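/- For every R > 0 and every integer k ≥ 0 there is exactly one α > 0 such that the solution u of the IVP with initial value α satisfies u(R) = 0 and u has exactly k zeros in the open interval (0, R). In other words, the radial Dirichlet problem Δu − u + |u|^{p−1}u = 0 on the ball of radius R with u = 0 on the boundary has a unique radial solution that changes sign exactly k times in the interior. -/

import Mathlib

open Real Filter Set

/-- The nonlinearity `f(s) = -s + |s|^(p-1) s`. -/
noncomputable def f (p s : ℝ) : ℝ := -s + |s| ^ (p - 1) * s

/-- The derivative of the nonlinearity, `f'(s) = -1 + p |s|^(p-1)`. -/
noncomputable def fder (p s : ℝ) : ℝ := -1 + p * |s| ^ (p - 1)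

/-- The primitive `F(s) = -s^2/2 + |s|^(p+1)/(p+1)`. -/
noncomputable def F (p s : ℝ) : ℝ := -s ^ 2 / 2 + |s| ^ (p + 1) / (p + 1)

/-- `u : [0,∞) → ℝ` (modeled on `Set.Ici 0`) is a C² solution of the IVP
`u'' + ((n-1)/r) u' + f(u) = 0`, `u(0) = α`, `u'(0) = 0`; the data `u'`, `u''`
are its first and second derivatives on `[0,∞)`. -/
structure IsSolution (n : ℕ) (p α : ℝ) (u u' u'' : ℝ → ℝ) : Prop where
  init : u 0 = α
  initDeriv : u' 0 = 0
  hasDeriv1 : ∀ r ∈ Set.Ici (0:ℝ), HasDerivWithinAt u (u' r) (Set.Ici 0) r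
  hasDeriv2 : ∀ r ∈ Set.Ici (0:ℝ), HasDerivWithinAt u' (u'' r) (Set.Ici 0) r
  cont2 : ContinuousOn u'' (Set.Ici 0)
  ode : ∀ r : ℝ, 0 < r → u'' r + ((n : ℝ) - 1) / r * u' r + f p (u r) = 0

/-- The variation `v` associated with a solution `u`: the C² solution of the linearized
equation `v'' + ((n-1)/r) v' + f'(u) v = 0`, `v(0) = 1`, `v'(0) = 0`. -/
structure IsVariation (n : ℕ) (p : ℝ) (u v v' v'' : ℝ → ℝ) : Prop where
  init : v 0 = 1
  initDeriv : v' 0 = 0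
  hasDeriv1 : ∀ r ∈ Set.Ici (0:ℝ), HasDerivWithinAt v (v' r) (Set.Ici 0) r
  hasDeriv2 : ∀ r ∈ Set.Ici (0:ℝ), HasDerivWithinAt v' (v'' r) (Set.Ici 0) r
  cont2 : ContinuousOn v'' (Set.Ici 0)
  ode : ∀ r : ℝ, 0 < r → v'' r + ((n : ℝ) - 1) / r * v' r + fder p (u r) * v r = 0

/-- `u` is decaying: `u(r) → 0` and `u'(r) → 0` as `r → ∞`. -/
def Decaying (u u' : ℝ → ℝ) : Prop :=
  Filter.Tendsto u Filter.atTop (nhds 0) ∧ Filter.Tendsto u' Filter.atTop (nhds 0)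

/-- `u` changes sign on `(0,∞)`. -/
def ChangesSign (u : ℝ → ℝ) : Prop :=
  (∃ r : ℝ, 0 < r ∧ u r < 0) ∧ (∃ r : ℝ, 0 < r ∧ 0 < u r)

/-- `z 0 < z 1 < ⋯ < z (k-1)` are exactly the zeros of `u` in `(0,∞)`. -/
def ExactZeros (u : ℝ → ℝ) (k : ℕ) (z : Fin k → ℝ) : Prop :=
  StrictMono z ∧ (∀ i, 0 < z i ∧ u (z i) = 0) ∧
    ∀ r : ℝ, 0 < r → u r = 0 → ∃ i, r = z i

lemma le_of_hasDerivAt_nonneg {g g' : ℝ → ℝ} {a b : ℝ} (hab : a ≤ b)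
    (hc : ContinuousOn g (Icc a b)) (hd : ∀ x ∈ Ioo a b, HasDerivAt g (g' x) x)
    (h : ∀ x ∈ Ioo a b, 0 ≤ g' x) : g a ≤ g b := by
  rcases hab.eq_or_lt with rfl | hlt
  · exact le_rfl
  · obtain ⟨c, hc', he⟩ := exists_hasDerivAt_eq_slope g g' hlt hc hd
    have h1 := h c hc'
    rw [he] at h1
    have h2 : 0 < b - a := sub_pos.2 hlt
    have := (div_nonneg_iff.1 h1)
    rcases this with h3 | h3 <;> linarith [h3.1, h3.2]

lemma lt_of_hasDerivAt_pos {g g' : ℝ → ℝ} {a b : ℝ} (hlt : a < b)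
    (hc : ContinuousOn g (Icc a b)) (hd : ∀ x ∈ Ioo a b, HasDerivAt g (g' x) x)
    (h : ∀ x ∈ Ioo a b, 0 < g' x) : g a < g b := by
  obtain ⟨c, hc', he⟩ := exists_hasDerivAt_eq_slope g g' hlt hc hd
  have h1 := h c hc'
  rw [he, lt_div_iff₀ (sub_pos.2 hlt)] at h1
  linarith

lemma le_of_hasDerivAt_nonpos {g g' : ℝ → ℝ} {a b : ℝ} (hab : a ≤ b)
    (hc : ContinuousOn g (Icc a b)) (hd : ∀ x ∈ Ioo a b, HasDerivAt g (g' x) x)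
    (h : ∀ x ∈ Ioo a b, g' x ≤ 0) : g b ≤ g a := by
  have := le_of_hasDerivAt_nonneg hab hc.neg (fun x hx => (hd x hx).neg)
    (fun x hx => neg_nonneg.2 (h x hx))
  simpa using this

lemma lt_of_hasDerivAt_neg {g g' : ℝ → ℝ} {a b : ℝ} (hlt : a < b)
    (hc : ContinuousOn g (Icc a b)) (hd : ∀ x ∈ Ioo a b, HasDerivAt g (g' x) x)
    (h : ∀ x ∈ Ioo a b, g' x < 0) : g b < g a := by
  have := lt_of_hasDerivAt_pos hlt hc.neg (fun x hx => (hd x hx).neg)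
    (fun x hx => neg_pos.2 (h x hx))
  simpa using this

/-- The first zero of a continuous function that is positive at `a` and not at `b`. -/
lemma exists_first_zero {g : ℝ → ℝ} {a b : ℝ} (hab : a ≤ b) (hc : ContinuousOn g (Icc a b))
    (ha : 0 < g a) (hb : g b ≤ 0) :
    ∃ r, a < r ∧ r ≤ b ∧ g r = 0 ∧ ∀ x, a ≤ x → x < r → 0 < g x := by
  have hcl : IsClosed (Icc a b ∩ g ⁻¹' Iic 0) :=
    hc.preimage_isClosed_of_isClosed isClosed_Icc isClosed_Iic
  have hne : (Icc a b ∩ g ⁻¹' Iic 0).Nonempty := ⟨b, ⟨hab, le_rfl⟩, hb⟩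
  have hbd : BddBelow (Icc a b ∩ g ⁻¹' Iic 0) := ⟨a, fun x hx => hx.1.1⟩
  have hm := hcl.csInf_mem hne hbd
  set r := sInf (Icc a b ∩ g ⁻¹' Iic 0) with hr
  have hpos : ∀ x, a ≤ x → x < r → 0 < g x := by
    intro x hx hxr
    by_contra hcon
    have : r ≤ x := csInf_le hbd ⟨⟨hx, hxr.le.trans hm.1.2⟩, not_lt.1 hcon⟩
    linarith
  have har : a < r := by
    rcases hm.1.1.eq_or_lt with h | h
    · exfalso
      have h2 : g r ≤ 0 := hm.2
      rw [← h] at h2; linarith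
    · exact h
  refine ⟨r, har, hm.1.2, ?_, hpos⟩
  apply le_antisymm hm.2
  have hcw : Tendsto g (nhdsWithin r (Ico a r)) (nhds (g r)) :=
    (hc r hm.1).mono_left (nhdsWithin_mono _ (fun x hx => ⟨hx.1, hx.2.le.trans hm.1.2⟩))
  have : (nhdsWithin r (Ico a r)).NeBot := by
    rw [← mem_closure_iff_nhdsWithin_neBot, closure_Ico har.ne]
    exact ⟨har.le, le_rfl⟩
  exact ge_of_tendsto hcw (eventually_nhdsWithin_of_forall fun x hx => (hpos x hx.1 hx.2).le)

/-- The last zero of a continuous function that is positive at `b` and not at `a`. -/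
lemma exists_last_zero {g : ℝ → ℝ} {a b : ℝ} (hab : a ≤ b) (hc : ContinuousOn g (Icc a b))
    (ha : g a ≤ 0) (hb : 0 < g b) :
    ∃ r, a ≤ r ∧ r < b ∧ g r = 0 ∧ ∀ x, r < x → x ≤ b → 0 < g x := by
  have hc' : ContinuousOn (fun x => g (-x)) (Icc (-b) (-a)) :=
    hc.comp continuous_neg.continuousOn (fun x hx => ⟨by linarith [hx.2], by linarith [hx.1]⟩)
  obtain ⟨r, h1, h2, h3, h4⟩ := exists_first_zero (g := fun x => g (-x)) (neg_le_neg hab) hc'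
    (by simpa using hb) (by simpa using ha)
  refine ⟨-r, by linarith, by linarith, h3, fun x hx hxb => ?_⟩
  have := h4 (-x) (by linarith) (by linarith)
  simpa using this

lemma hasDerivAt_eventually_right_neg {g : ℝ → ℝ} {d x : ℝ} (h : HasDerivAt g d x) (hd : d < 0)
    (hg : g x = 0) : ∃ ε > 0, ∀ y, x < y → y < x + ε → g y < 0 := by
  have h1 := h.tendsto_slope
  have h2 : ∀ᶠ y in nhdsWithin x {x}ᶜ, slope g x y < 0 := h1.eventually (gt_mem_nhds hd)
  rw [eventually_nhdsWithin_iff, Metric.eventually_nhds_iff] at h2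
  obtain ⟨ε, hε, h3⟩ := h2
  refine ⟨ε, hε, fun y hy hy2 => ?_⟩
  have h4 := h3 (y := y) (by rw [Real.dist_eq, abs_lt]; constructor <;> linarith) (by simp; linarith)
  rw [slope_def_field, hg, sub_zero, div_neg_iff] at h4
  rcases h4 with h4 | h4
  · linarith [h4.2]
  · exact h4.1

lemma hasDerivAt_eventually_left_pos {g : ℝ → ℝ} {d x : ℝ} (h : HasDerivAt g d x) (hd : d < 0)
    (hg : g x = 0) : ∃ ε > 0, ∀ y, x - ε < y → y < x → 0 < g y := by
  have h1 := h.tendsto_slope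
  have h2 : ∀ᶠ y in nhdsWithin x {x}ᶜ, slope g x y < 0 := h1.eventually (gt_mem_nhds hd)
  rw [eventually_nhdsWithin_iff, Metric.eventually_nhds_iff] at h2
  obtain ⟨ε, hε, h3⟩ := h2
  refine ⟨ε, hε, fun y hy hy2 => ?_⟩
  have h4 := h3 (y := y) (by rw [Real.dist_eq, abs_lt]; constructor <;> linarith) (by simp; linarith)
  rw [slope_def_field, hg, sub_zero, div_neg_iff] at h4
  rcases h4 with h4 | h4
  · exact h4.1
  · linarith [h4.2]

/-- If `g` vanishes at `x` and is positive just to the right, its derivative is nonnegative. -/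
lemma hasDerivAt_nonneg_of_right_nonneg {g : ℝ → ℝ} {d x b : ℝ} (h : HasDerivAt g d x)
    (hg : g x = 0) (hxb : x < b) (hp : ∀ y, x < y → y < b → 0 ≤ g y) : 0 ≤ d := by
  by_contra hd
  obtain ⟨ε, hε, h1⟩ := hasDerivAt_eventually_right_neg h (not_le.1 hd) hg
  have h2 := h1 (x + min ε (b - x) / 2) (by have : 0 < min ε (b - x) := lt_min hε (by linarith)
                                            linarith)
    (by have : min ε (b - x) ≤ ε := min_le_left _ _
        linarith)
  have h3 := hp (x + min ε (b - x) / 2) (by have : 0 < min ε (b - x) := lt_min hε (by linarith)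
                                            linarith)
    (by have : min ε (b - x) ≤ b - x := min_le_right _ _
        have : 0 < b - x := by linarith
        linarith)
  linarith

lemma hasDerivAt_abs_rpow_mul {p : ℝ} (hp : 1 < p) (s : ℝ) :
    HasDerivAt (fun s : ℝ => |s| ^ (p - 1) * s) (p * |s| ^ (p - 1)) s := by
  have hp1 : p ≠ 0 := by positivity
  rcases lt_trichotomy s 0 with h | h | h
  · have h1 : HasDerivAt (fun s : ℝ => -(-s) ^ p) (p * |s| ^ (p - 1)) s := by
      have := ((hasDerivAt_neg s).rpow_const (p := p) (Or.inr hp.le)).neg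
      refine this.congr_deriv ?_
      rw [abs_of_neg h]; simp
    refine h1.congr_of_eventuallyEq ?_
    filter_upwards [gt_mem_nhds h] with x hx
    rw [abs_of_neg hx, rpow_sub_one (by linarith)]
    have : -x ≠ 0 := by linarith
    have : x ≠ 0 := by linarith
    field_simp
  · subst h
    rw [abs_zero, zero_rpow (by linarith), mul_zero, hasDerivAt_iff_tendsto_slope]
    have h1 : Tendsto (fun s : ℝ => |s| ^ (p - 1)) (nhds 0) (nhds 0) := by
      have : Continuous (fun s : ℝ => |s| ^ (p - 1)) :=
        continuous_abs.rpow_const (fun _ => Or.inr (by linarith))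
      simpa [zero_rpow (show p - 1 ≠ 0 by linarith)] using this.tendsto 0
    refine (h1.mono_left nhdsWithin_le_nhds).congr' ?_
    filter_upwards [self_mem_nhdsWithin] with x hx
    have hx : x ≠ 0 := hx
    rw [slope_def_field]; simp; field_simp
  · have h1 : HasDerivAt (fun s : ℝ => s ^ p) (p * |s| ^ (p - 1)) s := by
      refine (Real.hasDerivAt_rpow_const (p := p) (Or.inr hp.le)).congr_deriv ?_
      rw [abs_of_pos h]
    refine h1.congr_of_eventuallyEq ?_
    filter_upwards [lt_mem_nhds h] with x hx
    rw [abs_of_pos hx, rpow_sub_one (by linarith)]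
    have : x ≠ 0 := by linarith
    field_simp

lemma abs_rpow_add_one {p : ℝ} (hp : 1 < p) (s : ℝ) : |s| ^ (p + 1) = s ^ 2 * |s| ^ (p - 1) := by
  rcases eq_or_ne s 0 with rfl | h
  · simp [zero_rpow (show p + 1 ≠ 0 by linarith)]
  · have h1 : 0 < |s| := abs_pos.2 h
    rw [show p + 1 = (p - 1) + 2 by ring, rpow_add h1, ← sq_abs s]
    norm_num [mul_comm]

lemma hasDerivAt_abs_rpow_add_one {p : ℝ} (hp : 1 < p) (s : ℝ) :
    HasDerivAt (fun s : ℝ => |s| ^ (p + 1) / (p + 1)) (|s| ^ (p - 1) * s) s := by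
  have := (hasDerivAt_abs_rpow s (p := p + 1) (by linarith)).div_const (p + 1)
  refine this.congr_deriv ?_
  have : p + 1 ≠ 0 := by linarith
  rw [show p + 1 - 2 = p - 1 by ring]; field_simp

lemma hasDerivAt_f {p : ℝ} (hp : 1 < p) (s : ℝ) : HasDerivAt (f p) (fder p s) s :=
  (hasDerivAt_id s).neg.add (hasDerivAt_abs_rpow_mul hp s)

lemma hasDerivAt_F {p : ℝ} (hp : 1 < p) (s : ℝ) : HasDerivAt (F p) (f p s) s := by
  have h1 : HasDerivAt (fun s : ℝ => -s ^ 2 / 2) (-s) s := by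
    refine ((hasDerivAt_pow 2 s).neg.div_const 2).congr_deriv ?_
    simp; ring
  exact h1.add (hasDerivAt_abs_rpow_add_one hp s)

lemma F_eq {p : ℝ} (hp : 1 < p) (s : ℝ) :
    F p s = -s ^ 2 / 2 + s ^ 2 * |s| ^ (p - 1) / (p + 1) := by
  rw [F, abs_rpow_add_one hp]

lemma f_neg (p s : ℝ) : f p (-s) = -f p s := by simp [f]; ring

lemma fder_neg (p s : ℝ) : fder p (-s) = fder p s := by simp [fder]

lemma F_neg (p s : ℝ) : F p (-s) = F p s := by simp [F]

lemma f_zero (p : ℝ) : f p 0 = 0 := by simp [f]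

lemma F_zero {p : ℝ} (hp : 1 < p) : F p 0 = 0 := by rw [F_eq hp]; simp

lemma continuous_f {p : ℝ} (hp : 1 < p) : Continuous (f p) :=
  continuous_iff_continuousAt.2 fun s => (hasDerivAt_f hp s).continuousAt

lemma continuous_F {p : ℝ} (hp : 1 < p) : Continuous (F p) :=
  continuous_iff_continuousAt.2 fun s => (hasDerivAt_F hp s).continuousAt

lemma continuous_abs_rpow {p : ℝ} (hp : 1 < p) : Continuous (fun s : ℝ => |s| ^ (p - 1)) :=
  continuous_abs.rpow_const (fun _ => Or.inr (by linarith))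

lemma continuous_fder {p : ℝ} (hp : 1 < p) : Continuous (fder p) :=
  continuous_const.add (continuous_const.mul (continuous_abs_rpow hp))

/-- `U'' + ((n-1)/r) U' + g(r) = 0` on `(0, ∞)`, with `U` and `U' = U1` continuous up to `0`. -/
structure Radial (n : ℕ) (g U U1 : ℝ → ℝ) : Prop where
  d0 : ∀ r, 0 < r → HasDerivAt U (U1 r) r
  d1 : ∀ r, 0 < r → HasDerivAt U1 (-(((n : ℝ) - 1) / r * U1 r) - g r) r
  c0 : ContinuousOn U (Ici 0)
  c1 : ContinuousOn U1 (Ici 0)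

lemma Radial.neg {n : ℕ} {g U U1 : ℝ → ℝ} (h : Radial n g U U1) :
    Radial n (fun r => -g r) (fun r => -U r) (fun r => -U1 r) where
  d0 r hr := (h.d0 r hr).neg
  d1 r hr := (h.d1 r hr).neg.congr_deriv (by ring)
  c0 := h.c0.neg
  c1 := h.c1.neg

lemma hasDerivAt_pow_pred {n : ℕ} (hn : 1 ≤ n) {r : ℝ} (hr : 0 < r) :
    HasDerivAt (fun r : ℝ => r ^ (n - 1)) (((n : ℝ) - 1) / r * r ^ (n - 1)) r := by
  refine (hasDerivAt_pow (n - 1) r).congr_deriv ?_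
  have h1 : ((n - 1 : ℕ) : ℝ) = (n : ℝ) - 1 := by push_cast [hn]; ring
  rw [h1]
  rcases Nat.eq_zero_or_pos (n - 1) with h | h
  · have : (n : ℝ) - 1 = 0 := by rw [← h1, h]; simp
    rw [this]; simp
  · obtain ⟨m, hm⟩ : ∃ m, n - 1 = m + 1 := ⟨n - 1 - 1, by omega⟩
    rw [hm, Nat.add_sub_cancel, pow_succ]; field_simp

/-- The energy. -/
noncomputable def energy (p : ℝ) (U U1 : ℝ → ℝ) (r : ℝ) : ℝ := U1 r ^ 2 / 2 + F p (U r)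

lemma hasDerivAt_energy {n : ℕ} {p : ℝ} (hp : 1 < p) {U U1 : ℝ → ℝ}
    (hU : Radial n (fun r => f p (U r)) U U1) {r : ℝ} (hr : 0 < r) :
    HasDerivAt (energy p U U1) (-(((n : ℝ) - 1) / r * U1 r ^ 2)) r := by
  have h1 := ((hU.d1 r hr).pow 2).div_const 2
  have h2 := (hasDerivAt_F hp (U r)).comp r (hU.d0 r hr)
  refine (h1.add h2).congr_deriv ?_
  simp; ring

lemma continuousOn_energy {n : ℕ} {p : ℝ} (hp : 1 < p) {U U1 : ℝ → ℝ}
    (hU : Radial n (fun r => f p (U r)) U U1) : ContinuousOn (energy p U U1) (Ici 0) :=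
  ((hU.c1.pow 2).div_const 2).add ((continuous_F hp).comp_continuousOn hU.c0)

lemma energy_le {n : ℕ} (hn : 1 ≤ n) {p : ℝ} (hp : 1 < p) {U U1 : ℝ → ℝ}
    (hU : Radial n (fun r => f p (U r)) U U1) {a b : ℝ} (ha : 0 ≤ a) (hab : a ≤ b) :
    energy p U U1 b ≤ energy p U U1 a := by
  have hn' : (1 : ℝ) ≤ n := by exact_mod_cast hn
  refine le_of_hasDerivAt_nonpos hab
    ((continuousOn_energy hp hU).mono fun x hx => ha.trans hx.1)
    (fun x hx => hasDerivAt_energy hp hU (ha.trans_lt hx.1)) fun x hx => ?_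
  have hx0 : 0 < x := ha.trans_lt hx.1
  have : 0 ≤ ((n : ℝ) - 1) / x * U1 x ^ 2 := by
    have : 0 ≤ (n : ℝ) - 1 := by linarith
    positivity
  linarith

/-- The Wronskian of the variation with `r U' + c U`, multiplied by `r^(n-1)`. -/
noncomputable def wron (n : ℕ) (p c : ℝ) (U U1 V V1 : ℝ → ℝ) (r : ℝ) : ℝ :=
  r ^ (n - 1) * (((c + 2 - n) * U1 r - r * f p (U r)) * V r - (r * U1 r + c * U r) * V1 r)

/-- The Wronskian of the variation with `U'`, multiplied by `r^(n-1)`. -/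
noncomputable def dwron (n : ℕ) (p : ℝ) (U U1 V V1 : ℝ → ℝ) (r : ℝ) : ℝ :=
  r ^ (n - 1) * (U1 r * V1 r + f p (U r) * V r) + (n - 1) * (r ^ (n - 2) * (U1 r * V r))

section pair

variable {n : ℕ} {p : ℝ} {U U1 V V1 : ℝ → ℝ}

lemma hasDerivAt_wron (hn : 1 ≤ n) (hp : 1 < p) (hU : Radial n (fun r => f p (U r)) U U1)
    (hV : Radial n (fun r => fder p (U r) * V r) V V1) (c : ℝ) {r : ℝ} (hr : 0 < r) :
    HasDerivAt (wron n p c U U1 V V1)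
      (r ^ (n - 1) * V r * (2 * U r - (2 - c * (p - 1)) * (|U r| ^ (p - 1) * U r))) r := by
  have hf : HasDerivAt (fun r => f p (U r)) (fder p (U r) * U1 r) r :=
    (hasDerivAt_f hp (U r)).comp r (hU.d0 r hr)
  have hw : HasDerivAt (fun r => (c + 2 - n) * U1 r - r * f p (U r)) _ r :=
    ((hU.d1 r hr).const_mul (c + 2 - (n : ℝ))).sub ((hasDerivAt_id' r).mul hf)
  have hz : HasDerivAt (fun r => r * U1 r + c * U r) _ r :=
    ((hasDerivAt_id' r).mul (hU.d1 r hr)).add ((hU.d0 r hr).const_mul c)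
  refine ((hasDerivAt_pow_pred hn hr).mul
    ((hw.mul (hV.d0 r hr)).sub (hz.mul (hV.d1 r hr)))).congr_deriv ?_
  simp only [f, fder, Pi.sub_apply, Pi.mul_apply]
  field_simp
  ring

lemma hasDerivAt_dwron (hn : 2 ≤ n) (hp : 1 < p) (hU : Radial n (fun r => f p (U r)) U U1)
    (hV : Radial n (fun r => fder p (U r) * V r) V V1) {r : ℝ} (hr : 0 < r) :
    HasDerivAt (dwron n p U U1 V V1) (-((n - 1) / r ^ 2 * (r ^ (n - 1) * (U1 r * V r)))) r := by
  have hf : HasDerivAt (fun r => f p (U r)) (fder p (U r) * U1 r) r :=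
    (hasDerivAt_f hp (U r)).comp r (hU.d0 r hr)
  have h2 : HasDerivAt (fun r : ℝ => r ^ (n - 2)) (((n : ℝ) - 2) / r * r ^ (n - 2)) r := by
    have := hasDerivAt_pow_pred (n := n - 1) (by omega) hr
    rw [show n - 1 - 1 = n - 2 by omega] at this
    refine this.congr_deriv ?_
    rw [Nat.cast_sub (by omega)]; push_cast; ring
  refine (((hasDerivAt_pow_pred (by omega) hr).mul (((hU.d1 r hr).mul (hV.d1 r hr)).add
    (hf.mul (hV.d0 r hr)))).add ((h2.mul ((hU.d1 r hr).mul (hV.d0 r hr))).const_mul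
      ((n : ℝ) - 1))).congr_deriv ?_
  obtain ⟨m, rfl⟩ : ∃ m, n = m + 2 := ⟨n - 2, by omega⟩
  simp only [Pi.add_apply, Pi.mul_apply, Nat.add_sub_cancel, show m + 2 - 1 = m + 1 by omega,
    pow_succ r m]
  push_cast
  field_simp
  ring

lemma continuousOn_wron (hp : 1 < p) (hU : Radial n (fun r => f p (U r)) U U1)
    (hV : Radial n (fun r => fder p (U r) * V r) V V1) (c : ℝ) :
    ContinuousOn (wron n p c U U1 V V1) (Ici 0) := by
  have h0 := hU.c0
  have h1 := hU.c1
  have h2 := hV.c0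
  have h3 := hV.c1
  have h4 : ContinuousOn (fun r => f p (U r)) (Ici 0) := (continuous_f hp).comp_continuousOn h0
  unfold wron
  fun_prop

lemma continuousOn_dwron (hp : 1 < p) (hU : Radial n (fun r => f p (U r)) U U1)
    (hV : Radial n (fun r => fder p (U r) * V r) V V1) :
    ContinuousOn (dwron n p U U1 V V1) (Ici 0) := by
  have h0 := hU.c0
  have h1 := hU.c1
  have h2 := hV.c0
  have h3 := hV.c1
  have h4 : ContinuousOn (fun r => f p (U r)) (Ici 0) := (continuous_f hp).comp_continuousOn h0
  unfold dwron
  fun_prop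

lemma wron_eq_dwron (hn : 2 ≤ n) (c r : ℝ) :
    wron n p c U U1 V V1 r = -(r * dwron n p U U1 V V1 r - (c + 1) * (r ^ (n - 1) * (U1 r * V r))
      + c * (r ^ (n - 1) * (U r * V1 r))) := by
  obtain ⟨m, rfl⟩ : ∃ m, n = m + 2 := ⟨n - 2, by omega⟩
  simp only [wron, dwron, Nat.add_sub_cancel, show m + 2 - 1 = m + 1 by omega, pow_succ r m]
  push_cast
  ring

/-- `r^(n-1) (U V' - V U')` is monotone decreasing where `U`, `V` are positive. -/
lemma hasDerivAt_crossWron (hn : 1 ≤ n) (hU : Radial n (fun r => f p (U r)) U U1)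
    (hV : Radial n (fun r => fder p (U r) * V r) V V1) {r : ℝ} (hr : 0 < r) :
    HasDerivAt (fun r => r ^ (n - 1) * (U r * V1 r - V r * U1 r))
      (-((p - 1) * (r ^ (n - 1) * (|U r| ^ (p - 1) * (U r * V r))))) r := by
  refine ((hasDerivAt_pow_pred hn hr).mul (((hU.d0 r hr).mul (hV.d1 r hr)).sub
    ((hV.d0 r hr).mul (hU.d1 r hr)))).congr_deriv ?_
  simp only [f, fder, Pi.sub_apply, Pi.mul_apply]
  field_simp
  ring

/-- The quotient `V / U'`. -/
lemma hasDerivAt_quot (hn : 2 ≤ n) (hU : Radial n (fun r => f p (U r)) U U1)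
    (hV : Radial n (fun r => fder p (U r) * V r) V V1) {r : ℝ} (hr : 0 < r) (h1 : U1 r ≠ 0) :
    HasDerivAt (fun r => V r / U1 r) (dwron n p U U1 V V1 r / (r ^ (n - 1) * U1 r ^ 2)) r := by
  refine ((hV.d0 r hr).div (hU.d1 r hr) h1).congr_deriv ?_
  obtain ⟨m, rfl⟩ : ∃ m, n = m + 2 := ⟨n - 2, by omega⟩
  simp only [dwron, Nat.add_sub_cancel, show m + 2 - 1 = m + 1 by omega, pow_succ r m]
  push_cast
  field_simp
  ring

/-- The weighted quotient `r^(n-1) V / U'`. -/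
lemma hasDerivAt_wquot (hn : 2 ≤ n) (hU : Radial n (fun r => f p (U r)) U U1)
    (hV : Radial n (fun r => fder p (U r) * V r) V V1) {r : ℝ} (hr : 0 < r) (h1 : U1 r ≠ 0) :
    HasDerivAt (fun r => r ^ (n - 1) * (V r / U1 r))
      (dwron n p U U1 V V1 r / U1 r ^ 2 + ((n : ℝ) - 1) / r * (r ^ (n - 1) * (V r / U1 r))) r := by
  refine ((hasDerivAt_pow_pred (by omega) hr).mul (hasDerivAt_quot hn hU hV hr h1)).congr_deriv ?_
  field_simp
  ring

/-- The Pohozaev function. -/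
lemma hasDerivAt_pohozaev (hn : 1 ≤ n) (hp : 1 < p) (hU : Radial n (fun r => f p (U r)) U U1)
    {r : ℝ} (hr : 0 < r) :
    HasDerivAt (fun r => r ^ (n - 1) * (r * energy p U U1 r + ((n : ℝ) - 2) / 2 * (U r * U1 r)))
      (r ^ (n - 1) * (U r ^ 2 * (-1 + (n / (p + 1) - ((n : ℝ) - 2) / 2) * |U r| ^ (p - 1)))) r := by
  refine ((hasDerivAt_pow_pred hn hr).mul (((hasDerivAt_id' r).mul
    (hasDerivAt_energy hp hU hr)).add (((hU.d0 r hr).mul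
      (hU.d1 r hr)).const_mul (((n : ℝ) - 2) / 2)))).congr_deriv ?_
  have : p + 1 ≠ 0 := by linarith
  simp only [f, F_eq hp, energy, Pi.add_apply, Pi.mul_apply]
  field_simp
  ring

end pair

section rise

variable {n : ℕ} {p : ℝ} {U U1 V V1 : ℝ → ℝ}

/-- The primitive of `2 s - κ |s|^(p-1) s`. -/
noncomputable def auxG (p κ s : ℝ) : ℝ := s ^ 2 - κ * (|s| ^ (p + 1) / (p + 1))

lemma auxG_eq (hp : 1 < p) (κ s : ℝ) :
    auxG p κ s = s ^ 2 * (1 - κ * |s| ^ (p - 1) / (p + 1)) := by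
  rw [auxG, abs_rpow_add_one hp]; ring

lemma auxG_zero (hp : 1 < p) (κ : ℝ) : auxG p κ 0 = 0 := by rw [auxG_eq hp]; simp

lemma auxG_nonneg (hp : 1 < p) {κ s : ℝ} (h : κ * |s| ^ (p - 1) ≤ p + 1) : 0 ≤ auxG p κ s := by
  rw [auxG_eq hp]
  refine mul_nonneg (sq_nonneg s) ?_
  rw [sub_nonneg, div_le_one (by linarith)]; exact h

lemma continuous_auxG (hp : 1 < p) (κ : ℝ) : Continuous (auxG p κ) := by
  have : Continuous (fun s : ℝ => |s| ^ (p + 1)) :=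
    continuous_abs.rpow_const (fun _ => Or.inr (by linarith))
  unfold auxG; fun_prop

lemma hasDerivAt_auxG (hp : 1 < p) (κ : ℝ) {g g' r : ℝ} {u : ℝ → ℝ} (h : HasDerivAt u g' r)
    (hg : u r = g) : HasDerivAt (fun r => auxG p κ (u r))
      ((2 * g - κ * (|g| ^ (p - 1) * g)) * g') r := by
  subst hg
  have h1 := (hasDerivAt_abs_rpow_add_one hp (u r)).comp r h
  refine ((h.pow 2).sub (h1.const_mul κ)).congr_deriv ?_
  simp; ring

lemma abs_rpow_le_of_le (hp : 1 < p) {x y : ℝ} (hx : 0 ≤ x) (hxy : x ≤ y) :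
    |x| ^ (p - 1) ≤ |y| ^ (p - 1) := by
  rw [abs_of_nonneg hx, abs_of_nonneg (hx.trans hxy)]
  exact rpow_le_rpow hx hxy (by linarith)

lemma energy_bound_of_dwron_eq_zero (hn : 2 ≤ n) (hp : 1 < p) {c r : ℝ} (hr : 0 < r)
    (h1 : U1 r ≠ 0) (hD : dwron n p U U1 V V1 r = 0) (hh : 0 < V r / U1 r)
    (hW : wron n p c U U1 V V1 r ≤
      r ^ (n - 1) * (V r / U1 r) * auxG p (2 - c * (p - 1)) (U r)) :
    2 * (1 + c) * energy p U U1 r + c * (((n : ℝ) - 1) / r * (U r * U1 r)) ≤ 0 := by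
  obtain ⟨m, rfl⟩ : ∃ m, n = m + 2 := ⟨n - 2, by omega⟩
  set φ := V r / U1 r with hφ
  have hV : V r = φ * U1 r := by rw [hφ]; field_simp
  have hR : 0 < r ^ m := pow_pos hr m
  simp only [dwron, wron, Nat.add_sub_cancel, show m + 2 - 1 = m + 1 by omega, pow_succ r m]
    at hD hW
  rw [hV] at hD hW
  have hV1 : r * V1 r = -(φ * (r * f p (U r) + (m + 1) * U1 r)) := by
    have : r ^ m * U1 r * (r * V1 r + (φ * (r * f p (U r) + (m + 1) * U1 r))) = 0 := by
      rw [← hD]; push_cast; ring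
    have := (mul_eq_zero.1 this).resolve_left (mul_ne_zero hR.ne' h1)
    linarith
  have hW2 : r ^ m * φ * (((c + 1) * (r * U1 r ^ 2) + c * (r * (U r * f p (U r))) +
      c * (m + 1) * (U r * U1 r)) - r * auxG p (2 - c * (p - 1)) (U r)) ≤ 0 := by
    have e : r ^ m * r * (((c + 2 - ((m + 2 : ℕ) : ℝ)) * U1 r - r * f p (U r)) * (φ * U1 r) -
        (r * U1 r + c * U r) * V1 r) = r ^ m * ((r * ((c + 2 - ((m + 2 : ℕ) : ℝ)) * U1 r
          - r * f p (U r)) * (φ * U1 r) - (r * U1 r + c * U r) * (r * V1 r))) := by ring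
    rw [e, hV1] at hW
    have : r ^ m * ((r * ((c + 2 - ((m + 2 : ℕ) : ℝ)) * U1 r
          - r * f p (U r)) * (φ * U1 r) - (r * U1 r + c * U r) *
            (-(φ * (r * f p (U r) + (m + 1) * U1 r))))) - r ^ m * r * φ *
              auxG p (2 - c * (p - 1)) (U r) = r ^ m * φ * (((c + 1) * (r * U1 r ^ 2) +
                c * (r * (U r * f p (U r))) +
      c * (m + 1) * (U r * U1 r)) - r * auxG p (2 - c * (p - 1)) (U r)) := by
      push_cast; ring
    linarith
  have h3 := nonpos_of_mul_nonpos_right hW2 (mul_pos hR hh)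
  have h4 : auxG p (2 - c * (p - 1)) (U r) = c * (U r * f p (U r)) - 2 * (1 + c) * F p (U r) := by
    have : p + 1 ≠ 0 := by linarith
    rw [auxG_eq hp, F_eq hp, f]; field_simp; ring
  rw [h4] at h3
  have h5 : r * (2 * (1 + c) * energy p U U1 r + c * ((((m + 2 : ℕ) : ℝ) - 1) / r * (U r * U1 r)))
      ≤ 0 := by
    rw [energy]
    have : r * (2 * (1 + c) * (U1 r ^ 2 / 2 + F p (U r)) +
        c * ((((m + 2 : ℕ) : ℝ) - 1) / r * (U r * U1 r))) = (c + 1) * (r * U1 r ^ 2) +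
          r * (2 * (1 + c) * F p (U r)) + c * (m + 1) * (U r * U1 r) := by
      push_cast; field_simp; ring
    rw [this]; linarith
  exact nonpos_of_mul_nonpos_right h5 hr

lemma continuousOn_Icc_of_hasDerivAt {g g' : ℝ → ℝ} {a b : ℝ}
    (h : ∀ x, a ≤ x → x ≤ b → HasDerivAt g (g' x) x) : ContinuousOn g (Icc a b) :=
  fun x hx => (h x hx.1 hx.2).continuousAt.continuousWithinAt

/-- The weighted quotient minus the Wronskian: its derivative has a sign when `dwron ≥ 0`. -/
lemma hasDerivAt_wquot_mul_sub_wron (hn : 2 ≤ n) (hp : 1 < p)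
    (hU : Radial n (fun r => f p (U r)) U U1)
    (hV : Radial n (fun r => fder p (U r) * V r) V V1) (c : ℝ) {r : ℝ} (hr : 0 < r)
    (h1 : U1 r ≠ 0) :
    HasDerivAt (fun r => r ^ (n - 1) * (V r / U1 r) * auxG p (2 - c * (p - 1)) (U r) -
      wron n p c U U1 V V1 r)
      ((dwron n p U U1 V V1 r / U1 r ^ 2 + ((n : ℝ) - 1) / r * (r ^ (n - 1) * (V r / U1 r))) *
        auxG p (2 - c * (p - 1)) (U r)) r := by
  refine (((hasDerivAt_wquot hn hU hV hr h1).mul (hasDerivAt_auxG hp (2 - c * (p - 1))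
    (hU.d0 r hr) rfl)).sub (hasDerivAt_wron (by omega) hp hU hV c hr)).congr_deriv ?_
  field_simp
  ring

/-- The Wronskian minus a multiple of `auxG`. -/
lemma hasDerivAt_wron_sub_auxG (hn : 2 ≤ n) (hp : 1 < p)
    (hU : Radial n (fun r => f p (U r)) U U1)
    (hV : Radial n (fun r => fder p (U r) * V r) V V1) (c h : ℝ) {r : ℝ} (hr : 0 < r)
    (h1 : U1 r ≠ 0) :
    HasDerivAt (fun r => wron n p c U U1 V V1 r - h * auxG p (2 - c * (p - 1)) (U r))
      ((r ^ (n - 1) * (V r / U1 r) - h) * (U r * (2 - (2 - c * (p - 1)) * |U r| ^ (p - 1))) * U1 r)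
        r := by
  refine ((hasDerivAt_wron (by omega) hp hU hV c hr).sub ((hasDerivAt_auxG hp (2 - c * (p - 1))
    (hU.d0 r hr) rfl).const_mul h)).congr_deriv ?_
  field_simp

lemma rise (hn : 2 ≤ n) (hp : 1 < p) (hU : Radial n (fun r => f p (U r)) U U1)
    (hV : Radial n (fun r => fder p (U r) * V r) V V1) {a m c : ℝ} (ha : 0 < a) (ham : a < m)
    (hUa : U a = 0) (hUpos : ∀ r, a < r → r ≤ m → 0 < U r)
    (hU1pos : ∀ r, a ≤ r → r < m → 0 < U1 r) (hU1m : U1 m = 0) (hVa : 0 < V a)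
    (hE : ∀ r, a ≤ r → r ≤ m → 0 < energy p U U1 r) (hc : 0 < c)
    (hκ : (2 - c * (p - 1)) * |U m| ^ (p - 1) = p + 1) (hW : wron n p c U U1 V V1 a ≤ 0) :
    0 < V m ∧ V1 m < 0 ∧ wron n p c U U1 V V1 m ≤ 0 := by
  have hn1 : (0 : ℝ) < (n : ℝ) - 1 := by
    have : (2 : ℝ) ≤ n := by exact_mod_cast hn
    linarith
  have hUm : 0 < U m := hUpos m ham le_rfl
  have hκ0 : 0 < 2 - c * (p - 1) := by
    have : 0 < |U m| ^ (p - 1) := rpow_pos_of_pos (abs_pos.2 hUm.ne') _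
    by_contra h
    have := mul_nonpos_of_nonpos_of_nonneg (not_lt.1 h) this.le
    linarith
  have hpos : ∀ x, a ≤ x → 0 < x := fun x hx => ha.trans_le hx
  have hsub : ∀ {x y}, a ≤ x → Icc x y ⊆ Ici (0 : ℝ) := fun hx z hz => (hpos _ (hx.trans hz.1)).le
  have hUnn : ∀ r, a ≤ r → r ≤ m → 0 ≤ U r := by
    intro r h1 h2
    rcases h1.eq_or_lt with rfl | h
    · exact hUa.ge
    · exact (hUpos r h h2).le
  have hUmono : ∀ x y, a ≤ x → x ≤ y → y ≤ m → U x ≤ U y := fun x y hx hxy hy =>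
    le_of_hasDerivAt_nonneg hxy (hU.c0.mono (hsub hx))
      (fun z hz => hU.d0 z (hpos z (hx.trans hz.1.le)))
      (fun z hz => (hU1pos z (hx.trans hz.1.le) (hz.2.trans_le hy)).le)
  have hGnn : ∀ r, a ≤ r → r ≤ m → 0 ≤ auxG p (2 - c * (p - 1)) (U r) := by
    intro r h1 h2
    refine auxG_nonneg hp ?_
    rw [← hκ]
    exact mul_le_mul_of_nonneg_left (abs_rpow_le_of_le hp (hUnn r h1 h2) (hUmono r m h1 h2 le_rfl))
      hκ0.le
  -- monotonicity of the quotient where the Wronskian is positive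
  have hquot : ∀ b, b < m → (∀ r, a ≤ r → r < b → 0 < dwron n p U U1 V V1 r) →
      ∀ r, a ≤ r → r ≤ b → 0 < V r := by
    intro b hbm hD r hr1 hr2
    have hmono := le_of_hasDerivAt_nonneg hr1
      (continuousOn_Icc_of_hasDerivAt fun x h1 h2 =>
        hasDerivAt_quot hn hU hV (hpos x h1) (hU1pos x h1 (by linarith)).ne')
      (fun x hx => hasDerivAt_quot hn hU hV (hpos x hx.1.le)
        (hU1pos x hx.1.le (by linarith [hx.2])).ne')
      (fun x hx => div_nonneg (hD x hx.1.le (by linarith [hx.2])).le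
        (mul_nonneg (pow_nonneg (hpos x hx.1.le).le _) (sq_nonneg _)))
    have h2 : 0 < V a / U1 a := div_pos hVa (hU1pos a le_rfl ham)
    have h3 := (div_pos_iff_of_pos_right (hU1pos r hr1 (by linarith))).1 (h2.trans_le hmono)
    exact h3
  have hD : ∀ r, a ≤ r → r < m → 0 < dwron n p U U1 V V1 r := by
    have hDa : 0 < dwron n p U U1 V V1 a := by
      have := wron_eq_dwron (p := p) (U := U) (U1 := U1) (V := V) (V1 := V1) hn c a
      rw [hUa] at this
      have h2 : 0 < (c + 1) * (a ^ (n - 1) * (U1 a * V a)) := by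
        have := hU1pos a le_rfl ham
        positivity
      have : 0 < a * dwron n p U U1 V V1 a := by nlinarith
      exact (mul_pos_iff_of_pos_left ha).1 this
    by_contra! hcon
    obtain ⟨x, hx1, hx2, hx3⟩ := hcon
    obtain ⟨r1, h1, h2, h3, h4⟩ := exists_first_zero hx1
      ((continuousOn_dwron hp hU hV).mono (hsub le_rfl)) hDa hx3
    have hr1m : r1 < m := by linarith
    have hVp := hquot r1 hr1m h4
    have hU1p := hU1pos r1 h1.le hr1m
    have hmono := le_of_hasDerivAt_nonneg h1.le
      (continuousOn_Icc_of_hasDerivAt fun x hx1 hx2 =>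
        hasDerivAt_wquot_mul_sub_wron hn hp hU hV c (hpos x hx1) (hU1pos x hx1 (by linarith)).ne')
      (fun x hx => hasDerivAt_wquot_mul_sub_wron hn hp hU hV c (hpos x hx.1.le)
        (hU1pos x hx.1.le (by linarith [hx.2])).ne')
      (fun x hx => by
        have hx0 := hpos x hx.1.le
        have e1 := h4 x hx.1.le hx.2
        have e2 := hVp x hx.1.le hx.2.le
        have e3 := hU1pos x hx.1.le (by linarith [hx.2])
        have e4 := hGnn x hx.1.le (by linarith [hx.2])
        positivity)
    simp only [hUa, auxG_zero hp, mul_zero, zero_sub] at hmono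
    have hfin := energy_bound_of_dwron_eq_zero (c := c) hn hp (hpos r1 h1.le) hU1p.ne' h3
      (div_pos (hVp r1 h1.le le_rfl) hU1p) (by linarith)
    have e1 := hE r1 h1.le hr1m.le
    have e2 := hUpos r1 h1 hr1m.le
    have e3 := hpos r1 h1.le
    have : 0 < 2 * (1 + c) * energy p U U1 r1 + c * (((n : ℝ) - 1) / r1 * (U r1 * U1 r1)) := by
      positivity
    linarith
  have hVpos : ∀ r, a ≤ r → r < m → 0 < V r := fun r h1 h2 =>
    hquot r h2 (fun x hx1 hx2 => hD x hx1 (hx2.trans h2)) r h1 le_rfl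
  have hhmono : ∀ x y, a ≤ x → x ≤ y → y < m →
      x ^ (n - 1) * (V x / U1 x) ≤ y ^ (n - 1) * (V y / U1 y) := by
    intro x y hx hxy hy
    refine le_of_hasDerivAt_nonneg (g := fun r => r ^ (n - 1) * (V r / U1 r)) hxy
      (continuousOn_Icc_of_hasDerivAt fun z h1 h2 =>
        hasDerivAt_wquot hn hU hV (hpos z (hx.trans h1)) (hU1pos z (hx.trans h1) (by linarith)).ne')
      (fun z hz => hasDerivAt_wquot hn hU hV (hpos z (hx.trans hz.1.le))
        (hU1pos z (hx.trans hz.1.le) (by linarith [hz.2])).ne') (fun z hz => ?_)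
    have e0 := hpos z (hx.trans hz.1.le)
    have e1 := hD z (hx.trans hz.1.le) (by linarith [hz.2])
    have e2 := hVpos z (hx.trans hz.1.le) (by linarith [hz.2])
    have e3 := hU1pos z (hx.trans hz.1.le) (by linarith [hz.2])
    positivity
  -- the point where the integrand changes sign
  obtain ⟨s, hs, hsκ⟩ : ∃ s ∈ Icc a m, (2 - c * (p - 1)) * |U s| ^ (p - 1) = 2 := by
    have hcont : ContinuousOn (fun r => (2 - c * (p - 1)) * |U r| ^ (p - 1)) (Icc a m) :=
      continuousOn_const.mul ((continuous_abs_rpow hp).comp_continuousOn (hU.c0.mono (hsub le_rfl)))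
    have := intermediate_value_Icc ham.le hcont
    refine this ⟨?_, ?_⟩
    · simp only [hUa, abs_zero]; rw [zero_rpow (by linarith)]; norm_num
    · simp only [hκ]; linarith
  have hsm : s < m := by
    rcases hs.2.eq_or_lt with h | h
    · rw [h, hκ] at hsκ; linarith
    · exact h
  have hWm : wron n p c U U1 V V1 m ≤ 0 := by
    have hcont : ContinuousOn (fun r => wron n p c U U1 V V1 r - (s ^ (n - 1) * (V s / U1 s)) *
        auxG p (2 - c * (p - 1)) (U r)) (Icc a m) :=
      ((continuousOn_wron hp hU hV c).sub (continuousOn_const.mul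
        ((continuous_auxG hp _).comp_continuousOn hU.c0))).mono (hsub le_rfl)
    have := le_of_hasDerivAt_nonpos ham.le hcont
      (fun x hx => hasDerivAt_wron_sub_auxG hn hp hU hV c _ (hpos x hx.1.le)
        (hU1pos x hx.1.le hx.2).ne') (fun x hx => by
          have e3 := hU1pos x hx.1.le hx.2
          have e4 := hUpos x hx.1 hx.2.le
          refine mul_nonpos_of_nonpos_of_nonneg ?_ e3.le
          rcases le_total x s with h | h
          · refine mul_nonpos_of_nonpos_of_nonneg (sub_nonpos.2 (hhmono x s hx.1.le h hsm))
              (mul_nonneg e4.le (sub_nonneg.2 ?_))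
            exact (mul_le_mul_of_nonneg_left (abs_rpow_le_of_le hp e4.le
              (hUmono x s hx.1.le h hs.2)) hκ0.le).trans_eq hsκ
          · refine mul_nonpos_of_nonneg_of_nonpos (sub_nonneg.2 (hhmono s x hs.1 h hx.2))
              (mul_nonpos_of_nonneg_of_nonpos e4.le (sub_nonpos.2 ?_))
            exact hsκ.symm.trans_le (mul_le_mul_of_nonneg_left (abs_rpow_le_of_le hp
              (hUnn s hs.1 hs.2) (hUmono s x hs.1 h hx.2.le)) hκ0.le))
    have hGm : auxG p (2 - c * (p - 1)) (U m) = 0 := by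
      rw [auxG_eq hp, hκ, div_self (by linarith)]; ring
    simp only [hUa, auxG_zero hp, hGm, mul_zero, sub_zero] at this
    linarith
  have hV1m : V1 m < 0 := by
    have hcont : ContinuousOn (fun r => r ^ (n - 1) * (U r * V1 r - V r * U1 r)) (Ici 0) := by
      have h0 := hU.c0
      have h1 := hU.c1
      have h2 := hV.c0
      have h3 := hV.c1
      fun_prop
    have := le_of_hasDerivAt_nonpos ham.le (hcont.mono (hsub le_rfl))
      (fun x hx => hasDerivAt_crossWron (by omega) hU hV (hpos x hx.1.le)) (fun x hx => by
        have e0 := hpos x hx.1.le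
        have e1 := hVpos x hx.1.le hx.2
        have e2 := hUpos x hx.1 hx.2.le
        have e3 : 0 < p - 1 := by linarith
        have : 0 ≤ (p - 1) * (x ^ (n - 1) * (|U x| ^ (p - 1) * (U x * V x))) := by positivity
        linarith)
    simp only [hUa, hU1m, zero_mul, zero_sub, mul_zero, sub_zero] at this
    have e1 : 0 < a ^ (n - 1) * (V a * U1 a) := by
      have := hU1pos a le_rfl ham
      positivity
    have e2 : 0 < m ^ (n - 1) * U m := by
      have := hpos m ham.le
      positivity
    by_contra hcon
    have := mul_nonneg e2.le (not_lt.1 hcon)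
    linarith
  refine ⟨?_, hV1m, hWm⟩
  by_contra hcon
  have hVm : V m ≤ 0 := not_lt.1 hcon
  have hVm0 : V m = 0 := by
    refine le_antisymm hVm ?_
    have hne : (nhdsWithin m (Ico a m)).NeBot := by
      rw [← mem_closure_iff_nhdsWithin_neBot, closure_Ico ham.ne]
      exact ⟨ham.le, le_rfl⟩
    have hcw : Tendsto V (nhdsWithin m (Ico a m)) (nhds (V m)) :=
      (hV.d0 m (hpos m ham.le)).continuousAt.continuousWithinAt
    exact ge_of_tendsto hcw (eventually_nhdsWithin_of_forall fun x hx => (hVpos x hx.1 hx.2).le)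
  rw [wron, hVm0, hU1m] at hWm
  have e2 : 0 < m ^ (n - 1) * (c * U m) := by
    have := hpos m ham.le
    positivity
  have := mul_neg_of_pos_of_neg e2 hV1m
  have e3 : m ^ (n - 1) * (((c + 2 - ↑n) * 0 - m * f p (U m)) * 0 - (m * 0 + c * U m) * V1 m) =
    -(m ^ (n - 1) * (c * U m) * V1 m) := by ring
  linarith

end rise

/-- A decreasing nodal half-interval `[m, b]` of `U`, from a critical point to a zero,
together with a solution `V` of the linearized equation that is positive at `m`. -/
structure Fall (n : ℕ) (p : ℝ) (U U1 V V1 : ℝ → ℝ) (m b : ℝ) : Prop where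
  hn : 3 ≤ n
  hp : 1 < p
  hU : Radial n (fun r => f p (U r)) U U1
  hV : Radial n (fun r => fder p (U r) * V r) V V1
  hm : 0 ≤ m
  hmb : m < b
  Upos : ∀ r, m ≤ r → r < b → 0 < U r
  Ub : U b = 0
  U1m : U1 m = 0
  U1neg : ∀ r, m < r → r ≤ b → U1 r < 0
  E : ∀ r, m ≤ r → r ≤ b → 0 < energy p U U1 r
  Vm : 0 < V m
  V1m : V1 m ≤ 0
  sub : 0 < (n : ℝ) / (p + 1) - ((n : ℝ) - 2) / 2

/-- The exponent attached to the height `B` with `B^(p-1) = β`. -/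
noncomputable def expo (p β : ℝ) : ℝ := (2 - (p + 1) / β) / (p - 1)

lemma two_sub_expo {p : ℝ} (hp : 1 < p) (β : ℝ) : 2 - expo p β * (p - 1) = (p + 1) / β := by
  have : p - 1 ≠ 0 := by linarith
  rw [expo]; field_simp; ring

lemma expo_pos {p : ℝ} (hp : 1 < p) {β : ℝ} (h : (p + 1) / 2 < β) : 0 < expo p β := by
  have : 0 < β := by linarith
  refine div_pos ?_ (by linarith)
  rw [sub_pos, div_lt_iff₀ this]; linarith

lemma expo_mono {p : ℝ} (hp : 1 < p) {β β' : ℝ} (h0 : 0 < β) (h : β ≤ β') :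
    expo p β ≤ expo p β' := by
  unfold expo
  have : (p + 1) / β' ≤ (p + 1) / β := div_le_div_of_nonneg_left (by linarith) h0 h
  exact div_le_div_of_nonneg_right (by linarith) (by linarith)

lemma half_lt_abs_rpow_of_F_pos {p : ℝ} (hp : 1 < p) {s : ℝ} (h : 0 < F p s) :
    (p + 1) / 2 < |s| ^ (p - 1) := by
  rw [F_eq hp] at h
  have h1 : 0 < s ^ 2 * (|s| ^ (p - 1) - (p + 1) / 2) := by
    have e : s ^ 2 * (|s| ^ (p - 1) - (p + 1) / 2) =
        (p + 1) * (-s ^ 2 / 2 + s ^ 2 * |s| ^ (p - 1) / (p + 1)) := by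
      have : p + 1 ≠ 0 := by linarith
      field_simp; ring
    rw [e]; exact mul_pos (by linarith) h
  have := (pos_iff_pos_of_mul_pos h1).1
  rcases (sq_nonneg s).eq_or_lt with h2 | h2
  · rw [← h2] at h1; simp at h1
  · linarith [this h2]

lemma f_pos_of_F_pos {p : ℝ} (hp : 1 < p) {s : ℝ} (hs : 0 < s) (h : 0 < F p s) : 0 < f p s := by
  have h1 := half_lt_abs_rpow_of_F_pos hp h
  have : f p s = s * (|s| ^ (p - 1) - 1) := by rw [f]; ring
  rw [this]
  exact mul_pos hs (by linarith)

namespace Fall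

variable {n : ℕ} {p : ℝ} {U U1 V V1 : ℝ → ℝ} {m b : ℝ}

lemma pos (H : Fall n p U U1 V V1 m b) {x : ℝ} (hx : m < x) : 0 < x := H.hm.trans_lt hx

lemma subset (H : Fall n p U U1 V V1 m b) {x y : ℝ} (hx : m ≤ x) : Icc x y ⊆ Ici (0 : ℝ) :=
  fun _ hz => H.hm.trans (hx.trans hz.1)

lemma nn (H : Fall n p U U1 V V1 m b) : (2 : ℝ) < n := by
  have : (3 : ℝ) ≤ n := by exact_mod_cast H.hn
  linarith

lemma Unn (H : Fall n p U U1 V V1 m b) {r : ℝ} (h1 : m ≤ r) (h2 : r ≤ b) : 0 ≤ U r := by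
  rcases h2.eq_or_lt with rfl | h
  · exact H.Ub.ge
  · exact (H.Upos r h1 h).le

lemma anti (H : Fall n p U U1 V V1 m b) {x y : ℝ} (hx : m ≤ x) (hxy : x ≤ y) (hy : y ≤ b) :
    U y ≤ U x :=
  le_of_hasDerivAt_nonpos hxy (H.hU.c0.mono (H.subset hx))
    (fun z hz => H.hU.d0 z (H.pos (hx.trans_lt hz.1)))
    (fun z hz => (H.U1neg z (hx.trans_lt hz.1) (hz.2.le.trans hy)).le)

lemma q_anti (H : Fall n p U U1 V V1 m b) {x y : ℝ} (hx : m ≤ x) (hxy : x ≤ y) (hy : y ≤ b) :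
    |U y| ^ (p - 1) ≤ |U x| ^ (p - 1) :=
  abs_rpow_le_of_le H.hp (H.Unn (hx.trans hxy) hy) (H.anti hx hxy hy)

lemma continuousOn_cross (H : Fall n p U U1 V V1 m b) :
    ContinuousOn (fun r => r ^ (n - 1) * (U r * V1 r - V r * U1 r)) (Ici 0) := by
  have h0 := H.hU.c0
  have h1 := H.hU.c1
  have h2 := H.hV.c0
  have h3 := H.hV.c1
  fun_prop

lemma exists_tau (H : Fall n p U U1 V V1 m b) :
    ∃ τ, m < τ ∧ τ < b ∧ V τ = 0 ∧ (∀ r, m ≤ r → r < τ → 0 < V r) ∧ V1 τ < 0 := by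
  have key : ∀ x, m < x → x ≤ b → (∀ r, m ≤ r → r < x → 0 < V r) →
      x ^ (n - 1) * (U x * V1 x - V x * U1 x) < 0 := by
    intro x hx hxb hpos
    have := lt_of_hasDerivAt_neg hx (H.continuousOn_cross.mono (H.subset le_rfl))
      (fun z hz => hasDerivAt_crossWron (by have := H.hn; omega) H.hU H.hV (H.pos hz.1))
      (fun z hz => by
        have e0 := H.pos hz.1
        have e1 := hpos z hz.1.le hz.2
        have e2 := H.Upos z hz.1.le (hz.2.trans_le hxb)
        have e3 : 0 < p - 1 := by linarith [H.hp]
        have e4 : 0 < |U z| ^ (p - 1) := rpow_pos_of_pos (abs_pos.2 e2.ne') _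
        have : 0 < (p - 1) * (z ^ (n - 1) * (|U z| ^ (p - 1) * (U z * V z))) := by positivity
        linarith)
    refine this.trans_le ?_
    rw [H.U1m, mul_zero, sub_zero]
    exact mul_nonpos_of_nonneg_of_nonpos (pow_nonneg H.hm _)
      (mul_nonpos_of_nonneg_of_nonpos (H.Unn le_rfl H.hmb.le) H.V1m)
  obtain ⟨x, hx1, hx2, hx3⟩ : ∃ x, m ≤ x ∧ x < b ∧ V x ≤ 0 := by
    by_contra! hcon
    have h1 := key b H.hmb le_rfl hcon
    rw [H.Ub, zero_mul, zero_sub] at h1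
    have hb0 := H.pos H.hmb
    have hVb : 0 ≤ V b := by
      have hne : (nhdsWithin b (Ico m b)).NeBot := by
        rw [← mem_closure_iff_nhdsWithin_neBot, closure_Ico H.hmb.ne]
        exact ⟨H.hmb.le, le_rfl⟩
      have hcw : Tendsto V (nhdsWithin b (Ico m b)) (nhds (V b)) :=
        (H.hV.d0 b hb0).continuousAt.continuousWithinAt
      exact ge_of_tendsto hcw (eventually_nhdsWithin_of_forall fun x hx => (hcon x hx.1 hx.2).le)
    have h2 := mul_nonneg (pow_nonneg hb0.le (n - 1))
      (mul_nonneg hVb (neg_nonneg.2 (H.U1neg b H.hmb le_rfl).le))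
    linarith
  obtain ⟨τ, h1, h2, h3, h4⟩ := exists_first_zero hx1 (H.hV.c0.mono (H.subset le_rfl)) H.Vm hx3
  refine ⟨τ, h1, by linarith, h3, h4, ?_⟩
  have h5 := key τ h1 (by linarith) h4
  rw [h3, zero_mul, sub_zero] at h5
  have h6 : 0 < τ ^ (n - 1) * U τ := mul_pos (pow_pos (H.pos h1) _) (H.Upos τ h1.le (by linarith))
  by_contra hcon
  have := mul_nonneg h6.le (not_lt.1 hcon)
  linarith

lemma pohozaev_nonneg (H : Fall n p U U1 V V1 m b) {r : ℝ} (h1 : m < r) (h2 : r < b) :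
    0 ≤ r * energy p U U1 r + ((n : ℝ) - 2) / 2 * (U r * U1 r) := by
  set N := fun r => r ^ (n - 1) * (r * energy p U U1 r + ((n : ℝ) - 2) / 2 * (U r * U1 r)) with hN
  have hc : ContinuousOn N (Ici 0) := by
    have h0 := H.hU.c0
    have h1 := H.hU.c1
    have h2 := continuousOn_energy H.hp H.hU
    simp only [hN]
    fun_prop
  have hd : ∀ z, m < z → HasDerivAt N _ z := fun z hz =>
    hasDerivAt_pohozaev (by have := H.hn; omega) H.hp H.hU (H.pos hz)
  have hNm : 0 ≤ N m := by
    simp only [hN, H.U1m, mul_zero, add_zero]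
    exact mul_nonneg (pow_nonneg H.hm _) (mul_nonneg H.hm (H.E m le_rfl H.hmb.le).le)
  have hNb : 0 ≤ N b := by
    simp only [hN, H.Ub, zero_mul, mul_zero, add_zero]
    have := H.pos H.hmb
    exact mul_nonneg (pow_nonneg this.le _) (mul_nonneg this.le (H.E b H.hmb.le le_rfl).le)
  have hr0 := H.pos h1
  have hNr : 0 ≤ N r := by
    rcases le_total 0 (-1 + ((n : ℝ) / (p + 1) - ((n : ℝ) - 2) / 2) * |U r| ^ (p - 1)) with h | h
    · refine hNm.trans (le_of_hasDerivAt_nonneg h1.le (hc.mono (H.subset le_rfl))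
        (fun z hz => hd z hz.1) (fun z hz => ?_))
      refine mul_nonneg (pow_nonneg (H.pos hz.1).le _) (mul_nonneg (sq_nonneg _) (h.trans ?_))
      have := mul_le_mul_of_nonneg_left (H.q_anti hz.1.le hz.2.le h2.le) H.sub.le
      linarith
    · refine hNb.trans (le_of_hasDerivAt_nonpos h2.le (hc.mono (H.subset h1.le))
        (fun z hz => hd z (h1.trans hz.1)) (fun z hz => ?_))
      refine mul_nonpos_of_nonneg_of_nonpos (pow_nonneg (H.pos (h1.trans hz.1)).le _)
        (mul_nonpos_of_nonneg_of_nonpos (sq_nonneg _) (le_trans ?_ h))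
      have := mul_le_mul_of_nonneg_left (H.q_anti h1.le hz.1.le hz.2.le) H.sub.le
      linarith
  exact nonneg_of_mul_nonneg_right hNr (pow_pos hr0 _)

lemma theta_anti (H : Fall n p U U1 V V1 m b) {x y : ℝ} (hx : m < x) (hxy : x ≤ y) (hy : y < b) :
    y * U1 y / U y ≤ x * U1 x / U x := by
  have hd : ∀ z, x ≤ z → z ≤ y → HasDerivAt (fun z => z * U1 z / U z)
      (((2 - n) * (U z * U1 z) - z * (U z * f p (U z)) - z * U1 z ^ 2) / U z ^ 2) z := by
    intro z h1 h2
    have hz0 := H.pos (hx.trans_le h1)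
    have hUz := H.Upos z (hx.le.trans h1) (by linarith)
    refine (((hasDerivAt_id' z).mul (H.hU.d1 z hz0)).div (H.hU.d0 z hz0) hUz.ne').congr_deriv ?_
    simp only [Pi.mul_apply]
    field_simp
    ring
  refine le_of_hasDerivAt_nonpos (g := fun z => z * U1 z / U z) hxy
    (continuousOn_Icc_of_hasDerivAt hd) (fun z hz => hd z hz.1.le hz.2.le) (fun z hz => ?_)
  refine div_nonpos_of_nonpos_of_nonneg ?_ (sq_nonneg _)
  have hz0 := H.pos (hx.trans hz.1)
  have h1 := H.pohozaev_nonneg (hx.trans hz.1) (hz.2.trans hy)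
  rw [energy] at h1
  have h2 : U z * f p (U z) - 2 * F p (U z) =
      U z ^ 2 * |U z| ^ (p - 1) * ((p - 1) / (p + 1)) := by
    have : p + 1 ≠ 0 := by linarith [H.hp]
    rw [F_eq H.hp, f]; field_simp; ring
  have h3 : 0 ≤ U z ^ 2 * |U z| ^ (p - 1) * ((p - 1) / (p + 1)) := by
    have := H.hp
    have h4 : 0 ≤ (p - 1) / (p + 1) := div_nonneg (by linarith) (by linarith)
    positivity
  have h4 := mul_nonneg hz0.le h3
  rw [← h2] at h4
  nlinarith

/-- The quantity controlling the sign of the Wronskian after the zero of `V`. -/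
lemma tilted_energy_pos (H : Fall n p U U1 V V1 m b) {c τ : ℝ} (hτ : m < τ) (hτb : τ < b)
    (hc0 : 0 ≤ c) (hc : c * (p - 1) < 2) (hw : τ * U1 τ + c * U τ ≤ 0) {r : ℝ} (h1 : τ < r)
    (h2 : r ≤ b) :
    0 < 2 * (1 + c) * energy p U U1 r + c * (((n : ℝ) - 1) / r * (U r * U1 r)) := by
  have hn := H.nn
  have hp := H.hp
  set k := c * ((n : ℝ) - 1) / (2 * (1 + c)) with hk
  have hk0 : 0 ≤ k := by
    have : 0 < (n : ℝ) - 1 := by linarith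
    positivity
  have hc1 : 0 < 2 * (1 + c) := by linarith
  have hkc : k * (2 * (1 + c)) = c * ((n : ℝ) - 1) := by rw [hk]; field_simp
  set P := fun r => r * energy p U U1 r + k * (U r * U1 r) with hP
  suffices hPpos : ∀ r, τ < r → r ≤ b → 0 < P r by
    have h3 := hPpos r h1 h2
    have hr0 := H.pos (hτ.trans h1)
    have : 2 * (1 + c) * energy p U U1 r + c * (((n : ℝ) - 1) / r * (U r * U1 r)) =
        2 * (1 + c) / r * P r := by
      simp only [hP]
      have : c * (((n : ℝ) - 1) / r * (U r * U1 r)) =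
        k * (2 * (1 + c)) * (U r * U1 r) / r := by rw [hkc]; field_simp
      rw [this]; field_simp
    rw [this]
    positivity
  rcases lt_or_ge c ((n : ℝ) - 2) with hcn | hcn
  · -- Pohozaev suffices
    have hk2 : k < ((n : ℝ) - 2) / 2 := by
      rw [hk, div_lt_div_iff₀ hc1 (by norm_num)]
      nlinarith
    intro r h1 h2
    have hr0 := H.pos (hτ.trans h1)
    have hEr := H.E r (hτ.trans h1).le h2
    rcases h2.eq_or_lt with rfl | h2'
    · simp only [hP, H.Ub, zero_mul, mul_zero, add_zero]; positivity
    · have h3 := H.pohozaev_nonneg (hτ.trans h1) h2'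
      have h4 : U r * U1 r < 0 := mul_neg_of_pos_of_neg (H.Upos r (hτ.trans h1).le h2')
        (H.U1neg r (hτ.trans h1) h2)
      simp only [hP]
      nlinarith
  · by_contra! hcon
    obtain ⟨r1, h1, h2, h3⟩ := hcon
    have hPb : 0 < P b := by
      simp only [hP, H.Ub, zero_mul, mul_zero, add_zero]
      exact mul_pos (H.pos H.hmb) (H.E b H.hmb.le le_rfl)
    have hPc : ContinuousOn P (Ici 0) := by
      have h0 := H.hU.c0
      have h1 := H.hU.c1
      have h2 := continuousOn_energy H.hp H.hU
      simp only [hP]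
      fun_prop
    obtain ⟨x, hx1, hx2, hx3, hx4⟩ := exists_last_zero h2
      (hPc.mono (H.subset (hτ.trans h1).le)) h3 hPb
    have hx0 := H.pos (hτ.trans (h1.trans_le hx1))
    have hUx := H.Upos x (hτ.trans (h1.trans_le hx1)).le hx2
    have hd : HasDerivAt P (energy p U U1 x + x * (-(((n : ℝ) - 1) / x * U1 x ^ 2)) +
        k * (U1 x * U1 x + U x * (-(((n : ℝ) - 1) / x * U1 x) - f p (U x)))) x := by
      refine (((hasDerivAt_id' x).mul (hasDerivAt_energy hp H.hU hx0)).add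
        (((H.hU.d0 x hx0).mul (H.hU.d1 x hx0)).const_mul k)).congr_deriv ?_
      ring
    have hnn := hasDerivAt_nonneg_of_right_nonneg hd hx3 hx2 (fun y h1 h2 => (hx4 y h1 h2.le).le)
    set θ := -(x * U1 x / U x) with hθ
    have hθc : c ≤ θ := by
      have e1 := H.theta_anti hτ (h1.le.trans hx1) hx2
      have hUτ := H.Upos τ hτ.le hτb
      have e2 : τ * U1 τ / U τ ≤ -c := by rw [div_le_iff₀ hUτ]; linarith
      rw [hθ]; linarith
    have hU1x : x * U1 x = -(θ * U x) := by rw [hθ]; field_simp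
    have hE : x ^ 2 * energy p U U1 x = k * θ * U x ^ 2 := by
      have : x * P x = 0 := by rw [hx3, mul_zero]
      simp only [hP] at this
      have e : x * (x * energy p U U1 x + k * (U x * U1 x)) =
        x ^ 2 * energy p U U1 x + k * (U x * (x * U1 x)) := by ring
      rw [e, hU1x] at this
      linarith
    have hUf : U x * f p (U x) = (p + 1) * (energy p U U1 x - U1 x ^ 2 / 2) +
        (p - 1) / 2 * U x ^ 2 := by
      have : p + 1 ≠ 0 := by linarith
      rw [energy, add_sub_cancel_left, F_eq hp, f]; field_simp; ring
    have hfin : x ^ 2 * (energy p U U1 x + x * (-(((n : ℝ) - 1) / x * U1 x ^ 2)) +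
        k * (U1 x * U1 x + U x * (-(((n : ℝ) - 1) / x * U1 x) - f p (U x)))) =
        U x ^ 2 * (k * (n - k * (p + 1)) * θ - (n - 1 - k * (p + 3) / 2) * θ ^ 2 -
          k * (p - 1) / 2 * x ^ 2) := by
      have e1 : x ^ 2 * (energy p U U1 x + x * (-(((n : ℝ) - 1) / x * U1 x ^ 2)) +
        k * (U1 x * U1 x + U x * (-(((n : ℝ) - 1) / x * U1 x) - f p (U x)))) =
        x ^ 2 * energy p U U1 x - ((n : ℝ) - 1 - k) * (x * U1 x) ^ 2 -
          k * ((n : ℝ) - 1) * (U x * (x * U1 x)) - k * x ^ 2 * (U x * f p (U x)) := by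
        field_simp; ring
      have e2 : k * x ^ 2 * (U x * f p (U x)) = k * ((p + 1) * (x ^ 2 * energy p U U1 x -
        (x * U1 x) ^ 2 / 2) + (p - 1) / 2 * (x ^ 2 * U x ^ 2)) := by rw [hUf]; ring
      rw [e1, e2, hE, hU1x]; ring
    have hnn2 := mul_nonneg (sq_nonneg x) hnn
    rw [hfin] at hnn2
    have hnn3 := nonneg_of_mul_nonneg_right hnn2 (pow_pos hUx 2)
    have hcpos : 0 < c := by linarith
    have hkpos : 0 < k := by
      have : 0 < (n : ℝ) - 1 := by linarith
      positivity
    have hq : 0 < (n : ℝ) - 1 - k * (p + 3) / 2 := by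
      have : ((n : ℝ) - 1 - k * (p + 3) / 2) * (2 * (1 + c)) =
        ((n : ℝ) - 1) * ((4 + c - c * p) / 2) := by
        have : k * (p + 3) / 2 * (2 * (1 + c)) = c * ((n : ℝ) - 1) * (p + 3) / 2 := by
          rw [← hkc]; ring
        rw [sub_mul, this]; ring
      have h5 : 0 < ((n : ℝ) - 1) * ((4 + c - c * p) / 2) := mul_pos (by linarith) (by linarith)
      rw [← this] at h5
      exact (mul_pos_iff_of_pos_right hc1).1 h5
    have hcmp : k * (n - k * (p + 1)) ≤ (n - 1 - k * (p + 3) / 2) * c := by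
      have e : ((n - 1 - k * (p + 3) / 2) * c - k * (n - k * (p + 1))) * (2 * (1 + c)) ^ 2 =
          c * ((n : ℝ) - 1) * ((2 - c * (p - 1)) * (c + 2 - n)) := by
        have e1 : ((n - 1 - k * (p + 3) / 2) * c - k * (n - k * (p + 1))) * (2 * (1 + c)) ^ 2 =
          (n - 1) * c * (2 * (1 + c)) ^ 2 - (k * (2 * (1 + c))) * (p + 3) / 2 * c * (2 * (1 + c))
            - (k * (2 * (1 + c))) * n * (2 * (1 + c)) + (k * (2 * (1 + c))) ^ 2 * (p + 1) := by
          ring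
        rw [e1, hkc]; ring
      have h5 : 0 ≤ c * ((n : ℝ) - 1) * ((2 - c * (p - 1)) * (c + 2 - n)) :=
        mul_nonneg (mul_nonneg (by linarith) (by linarith))
          (mul_nonneg (by linarith) (by linarith))
      rw [← e] at h5
      have := nonneg_of_mul_nonneg_left h5 (by positivity)
      linarith
    have hθpos : 0 < θ := hcpos.trans_le hθc
    have h6 : k * (n - k * (p + 1)) * θ ≤ (n - 1 - k * (p + 3) / 2) * θ ^ 2 := by
      calc k * (n - k * (p + 1)) * θ ≤ (n - 1 - k * (p + 3) / 2) * c * θ :=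
            mul_le_mul_of_nonneg_right hcmp hθpos.le
        _ ≤ (n - 1 - k * (p + 3) / 2) * θ * θ :=
            mul_le_mul_of_nonneg_right (mul_le_mul_of_nonneg_left hθc hq.le) hθpos.le
        _ = _ := by ring
    have h7 : 0 < k * (p - 1) / 2 * x ^ 2 := by
      have : 0 < p - 1 := by linarith
      positivity
    linarith

end Fall

namespace Fall

variable {n : ℕ} {p : ℝ} {U U1 V V1 : ℝ → ℝ} {m b : ℝ}

lemma dwron_pos_of_V_pos (H : Fall n p U U1 V V1 m b) {x : ℝ} (hx : m < x) (hxb : x ≤ b)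
    (hV : ∀ r, m ≤ r → r < x → 0 < V r) : 0 < dwron n p U U1 V V1 x := by
  have hn := H.nn
  have h1 := lt_of_hasDerivAt_pos hx ((continuousOn_dwron H.hp H.hU H.hV).mono (H.subset le_rfl))
    (fun z hz => hasDerivAt_dwron (by have := H.hn; omega) H.hp H.hU H.hV (H.pos hz.1))
    (fun z hz => by
      have e0 := H.pos hz.1
      have e1 := hV z hz.1.le hz.2
      have e2 := H.U1neg z hz.1 (hz.2.le.trans hxb)
      have e3 : 0 < ((n : ℝ) - 1) / z ^ 2 * (z ^ (n - 1) * (-U1 z * V z)) := by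
        have : 0 < (n : ℝ) - 1 := by linarith
        have : 0 < -U1 z := by linarith
        positivity
      linarith)
  refine lt_of_le_of_lt ?_ h1
  simp only [dwron, H.U1m, zero_mul, zero_add, mul_zero, add_zero]
  have hE := H.E m le_rfl H.hmb.le
  rw [energy, H.U1m] at hE
  have := f_pos_of_F_pos H.hp (H.Upos m le_rfl H.hmb) (by linarith)
  exact mul_nonneg (pow_nonneg H.hm _) (mul_pos this H.Vm).le

lemma wron_left_mono (H : Fall n p U U1 V V1 m b) {c c' : ℝ} (hc : c' ≤ c) :
    wron n p c' U U1 V V1 m ≤ wron n p c U U1 V V1 m := by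
  have h1 : wron n p c' U U1 V V1 m - wron n p c U U1 V V1 m =
      m ^ (n - 1) * ((c - c') * (U m * V1 m)) := by
    simp only [wron, H.U1m]; ring
  have h2 := mul_nonneg (pow_nonneg H.hm (n - 1)) (mul_nonneg (sub_nonneg.2 hc)
    (mul_nonneg (H.Unn le_rfl H.hmb.le) (neg_nonneg.2 H.V1m)))
  linarith

lemma wron_tau_nonpos (H : Fall n p U U1 V V1 m b) {c τ : ℝ} (hτ : m < τ) (hτb : τ < b)
    (hV : ∀ r, m ≤ r → r < τ → 0 < V r) (hκ0 : 0 ≤ 2 - c * (p - 1))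
    (hκ : 2 ≤ (2 - c * (p - 1)) * |U τ| ^ (p - 1)) (hW : wron n p c U U1 V V1 m ≤ 0) :
    wron n p c U U1 V V1 τ ≤ 0 := by
  refine (le_of_hasDerivAt_nonpos hτ.le ((continuousOn_wron H.hp H.hU H.hV c).mono
    (H.subset le_rfl)) (fun z hz => hasDerivAt_wron (by have := H.hn; omega) H.hp H.hU H.hV c
      (H.pos hz.1)) (fun z hz => ?_)).trans hW
  have e0 := H.pos hz.1
  have e1 := hV z hz.1.le hz.2
  have e2 := H.Upos z hz.1.le (hz.2.trans hτb)
  have e3 := mul_le_mul_of_nonneg_left (H.q_anti hz.1.le hz.2.le hτb.le) hκ0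
  refine mul_nonpos_of_nonneg_of_nonpos (by positivity) ?_
  nlinarith

/-- Past the zero of `V`, the quotient `V / U1` keeps increasing. -/
lemma dwron_pos_aux (H : Fall n p U U1 V V1 m b) {c τ : ℝ} (hτ : m < τ) (hτb : τ < b)
    (hV : ∀ r, m ≤ r → r < τ → 0 < V r) (hVτ : V τ = 0) (hV1τ : V1 τ < 0) (hc0 : 0 ≤ c)
    (hc : c * (p - 1) < 2) (hκ : (2 - c * (p - 1)) * |U τ| ^ (p - 1) ≤ p + 1)
    (hW : wron n p c U U1 V V1 τ ≤ 0) {r : ℝ} (hr : m < r) (hrb : r ≤ b) :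
    0 < dwron n p U U1 V V1 r := by
  rcases le_or_gt r τ with h | h
  · exact H.dwron_pos_of_V_pos hr hrb fun x h1 h2 => hV x h1 (h2.trans_le h)
  have hn := H.nn
  have hn2 : 2 ≤ n := by have := H.hn; omega
  have hp := H.hp
  have hτ0 := H.pos hτ
  have hw : τ * U1 τ + c * U τ ≤ 0 := by
    simp only [wron, hVτ, mul_zero, zero_sub] at hW
    have h1 : 0 < τ ^ (n - 1) * -V1 τ := mul_pos (pow_pos hτ0 _) (neg_pos.2 hV1τ)
    have h2 : τ ^ (n - 1) * -V1 τ * (τ * U1 τ + c * U τ) ≤ 0 := by linarith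
    exact nonpos_of_mul_nonpos_right h2 h1
  by_contra hcon
  have hDτ := H.dwron_pos_of_V_pos hτ hτb.le hV
  obtain ⟨r1, h1, h2, h3, h4⟩ := exists_first_zero h.le
    ((continuousOn_dwron hp H.hU H.hV).mono (H.subset hτ.le)) hDτ (not_lt.1 hcon)
  have hr1b : r1 ≤ b := h2.trans hrb
  have hU1 : ∀ x, τ ≤ x → x ≤ b → U1 x < 0 := fun x hx hxb => H.U1neg x (hτ.trans_le hx) hxb
  have hx0 : ∀ x, τ ≤ x → 0 < x := fun x hx => H.pos (hτ.trans_le hx)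
  have hφ : ∀ x, τ < x → x ≤ r1 → 0 < V x / U1 x := by
    intro x hx hx1
    have := lt_of_hasDerivAt_pos (g := fun r => V r / U1 r) hx
      (continuousOn_Icc_of_hasDerivAt fun y hy1 hy2 => hasDerivAt_quot hn2 H.hU H.hV (hx0 y hy1)
        (hU1 y hy1 (hy2.trans (hx1.trans hr1b))).ne)
      (fun y hy => hasDerivAt_quot hn2 H.hU H.hV (hx0 y hy.1.le)
        (hU1 y hy.1.le (hy.2.le.trans (hx1.trans hr1b))).ne)
      (fun y hy => by
        have e1 := h4 y hy.1.le (hy.2.trans_le hx1)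
        have e2 := hx0 y hy.1.le
        have e3 : 0 < U1 y ^ 2 :=
          sq_pos_of_neg (hU1 y hy.1.le (hy.2.le.trans (hx1.trans hr1b)))
        positivity)
    simpa [hVτ] using this
  have hWr1 : wron n p c U U1 V V1 r1 ≤
      r1 ^ (n - 1) * (V r1 / U1 r1) * auxG p (2 - c * (p - 1)) (U r1) := by
    have := le_of_hasDerivAt_nonneg h1.le
      (continuousOn_Icc_of_hasDerivAt fun y hy1 hy2 => hasDerivAt_wquot_mul_sub_wron hn2 hp H.hU
        H.hV c (hx0 y hy1) (hU1 y hy1 (hy2.trans hr1b)).ne)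
      (fun y hy => hasDerivAt_wquot_mul_sub_wron hn2 hp H.hU H.hV c (hx0 y hy.1.le)
        (hU1 y hy.1.le (hy.2.le.trans hr1b)).ne)
      (fun y hy => by
        have e1 := h4 y hy.1.le hy.2
        have e2 := hx0 y hy.1.le
        have e3 := hφ y hy.1 hy.2.le
        have e4 : 0 ≤ auxG p (2 - c * (p - 1)) (U y) := by
          refine auxG_nonneg hp (le_trans ?_ hκ)
          exact mul_le_mul_of_nonneg_left (H.q_anti hτ.le hy.1.le (hy.2.le.trans hr1b))
            (by linarith)
        have e5 : 0 < (n : ℝ) - 1 := by linarith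
        positivity)
    simp only [hVτ, zero_div, mul_zero, zero_mul, zero_sub] at this
    linarith
  have hb := energy_bound_of_dwron_eq_zero hn2 hp (hx0 r1 h1.le) (hU1 r1 h1.le hr1b).ne h3
    (hφ r1 h1 le_rfl) hWr1
  have := H.tilted_energy_pos hτ hτb hc0 hc hw h1 hr1b
  linarith

lemma dwron_pos (H : Fall n p U U1 V V1 m b) {τ : ℝ} (hτ : m < τ) (hτb : τ < b)
    (hV : ∀ r, m ≤ r → r < τ → 0 < V r) (hVτ : V τ = 0) (hV1τ : V1 τ < 0)
    (hW : wron n p (expo p (|U m| ^ (p - 1))) U U1 V V1 m ≤ 0) {r : ℝ} (hr : m < r)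
    (hrb : r ≤ b) : 0 < dwron n p U U1 V V1 r := by
  have hp := H.hp
  rcases lt_or_ge ((p + 1) / 2) (|U τ| ^ (p - 1)) with h | h
  · have hq : 0 < |U τ| ^ (p - 1) := by linarith
    have e1 := two_sub_expo hp (|U τ| ^ (p - 1))
    have e2 : 0 < (p + 1) / |U τ| ^ (p - 1) := div_pos (by linarith) hq
    have e3 : (2 - expo p (|U τ| ^ (p - 1)) * (p - 1)) * |U τ| ^ (p - 1) = p + 1 := by
      rw [e1]; field_simp
    refine H.dwron_pos_aux hτ hτb hV hVτ hV1τ (expo_pos hp h).le (by linarith) e3.le ?_ hr hrb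
    refine H.wron_tau_nonpos hτ hτb hV (by linarith) (by linarith) (le_trans ?_ hW)
    exact H.wron_left_mono (expo_mono hp hq (H.q_anti le_rfl hτ.le hτb.le))
  · refine H.dwron_pos_aux (c := 0) hτ hτb hV hVτ hV1τ le_rfl (by linarith) (by linarith) ?_ hr hrb
    simp only [wron, hVτ, mul_zero, zero_sub, zero_mul, add_zero]
    have h1 := H.pos hτ
    have h2 := H.U1neg τ hτ hτb.le
    have : 0 ≤ τ ^ (n - 1) * (τ * (U1 τ * V1 τ)) :=
      mul_nonneg (by positivity) (mul_nonneg h1.le (mul_pos_of_neg_of_neg h2 hV1τ).le)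
    linarith

lemma quot_lt (H : Fall n p U U1 V V1 m b)
    (hD : ∀ r, m < r → r ≤ b → 0 < dwron n p U U1 V V1 r) {x y : ℝ} (hx : m < x) (hxy : x < y)
    (hy : y ≤ b) : V x / U1 x < V y / U1 y := by
  have hn2 : 2 ≤ n := by have := H.hn; omega
  have hd : ∀ z, x ≤ z → z ≤ y → HasDerivAt (fun r => V r / U1 r)
      (dwron n p U U1 V V1 z / (z ^ (n - 1) * U1 z ^ 2)) z := fun z h1 h2 =>
    hasDerivAt_quot hn2 H.hU H.hV (H.pos (hx.trans_le h1))
      (H.U1neg z (hx.trans_le h1) (h2.trans hy)).ne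
  refine lt_of_hasDerivAt_pos (g := fun r => V r / U1 r) hxy (continuousOn_Icc_of_hasDerivAt hd)
    (fun z hz => hd z hz.1.le hz.2.le) (fun z hz => ?_)
  have e1 := hD z (hx.trans hz.1) (hz.2.le.trans hy)
  have e2 := H.pos (hx.trans hz.1)
  have e3 : 0 < U1 z ^ 2 := sq_pos_of_neg (H.U1neg z (hx.trans hz.1) (hz.2.le.trans hy))
  positivity

lemma quot_le (H : Fall n p U U1 V V1 m b)
    (hD : ∀ r, m < r → r ≤ b → 0 < dwron n p U U1 V V1 r) {x y : ℝ} (hx : m < x) (hxy : x ≤ y)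
    (hy : y ≤ b) : V x / U1 x ≤ V y / U1 y := by
  rcases hxy.eq_or_lt with rfl | h
  · exact le_rfl
  · exact (H.quot_lt hD hx h hy).le

lemma exists_level (H : Fall n p U U1 V V1 m b) {κ x y : ℝ} (hx : m ≤ x) (hxy : x ≤ y)
    (h1 : 2 ≤ κ * |U x| ^ (p - 1)) (h2 : κ * |U y| ^ (p - 1) ≤ 2) :
    ∃ r, x ≤ r ∧ r ≤ y ∧ κ * |U r| ^ (p - 1) = 2 := by
  have hc : ContinuousOn (fun r => κ * |U r| ^ (p - 1)) (Icc x y) :=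
    continuousOn_const.mul ((continuous_abs_rpow H.hp).comp_continuousOn
      (H.hU.c0.mono (H.subset hx)))
  obtain ⟨r, hr, he⟩ := intermediate_value_Icc' hxy hc ⟨h2, h1⟩
  exact ⟨r, hr.1, hr.2, he⟩

end Fall

lemma auxG_add_F_nonpos {p : ℝ} (hp : 1 < p) {B x : ℝ} (hB : 0 < B)
    (hβ : (p + 1) / 2 < |B| ^ (p - 1)) (hx : 0 ≤ x) :
    auxG p ((p + 1) / |B| ^ (p - 1)) x +
      (p - 1) / (|B| ^ (p - 1) - 1) * (F p x - F p B) ≤ 0 := by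
  set β := |B| ^ (p - 1) with hβd
  have hβ1 : 0 < β - 1 := by linarith
  have hp1 : p + 1 ≠ 0 := by linarith
  set t := x / B with ht
  have ht0 : 0 ≤ t := div_nonneg hx hB.le
  have hxt : x = t * B := by rw [ht]; field_simp
  set T := t ^ (p + 1) with hT
  have hxT : |x| ^ (p + 1) = T * (B ^ 2 * β) := by
    rw [hxt, abs_mul, mul_rpow (abs_nonneg _) (abs_nonneg _), abs_of_nonneg ht0,
      abs_rpow_add_one hp B]
  have hTt : 1 + (p + 1) / 2 * (t ^ 2 - 1) ≤ T := by
    have h1 := one_add_mul_self_le_rpow_one_add (s := t ^ 2 - 1)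
      (by nlinarith [sq_nonneg t]) (p := (p + 1) / 2) (by linarith)
    have h2 : (1 + (t ^ 2 - 1)) ^ ((p + 1) / 2) = T := by
      rw [hT, show 1 + (t ^ 2 - 1) = t ^ (2 : ℝ) by rw [rpow_two]; ring, ← rpow_mul ht0]
      congr 1; ring
    rw [h2] at h1; exact h1
  have hmain : auxG p ((p + 1) / β) x + (p - 1) / (β - 1) * (F p x - F p B) =
      B ^ 2 / (β - 1) * (-((2 * β - p - 1) / (p + 1) *
        (T - (1 + (p + 1) / 2 * (t ^ 2 - 1))))) := by
    have hβ0 : β ≠ 0 := by linarith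
    rw [auxG, hxT, F, F, hxT, abs_rpow_add_one hp B, ← hβd, hxt]
    field_simp
    ring
  rw [hmain]
  refine mul_nonpos_of_nonneg_of_nonpos (by positivity) ?_
  have h1 : 0 ≤ (2 * β - p - 1) / (p + 1) := div_nonneg (by linarith) (by linarith)
  have := mul_nonneg h1 (sub_nonneg.2 hTt)
  linarith

namespace Fall

variable {n : ℕ} {p : ℝ} {U U1 V V1 : ℝ → ℝ} {m b : ℝ}

lemma height_le (H : Fall n p U U1 V V1 m b) {B : ℝ} (hB : 0 < B)
    (hβ : (p + 1) / 2 < |B| ^ (p - 1)) (hFB : F p B ≤ U1 b ^ 2 / 2) : B ≤ U m := by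
  have hp := H.hp
  have h1 := energy_le (by have := H.hn; omega) hp H.hU H.hm H.hmb.le
  rw [energy, energy, H.U1m, H.Ub, F_zero hp] at h1
  have h2 : F p B ≤ F p (U m) := by linarith
  by_contra hcon
  have hA := H.Upos m le_rfl H.hmb
  have h3 := abs_rpow_le_of_le hp hA.le (not_le.1 hcon).le
  have h4 : 0 < |B| ^ (p - 1) / (p + 1) - 1 / 2 := by
    have : 0 < p + 1 := by linarith
    rw [sub_pos, div_lt_div_iff₀ (by norm_num) this]; linarith
  have h5 : U m ^ 2 < B ^ 2 := by
    have := not_le.1 hcon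
    nlinarith
  have h6 := mul_lt_mul_of_pos_right h5 h4
  have h7 : |U m| ^ (p - 1) / (p + 1) ≤ |B| ^ (p - 1) / (p + 1) :=
    div_le_div_of_nonneg_right h3 (by linarith)
  have h8 := mul_le_mul_of_nonneg_left h7 (sq_nonneg (U m))
  have e : ∀ s, F p s = s ^ 2 * (|s| ^ (p - 1) / (p + 1)) - s ^ 2 / 2 := fun s => by
    rw [F_eq hp]; ring
  rw [e, e] at h2
  linarith

/-- Passing from a critical point to the next zero. -/
theorem conclusion (H : Fall n p U U1 V V1 m b)
    (hW : wron n p (expo p (|U m| ^ (p - 1))) U U1 V V1 m ≤ 0) :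
    V b < 0 ∧ ∀ B, 0 < B → (p + 1) / 2 < |B| ^ (p - 1) → F p B ≤ U1 b ^ 2 / 2 →
      wron n p (expo p (|B| ^ (p - 1))) U U1 V V1 b ≤ 0 := by
  have hp := H.hp
  have hn := H.nn
  have hn2 : 2 ≤ n := by have := H.hn; omega
  obtain ⟨τ, hτ, hτb, hVτ, hV, hV1τ⟩ := H.exists_tau
  have hD : ∀ r, m < r → r ≤ b → 0 < dwron n p U U1 V V1 r := fun r h1 h2 =>
    H.dwron_pos hτ hτb hV hVτ hV1τ hW h1 h2
  have hφpos : ∀ r, τ < r → r ≤ b → 0 < V r / U1 r := fun r h1 h2 => by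
    have := H.quot_lt hD hτ h1 h2
    rwa [hVτ, zero_div] at this
  have hU1b := H.U1neg b H.hmb le_rfl
  have hVb : V b < 0 := by
    have := hφpos b hτb le_rfl
    rcases div_pos_iff.1 this with h | h
    · linarith [h.2]
    · exact h.1
  refine ⟨hVb, fun B hB hβ hFB => ?_⟩
  have hBA := H.height_le hB hβ hFB
  set β := |B| ^ (p - 1) with hβd
  have hβ0 : 0 < β := by linarith
  have hβA : β ≤ |U m| ^ (p - 1) := abs_rpow_le_of_le hp hB.le hBA
  have hκ := two_sub_expo hp β
  have hκ0 : 0 < (p + 1) / β := div_pos (by linarith) hβ0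
  rcases le_or_gt ((p + 1) / β * |U τ| ^ (p - 1)) 2 with hcase | hcase
  · obtain ⟨r0, h1, h2, h3⟩ := H.exists_level (κ := (p + 1) / β) le_rfl hτ.le (by
      have : (p + 1) / β * β ≤ (p + 1) / β * |U m| ^ (p - 1) :=
        mul_le_mul_of_nonneg_left hβA hκ0.le
      rw [div_mul_cancel₀ _ hβ0.ne'] at this
      linarith) hcase
    have hr0 : m < r0 := by
      rcases h1.eq_or_lt with h | h
      · exfalso
        rw [← h] at h3
        have : (p + 1) / β * β ≤ (p + 1) / β * |U m| ^ (p - 1) :=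
          mul_le_mul_of_nonneg_left hβA hκ0.le
        rw [div_mul_cancel₀ _ hβ0.ne'] at this
        linarith
      · exact h
    set φ0 := V r0 / U1 r0 with hφ0
    have hφ0n : φ0 ≤ 0 := by
      have := H.quot_le hD hr0 h2 hτb.le
      rwa [hVτ, zero_div] at this
    set ω := (p - 1) / (β - 1) with hω
    have hω0 : 0 ≤ ω := div_nonneg (by linarith) (by linarith)
    set S := fun r => r ^ (n - 1) * (auxG p (2 - expo p β * (p - 1)) (U r) +
      ω * (energy p U U1 r - F p B)) with hS
    have hSc : ContinuousOn S (Ici 0) := by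
      have e1 := H.hU.c0
      have e2 := continuousOn_energy hp H.hU
      have e3 : ContinuousOn (fun r => auxG p (2 - expo p β * (p - 1)) (U r)) (Ici 0) :=
        (continuous_auxG hp _).comp_continuousOn e1
      simp only [hS]
      fun_prop
    have hd : ∀ r, m < r → HasDerivAt (fun r => wron n p (expo p β) U U1 V V1 r - φ0 * S r)
        (r ^ (n - 1) * (U r * (2 - (p + 1) / β * |U r| ^ (p - 1))) * (V r - φ0 * U1 r) -
          φ0 * (((n : ℝ) - 1) / r * (r ^ (n - 1) * (auxG p ((p + 1) / β) (U r) +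
            ω * (F p (U r) - F p B) - ω * (U1 r ^ 2 / 2))))) r := by
      intro r hr
      have hr0 := H.pos hr
      have e1 : HasDerivAt S _ r := (hasDerivAt_pow_pred (by omega) hr0).mul
        ((hasDerivAt_auxG hp (2 - expo p β * (p - 1)) (H.hU.d0 r hr0) rfl).add
          (((hasDerivAt_energy hp H.hU hr0).sub_const (F p B)).const_mul ω))
      refine ((hasDerivAt_wron (by omega) hp H.hU H.hV (expo p β) hr0).sub
        (e1.const_mul φ0)).congr_deriv ?_
      simp only [hκ, energy]
      field_simp
      ring
    have hle := le_of_hasDerivAt_nonpos H.hmb.le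
      (((continuousOn_wron hp H.hU H.hV (expo p β)).sub (hSc.const_mul φ0)).mono
        (H.subset le_rfl)) (fun r hr => hd r hr.1) (fun r hr => by
        have e0 := H.pos hr.1
        have e1 : (U r * (2 - (p + 1) / β * |U r| ^ (p - 1))) * (V r - φ0 * U1 r) ≤ 0 := by
          have hU1r := H.U1neg r hr.1 hr.2.le
          have hUr := H.Upos r hr.1.le hr.2
          have e2 : V r - φ0 * U1 r = (V r / U1 r - φ0) * U1 r := by
            have := hU1r.ne; field_simp
          rw [e2]
          rcases le_total r r0 with h | h
          · have e3 := mul_le_mul_of_nonneg_left (H.q_anti hr.1.le h (h2.trans hτb.le)) hκ0.le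
            have e4 := H.quot_le hD hr.1 h (h2.trans hτb.le)
            exact mul_nonpos_of_nonpos_of_nonneg
              (mul_nonpos_of_nonneg_of_nonpos hUr.le (by linarith))
              (mul_nonneg_of_nonpos_of_nonpos (by linarith) hU1r.le)
          · have e3 := mul_le_mul_of_nonneg_left (H.q_anti hr0.le h hr.2.le) hκ0.le
            have e4 := H.quot_le hD hr0 h hr.2.le
            exact mul_nonpos_of_nonneg_of_nonpos
              (mul_nonneg hUr.le (by linarith))
              (mul_nonpos_of_nonneg_of_nonpos (by linarith) hU1r.le)
        have e2 := auxG_add_F_nonpos hp hB hβ (H.Unn hr.1.le hr.2.le)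
        have e3 : 0 ≤ ω * (U1 r ^ 2 / 2) := by positivity
        have e4 := mul_nonpos_of_nonneg_of_nonpos (pow_nonneg e0.le (n - 1)) e1
        have e5 : 0 ≤ ((n : ℝ) - 1) / r := div_nonneg (by linarith) e0.le
        have e6 := mul_nonneg_of_nonpos_of_nonpos hφ0n (mul_nonpos_of_nonneg_of_nonpos e5
          (mul_nonpos_of_nonneg_of_nonpos (pow_nonneg e0.le (n - 1)) (show
            auxG p ((p + 1) / β) (U r) + ω * (F p (U r) - F p B) - ω * (U1 r ^ 2 / 2) ≤ 0 by
              linarith)))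
        linarith)
    have hSb : 0 ≤ S b := by
      simp only [hS, H.Ub, auxG_zero hp, energy, F_zero hp, zero_add, add_zero]
      exact mul_nonneg (pow_nonneg (H.pos H.hmb).le _) (mul_nonneg hω0 (by linarith))
    have hSm : S m ≤ 0 := by
      have e2 := auxG_add_F_nonpos hp hB hβ (H.Unn le_rfl H.hmb.le)
      simp only [hS, energy, H.U1m, hκ]
      refine mul_nonpos_of_nonneg_of_nonpos (pow_nonneg H.hm _) ?_
      simpa using e2
    have e1 := mul_nonpos_of_nonpos_of_nonneg hφ0n hSb
    have e2 := mul_nonneg_of_nonpos_of_nonpos hφ0n hSm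
    have e3 := H.wron_left_mono (expo_mono hp hβ0 hβA)
    simp only [Pi.sub_apply] at hle
    linarith
  · set X := max B (U τ) with hX
    have hUτ := H.Upos τ hτ.le hτb
    have hX0 : 0 < X := lt_max_of_lt_left hB
    set β1 := |X| ^ (p - 1) with hβ1
    have hββ1 : β ≤ β1 := abs_rpow_le_of_le hp hB.le (le_max_left _ _)
    have hβ1A : β1 ≤ |U m| ^ (p - 1) :=
      abs_rpow_le_of_le hp hX0.le (max_le hBA (H.anti le_rfl hτ.le hτb.le))
    have hβ10 : 0 < β1 := hβ0.trans_le hββ1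
    have hτβ1 : |U τ| ^ (p - 1) ≤ β1 := abs_rpow_le_of_le hp hUτ.le (le_max_right _ _)
    have hκ10 : 0 < (p + 1) / β1 := div_pos (by linarith) hβ10
    have hκ1τ : 2 ≤ (p + 1) / β1 * |U τ| ^ (p - 1) := by
      rcases max_cases B (U τ) with h | h
      · rw [hβ1, hX, h.1]; exact hcase.le
      · have : (p + 1) / |U τ| ^ (p - 1) * |U τ| ^ (p - 1) = p + 1 :=
          div_mul_cancel₀ _ (rpow_pos_of_pos (abs_pos.2 hUτ.ne') _).ne'
        rw [hβ1, hX, h.1, this]; linarith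
    have hκ1 := two_sub_expo hp β1
    set c1 := expo p β1 with hc1
    have hWτ : wron n p c1 U U1 V V1 τ ≤ 0 :=
      H.wron_tau_nonpos hτ hτb hV (by rw [hκ1]; exact hκ10.le) (by rw [hκ1]; exact hκ1τ)
        ((H.wron_left_mono (expo_mono hp hβ10 hβ1A)).trans hW)
    obtain ⟨s, h1, h2, h3⟩ := H.exists_level (κ := (p + 1) / β1) hτ.le hτb.le hκ1τ (by
      rw [H.Ub, abs_zero, zero_rpow (by linarith), mul_zero]; norm_num)
    have hφnn : ∀ r, τ ≤ r → r ≤ b → 0 ≤ V r / U1 r := fun r h1 h2 => by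
      have := H.quot_le hD hτ h1 h2
      rwa [hVτ, zero_div] at this
    have hmono : ∀ x y, τ ≤ x → x ≤ y → y ≤ b →
        x ^ (n - 1) * (V x / U1 x) ≤ y ^ (n - 1) * (V y / U1 y) := fun x y hx hxy hy => by
      have := H.pos (hτ.trans_le hx)
      exact mul_le_mul (pow_le_pow_left₀ this.le hxy _) (H.quot_le hD (hτ.trans_le hx) hxy hy)
        (hφnn x hx (hxy.trans hy)) (pow_nonneg (this.le.trans hxy) _)
    set h0 := s ^ (n - 1) * (V s / U1 s) with hh0
    have hh0n : 0 ≤ h0 := mul_nonneg (pow_nonneg (H.pos (hτ.trans_le h1)).le _) (hφnn s h1 h2)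
    have hd : ∀ r, τ ≤ r → r ≤ b → HasDerivAt _ _ r := fun r hr hrb =>
      hasDerivAt_wron_sub_auxG hn2 hp H.hU H.hV c1 h0 (H.pos (hτ.trans_le hr))
        (H.U1neg r (hτ.trans_le hr) hrb).ne
    have hle := le_of_hasDerivAt_nonpos hτb.le (continuousOn_Icc_of_hasDerivAt hd)
      (fun r hr => hd r hr.1.le hr.2.le) (fun r hr => by
        have hU1r := H.U1neg r (hτ.trans hr.1) hr.2.le
        have hUr := H.Upos r (hτ.trans hr.1).le hr.2
        rw [hκ1]
        rcases le_total r s with h | h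
        · have e3 := mul_le_mul_of_nonneg_left (H.q_anti (hτ.trans hr.1).le h h2) hκ10.le
          have e4 := hmono r s hr.1.le h h2
          exact mul_nonpos_of_nonneg_of_nonpos (mul_nonneg_of_nonpos_of_nonpos (by linarith)
            (mul_nonpos_of_nonneg_of_nonpos hUr.le (by linarith))) hU1r.le
        · have e3 := mul_le_mul_of_nonneg_left (H.q_anti (hτ.trans_le h1).le h hr.2.le) hκ10.le
          have e4 := hmono s r h1 h hr.2.le
          exact mul_nonpos_of_nonneg_of_nonpos (mul_nonneg (by linarith)
            (mul_nonneg hUr.le (by linarith))) hU1r.le)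
    rw [H.Ub, auxG_zero hp, mul_zero, sub_zero] at hle
    have hG : 0 ≤ auxG p (2 - c1 * (p - 1)) (U τ) := by
      refine auxG_nonneg hp ?_
      rw [hκ1, div_mul_eq_mul_div, div_le_iff₀ hβ10]
      exact mul_le_mul_of_nonneg_left hτβ1 (by linarith)
    have hWb : wron n p c1 U U1 V V1 b ≤ 0 := by
      have := mul_nonneg hh0n hG
      linarith
    have hdiff : wron n p c1 U U1 V V1 b - wron n p (expo p β) U U1 V V1 b =
        b ^ (n - 1) * ((c1 - expo p β) * (U1 b * V b)) := by
      simp only [wron, H.Ub]; ring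
    have := mul_nonneg (pow_nonneg (H.pos H.hmb).le (n - 1)) (mul_nonneg
      (sub_nonneg.2 (expo_mono hp hβ0 hββ1)) (mul_pos_of_neg_of_neg hU1b hVb).le)
    linarith

end Fall

/-- Zeros of a radial solution that does not vanish at the origin are simple. -/
lemma Radial.simple_zero {n : ℕ} {p : ℝ} {U U1 : ℝ → ℝ} (hn : 1 ≤ n) (hp : 1 < p)
    (hU : Radial n (fun r => f p (U r)) U U1) (h0 : U 0 ≠ 0) {z : ℝ} (hz : 0 < z)
    (hUz : U z = 0) : U1 z ≠ 0 := by
  intro hU1z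
  have hn' : (0 : ℝ) ≤ (n : ℝ) - 1 := by
    have : (1 : ℝ) ≤ n := by exact_mod_cast hn
    linarith
  have hqc : ContinuousOn (fun r => |U r| ^ (p - 1)) (Icc 0 z) :=
    (continuous_abs_rpow hp).comp_continuousOn (hU.c0.mono fun x hx => hx.1)
  obtain ⟨Q, hQ⟩ := isCompact_Icc.bddAbove_image hqc
  have hQ' : ∀ r, 0 ≤ r → r ≤ z → |U r| ^ (p - 1) ≤ Q := fun r h1 h2 =>
    hQ (mem_image_of_mem _ ⟨h1, h2⟩)
  have key : ∀ ε, 0 < ε → ε < z → U ε = 0 := by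
    intro ε hε hεz
    set K := 2 + Q + 2 * ((n : ℝ) - 1) / ε with hK
    have hd : ∀ r, ε ≤ r → r ≤ z → HasDerivAt (fun r => exp (K * r) * (U r ^ 2 + U1 r ^ 2))
        (exp (K * r) * (K * (U r ^ 2 + U1 r ^ 2) + (2 * (U r * U1 r) +
          2 * (U1 r * (-(((n : ℝ) - 1) / r * U1 r) - f p (U r)))))) r := by
      intro r h1 h2
      have hr := hε.trans_le h1
      refine ((((hasDerivAt_id' r).const_mul K).exp).mul (((hU.d0 r hr).pow 2).add
        ((hU.d1 r hr).pow 2))).congr_deriv ?_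
      simp
      ring
    have h1 := le_of_hasDerivAt_nonneg hεz.le (continuousOn_Icc_of_hasDerivAt hd)
      (fun r hr => hd r hr.1.le hr.2.le) (fun r hr => by
        have hr0 := hε.trans hr.1
        refine mul_nonneg (exp_pos _).le ?_
        have hq := hQ' r hr0.le hr.2.le
        have hq0 : 0 ≤ |U r| ^ (p - 1) := rpow_nonneg (abs_nonneg _) _
        have e1 : ((n : ℝ) - 1) / r ≤ ((n : ℝ) - 1) / ε :=
          div_le_div_of_nonneg_left hn' hε hr.1.le
        have e2 : f p (U r) = U r * (|U r| ^ (p - 1) - 1) := by rw [f]; ring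
        rw [e2, hK, mul_div_assoc]
        set A := ((n : ℝ) - 1) / r
        set A' := ((n : ℝ) - 1) / ε
        set q := |U r| ^ (p - 1)
        set x := U r
        set y := U1 r
        have e0 : 0 ≤ A := div_nonneg hn' hr0.le
        have e3 : 0 ≤ (A' - A) * y ^ 2 := mul_nonneg (by linarith) (sq_nonneg y)
        have e4 : 0 ≤ A' * x ^ 2 := mul_nonneg (by linarith) (sq_nonneg x)
        have e5 : 0 ≤ (Q - q) * (x ^ 2 + y ^ 2) := mul_nonneg (by linarith) (by positivity)
        have e6 : 0 ≤ q * (x - y) ^ 2 := mul_nonneg hq0 (sq_nonneg _)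
        have e7 := sq_nonneg (x + y)
        nlinarith)
    rw [hUz, hU1z] at h1
    have h2 : exp (K * ε) * (U ε ^ 2 + U1 ε ^ 2) ≤ 0 := by simpa using h1
    have h3 := nonpos_of_mul_nonpos_right h2 (exp_pos _)
    have : U ε ^ 2 = 0 := le_antisymm (by nlinarith [sq_nonneg (U1 ε)]) (sq_nonneg _)
    simpa using this
  refine h0 ?_
  have hne : (nhdsWithin (0 : ℝ) (Ioo 0 z)).NeBot := by
    rw [← mem_closure_iff_nhdsWithin_neBot, closure_Ioo hz.ne]
    exact ⟨le_rfl, hz.le⟩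
  have h1 : Tendsto U (nhdsWithin 0 (Ioo 0 z)) (nhds (U 0)) :=
    (hU.c0 0 (mem_Ici.2 le_rfl)).mono_left (nhdsWithin_mono _ fun x hx => hx.1.le)
  refine tendsto_nhds_unique h1 (tendsto_const_nhds.congr' ?_)
  exact eventually_nhdsWithin_of_forall fun x hx => (key x hx.1 hx.2).symm

/-- A radial solution with the solution of its linearization, both started at the origin. -/
structure Shot (n : ℕ) (p : ℝ) (U U1 V V1 : ℝ → ℝ) : Prop where
  hn : 3 ≤ n
  hp : 1 < p
  hU : Radial n (fun r => f p (U r)) U U1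
  hV : Radial n (fun r => fder p (U r) * V r) V V1
  UV0 : 0 < U 0 * V 0
  U10 : U1 0 = 0
  V10 : V1 0 = 0
  sub : 0 < (n : ℝ) / (p + 1) - ((n : ℝ) - 2) / 2

/-- The property propagated from one zero to the next. -/
def GoodZero (n : ℕ) (p : ℝ) (U U1 V V1 : ℝ → ℝ) (z : ℝ) : Prop :=
  0 < V z * U1 z ∧ ∀ B, 0 < B → (p + 1) / 2 < |B| ^ (p - 1) → F p B ≤ U1 z ^ 2 / 2 →
    wron n p (expo p (|B| ^ (p - 1))) U U1 V V1 z ≤ 0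

namespace Shot

variable {n : ℕ} {p : ℝ} {U U1 V V1 : ℝ → ℝ}

lemma neg (H : Shot n p U U1 V V1) :
    Shot n p (fun r => -U r) (fun r => -U1 r) (fun r => -V r) (fun r => -V1 r) where
  hn := H.hn
  hp := H.hp
  hU := by simpa only [f_neg] using H.hU.neg
  hV := by simpa only [fder_neg, mul_neg] using H.hV.neg
  UV0 := by simpa using H.UV0
  U10 := by simpa using H.U10
  V10 := by simpa using H.V10
  sub := H.sub

lemma goodZero_neg {z : ℝ} (h : GoodZero n p (fun r => -U r) (fun r => -U1 r) (fun r => -V r)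
    (fun r => -V1 r) z) : GoodZero n p U U1 V V1 z := by
  refine ⟨by simpa using h.1, fun B h1 h2 h3 => ?_⟩
  have := h.2 B h1 h2 (by simpa using h3)
  have e : ∀ c, wron n p c (fun r => -U r) (fun r => -U1 r) (fun r => -V r) (fun r => -V1 r) z =
      wron n p c U U1 V V1 z := fun c => by simp only [wron, f_neg]; ring
  rwa [e] at this

lemma U0 (H : Shot n p U U1 V V1) : U 0 ≠ 0 := fun h => by
  have := H.UV0
  rw [h, zero_mul] at this
  exact lt_irrefl _ this

lemma U1_ne (H : Shot n p U U1 V V1) {z : ℝ} (hz : 0 < z) (h : U z = 0) : U1 z ≠ 0 :=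
  H.hU.simple_zero (by have := H.hn; omega) H.hp H.U0 hz h

lemma energy_pos (H : Shot n p U U1 V V1) {b : ℝ} (hb : 0 < b) (hUb : U b = 0) {r : ℝ}
    (h1 : 0 ≤ r) (h2 : r ≤ b) : 0 < energy p U U1 r := by
  refine lt_of_lt_of_le ?_ (energy_le (by have := H.hn; omega) H.hp H.hU h1 h2)
  rw [energy, hUb, F_zero H.hp]
  have := pow_pos (abs_pos.2 (H.U1_ne hb hUb)) 2
  rw [sq_abs] at this
  linarith

lemma f_pos_of_crit (H : Shot n p U U1 V V1) {b : ℝ} (hb : 0 < b) (hUb : U b = 0) {r : ℝ}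
    (h1 : 0 ≤ r) (h2 : r ≤ b) (h3 : 0 < U r) (h4 : U1 r = 0) : 0 < f p (U r) := by
  have := H.energy_pos hb hUb h1 h2
  rw [energy, h4] at this
  exact f_pos_of_F_pos H.hp h3 (by linarith)

lemma U1_neg_of_right (H : Shot n p U U1 V V1) {b m m' : ℝ} (hm : 0 ≤ m)
    (hUb : U b = 0) (hpos : ∀ r, m < r → r < b → 0 < U r) (hU1b : U1 b < 0) (hmm' : m < m')
    (hm' : m' ≤ b) (hneg : ∀ r, m < r → r < m' → U1 r < 0) {r : ℝ} (h1 : m < r) (h2 : r ≤ b) :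
    U1 r < 0 := by
  by_contra hcon
  have hr' : m' ≤ r := by
    by_contra h
    exact hcon (hneg r h1 (not_le.1 h))
  have hrb : r < b := by
    rcases h2.eq_or_lt with rfl | h
    · exact absurd hU1b hcon
    · exact h
  set x := (m + m') / 2 with hx
  have hx1 : m < x := by linarith
  have hx2 : x < m' := by linarith
  obtain ⟨y, e1, e2, e3, e4⟩ := exists_first_zero (g := fun r => -U1 r) (a := x) (b := r)
    (by linarith) ((H.hU.c1.mono fun z hz => by
      have := hz.1
      exact mem_Ici.2 (by linarith)).neg) (by have := hneg x hx1 hx2; linarith)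
    (by have := not_lt.1 hcon; linarith)
  have e3' : U1 y = 0 := by linarith
  have hy0 : 0 < y := by linarith
  have hUy := hpos y (by linarith) (by linarith)
  have hf := H.f_pos_of_crit (by linarith) hUb hy0.le (by linarith) hUy e3'
  have hd := H.hU.d1 y hy0
  rw [e3'] at hd
  obtain ⟨ε, hε, h5⟩ := hasDerivAt_eventually_left_pos hd (by linarith) e3'
  have h6 := h5 (max x (y - ε / 2)) (lt_max_of_lt_right (by linarith)) (max_lt e1 (by linarith))
  have h7 := e4 (max x (y - ε / 2)) (le_max_left _ _) (max_lt e1 (by linarith))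
  linarith

lemma goodZero_of_first (H : Shot n p U U1 V V1) {b : ℝ} (hb : 0 < b) (hUb : U b = 0)
    (hpos : ∀ r, 0 ≤ r → r < b → 0 < U r) (hU1b : U1 b < 0) : GoodZero n p U U1 V V1 b := by
  have hf0 := H.f_pos_of_crit hb hUb le_rfl hb.le (hpos 0 le_rfl hb) H.U10
  have hfc : ContinuousWithinAt (fun r => f p (U r)) (Ici 0) 0 :=
    (continuous_f H.hp).continuousAt.comp_continuousWithinAt (H.hU.c0 0 (mem_Ici.2 le_rfl))
  have hev := hfc.eventually (lt_mem_nhds hf0)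
  rw [eventually_nhdsWithin_iff, Metric.eventually_nhds_iff] at hev
  obtain ⟨ε, hε, hev⟩ := hev
  have hfpos : ∀ r, 0 ≤ r → r < ε → 0 < f p (U r) := fun r h1 h2 =>
    hev (by rw [Real.dist_eq, sub_zero, abs_of_nonneg h1]; exact h2) h1
  have hneg : ∀ r, 0 < r → r < min ε b → U1 r < 0 := by
    intro r h1 h2
    have hd : ∀ z, 0 < z → HasDerivAt (fun r => r ^ (n - 1) * U1 r)
        (-(z ^ (n - 1) * f p (U z))) z := fun z hz => by
      refine ((hasDerivAt_pow_pred (by have := H.hn; omega) hz).mul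
        (H.hU.d1 z hz)).congr_deriv ?_
      ring
    have h3 := lt_of_hasDerivAt_neg (g := fun r => r ^ (n - 1) * U1 r) h1
      (((continuous_pow (n - 1)).continuousOn.mul H.hU.c1).mono fun z hz => hz.1)
      (fun z hz => hd z hz.1) (fun z hz => by
        have := hfpos z hz.1.le (hz.2.trans (h2.trans_le (min_le_left _ _)))
        have h4 := pow_pos hz.1 (n - 1)
        have := mul_pos h4 this
        linarith)
    rw [H.U10, mul_zero] at h3
    by_contra hcon
    have := mul_nonneg (pow_pos h1 (n - 1)).le (not_lt.1 hcon)
    linarith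
  have hU1neg : ∀ r, 0 < r → r ≤ b → U1 r < 0 := fun r h1 h2 =>
    H.U1_neg_of_right le_rfl hUb (fun r h1 h2 => hpos r h1.le h2) hU1b (lt_min hε hb)
      (min_le_right _ _) hneg h1 h2
  have hV0 : 0 < V 0 := (pos_iff_pos_of_mul_pos H.UV0).1 (hpos 0 le_rfl hb)
  have HF : Fall n p U U1 V V1 0 b := ⟨H.hn, H.hp, H.hU, H.hV, le_rfl, hb, hpos, hUb, H.U10,
    hU1neg, fun r h1 h2 => H.energy_pos hb hUb h1 h2, hV0, H.V10.le, H.sub⟩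
  have := HF.conclusion (by
    have : n - 1 ≠ 0 := by have := H.hn; omega
    simp [wron, this])
  exact ⟨mul_pos_of_neg_of_neg this.1 hU1b, this.2⟩

lemma goodZero_of_prev (H : Shot n p U U1 V V1) {a b : ℝ} (ha : 0 < a) (hab : a < b)
    (hUa : U a = 0) (hUb : U b = 0) (hpos : ∀ r, a < r → r < b → 0 < U r) (hU1b : U1 b < 0)
    (hga : GoodZero n p U U1 V V1 a) : GoodZero n p U U1 V V1 b := by
  have hb := ha.trans hab
  have hU1a : 0 < U1 a := lt_of_le_of_ne (hasDerivAt_nonneg_of_right_nonneg (H.hU.d0 a ha) hUa hab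
    fun y h1 h2 => (hpos y h1 h2).le) (H.U1_ne ha hUa).symm
  obtain ⟨m, h1, h2, h3, h4⟩ := exists_first_zero hab.le
    (H.hU.c1.mono fun z hz => ha.le.trans hz.1) hU1a hU1b.le
  have hmb : m < b := by
    rcases h2.eq_or_lt with rfl | h
    · exact absurd h3 hU1b.ne
    · exact h
  have hm := ha.trans h1
  have hUm := hpos m h1 hmb
  have hd := H.hU.d1 m hm
  rw [h3] at hd
  obtain ⟨ε, hε, h5⟩ := hasDerivAt_eventually_right_neg hd (by
    have := H.f_pos_of_crit hb hUb hm.le h2 hUm h3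
    linarith) h3
  have hU1neg : ∀ r, m < r → r ≤ b → U1 r < 0 := fun r e1 e2 =>
    H.U1_neg_of_right hm.le hUb (fun r e1 e2 => hpos r (h1.trans e1) e2) hU1b
      (m' := min (m + ε) b) (lt_min (by linarith) hmb) (min_le_right _ _)
      (fun r e1 e2 => h5 r e1 (e2.trans_le (min_le_left _ _))) e1 e2
  have hEm := H.energy_pos hb hUb hm.le h2
  have hβ : (p + 1) / 2 < |U m| ^ (p - 1) := by
    rw [energy, h3] at hEm
    exact half_lt_abs_rpow_of_F_pos H.hp (by linarith)
  have hβ0 : 0 < |U m| ^ (p - 1) := by linarith [H.hp]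
  have hFm : F p (U m) ≤ U1 a ^ 2 / 2 := by
    have := energy_le (by have := H.hn; omega) H.hp H.hU ha.le h1.le
    rw [energy, energy, h3, hUa, F_zero H.hp] at this
    linarith
  have hrise := rise (by have := H.hn; omega) H.hp H.hU H.hV ha h1 hUa
    (fun r e1 e2 => hpos r e1 (e2.trans_lt hmb)) h4 h3
    ((pos_iff_pos_of_mul_pos hga.1).2 hU1a)
    (fun r e1 e2 => H.energy_pos hb hUb (ha.le.trans e1) (e2.trans h2))
    (expo_pos H.hp hβ) (by rw [two_sub_expo H.hp, div_mul_cancel₀ _ hβ0.ne'])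
    (hga.2 (U m) hUm hβ hFm)
  have HF : Fall n p U U1 V V1 m b := ⟨H.hn, H.hp, H.hU, H.hV, hm.le, hmb,
    fun r e1 e2 => hpos r (h1.trans_le e1) e2, hUb, h3, hU1neg,
    fun r e1 e2 => H.energy_pos hb hUb (hm.le.trans e1) e2, hrise.1, hrise.2.1.le, H.sub⟩
  have := HF.conclusion hrise.2.2
  exact ⟨mul_pos_of_neg_of_neg this.1 hU1b, this.2⟩

lemma goodZero_step (H : Shot n p U U1 V V1) {b : ℝ} (hb : 0 < b) (hUb : U b = 0)
    (hprev : ∀ a, 0 < a → a < b → U a = 0 → GoodZero n p U U1 V V1 a) (hU1b : U1 b < 0) :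
    GoodZero n p U U1 V V1 b := by
  obtain ⟨ε, hε, h1⟩ := hasDerivAt_eventually_left_pos (H.hU.d0 b hb) hU1b hUb
  set c := max (b - ε / 2) (b / 2) with hc
  have hc0 : 0 < c := lt_max_of_lt_right (by linarith)
  have hcb : c < b := max_lt (by linarith) (by linarith)
  have hcε : b - ε < c := lt_max_of_lt_left (by linarith)
  have hUc : 0 < U c := h1 c hcε hcb
  by_cases hall : ∀ r, 0 ≤ r → r ≤ c → 0 < U r
  · refine H.goodZero_of_first hb hUb (fun r e1 e2 => ?_) hU1b
    rcases le_or_gt r c with h | h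
    · exact hall r e1 h
    · exact h1 r (hcε.trans h) e2
  · push Not at hall
    obtain ⟨y, e1, e2, e3⟩ := hall
    obtain ⟨a, d1, d2, d3, d4⟩ := exists_last_zero e2 (H.hU.c0.mono fun z hz => e1.trans hz.1) e3
      hUc
    have ha : 0 < a := by
      rcases (e1.trans d1).eq_or_lt with h | h
      · rw [← h] at d3; exact absurd d3 H.U0
      · exact h
    refine H.goodZero_of_prev ha (d2.trans hcb) d3 hUb (fun r g1 g2 => ?_) hU1b
      (hprev a ha (d2.trans hcb) d3)
    rcases le_or_gt r c with h | h
    · exact d4 r g1 h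
    · exact h1 r (hcε.trans h) g2

lemma isolated_zero (H : Shot n p U U1 V V1) {z : ℝ} (hz : 0 < z) (h : U z = 0) :
    ∀ᶠ r in nhdsWithin z {z}ᶜ, U r ≠ 0 := by
  have h1 := (H.hU.d0 z hz).eventually_ne (H.U1_ne hz h) (c := 0)
  exact h1

theorem goodZero (H : Shot n p U U1 V V1) {z : ℝ} (hz : 0 < z) (hUz : U z = 0) :
    GoodZero n p U U1 V V1 z := by
  by_contra hbad
  set S := {x | 0 < x ∧ x ≤ z ∧ U x = 0 ∧ ¬ GoodZero n p U U1 V V1 x} with hS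
  have hne : S.Nonempty := ⟨z, hz, le_rfl, hUz, hbad⟩
  have hbd : BddBelow S := ⟨0, fun x hx => hx.1.le⟩
  set b := sInf S with hbdef
  have hb0 : 0 ≤ b := le_csInf hne fun x hx => hx.1.le
  have hbcl : b ∈ closure S := csInf_mem_closure hne hbd
  have hUb : U b = 0 := by
    have hcl : IsClosed (Icc 0 z ∩ U ⁻¹' {0}) :=
      (H.hU.c0.mono fun x hx => hx.1).preimage_isClosed_of_isClosed isClosed_Icc isClosed_singleton
    have hsub : S ⊆ Icc 0 z ∩ U ⁻¹' {0} := fun x hx => ⟨⟨hx.1.le, hx.2.1⟩, hx.2.2.1⟩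
    exact (closure_minimal hsub hcl hbcl).2
  have hbpos : 0 < b := lt_of_le_of_ne hb0 fun h => H.U0 (by rwa [← h] at hUb)
  have hbS : ¬ GoodZero n p U U1 V V1 b := by
    have hiso := H.isolated_zero hbpos hUb
    rw [eventually_nhdsWithin_iff, Metric.eventually_nhds_iff] at hiso
    obtain ⟨ε, hε, hiso⟩ := hiso
    obtain ⟨x, hxS, hx⟩ := exists_lt_of_csInf_lt hne (show sInf S < b + ε by rw [← hbdef]; linarith)
    have hbx : b ≤ x := csInf_le hbd hxS
    by_cases hxb : x = b
    · rw [← hxb]; exact hxS.2.2.2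
    · exact absurd hxS.2.2.1 (hiso (by rw [Real.dist_eq, abs_of_nonneg (by linarith)]; linarith)
        hxb)
  have hbz : b ≤ z := csInf_le hbd ⟨hz, le_rfl, hUz, hbad⟩
  have hprev : ∀ a, 0 < a → a < b → U a = 0 → GoodZero n p U U1 V V1 a := by
    intro a ha hab hUa
    by_contra hcon
    have := csInf_le hbd (show a ∈ S from ⟨ha, hab.le.trans hbz, hUa, hcon⟩)
    linarith
  rcases (H.U1_ne hbpos hUb).lt_or_gt with h | h
  · exact hbS (H.goodZero_step hbpos hUb hprev h)
  · refine hbS (goodZero_neg (H.neg.goodZero_step hbpos (by simpa using hUb) ?_ (by simpa using h)))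
    intro a h1 h2 h3
    refine goodZero_neg ?_
    simpa using hprev a h1 h2 (by simpa using h3)

end Shot

section existence

/-- `∫₀¹ τ^(n-1) g(tτ) dτ`. -/
noncomputable def avg (n : ℕ) (g : ℝ → ℝ) (t : ℝ) : ℝ := ∫ τ in (0 : ℝ)..1, τ ^ (n - 1) * g (t * τ)

/-- The radial inverse of the Laplacian, `∫₀^r t^(1-n) ∫₀^t s^(n-1) g(s) ds dt`. -/
noncomputable def radInt (n : ℕ) (g : ℝ → ℝ) (r : ℝ) : ℝ := ∫ t in (0 : ℝ)..r, t * avg n g t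

variable {n : ℕ} {g : ℝ → ℝ}

lemma continuous_avg (hg : Continuous g) : Continuous (avg n g) := by
  unfold avg
  apply intervalIntegral.continuous_parametric_intervalIntegral_of_continuous'
    (f := fun t τ : ℝ => τ ^ (n - 1) * g (t * τ))
  simp only [Function.uncurry_def]
  fun_prop

lemma avg_sub {g₁ g₂ : ℝ → ℝ} (h₁ : Continuous g₁) (h₂ : Continuous g₂) (t : ℝ) :
    avg n (fun s => g₁ s - g₂ s) t = avg n g₁ t - avg n g₂ t := by
  unfold avg
  rw [← intervalIntegral.integral_sub]
  · congr 1; funext τ; ring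
  · apply Continuous.intervalIntegrable; fun_prop
  · apply Continuous.intervalIntegrable; fun_prop

lemma radInt_sub {g₁ g₂ : ℝ → ℝ} (h₁ : Continuous g₁) (h₂ : Continuous g₂) (r : ℝ) :
    radInt n (fun s => g₁ s - g₂ s) r = radInt n g₁ r - radInt n g₂ r := by
  have c1 := continuous_avg (n := n) h₁
  have c2 := continuous_avg (n := n) h₂
  unfold radInt
  rw [← intervalIntegral.integral_sub]
  · congr 1; funext t; rw [avg_sub h₁ h₂]; ring
  · apply Continuous.intervalIntegrable; fun_prop
  · apply Continuous.intervalIntegrable; fun_prop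

lemma integral_exp_le {l r : ℝ} (hl : 0 < l) :
    ∫ t in (0 : ℝ)..r, exp (l * t) = (exp (l * r) - 1) / l := by
  rw [intervalIntegral.integral_eq_sub_of_hasDerivAt (f := fun t => exp (l * t) / l)]
  · simp; ring
  · intro x _
    refine (((hasDerivAt_id' x).const_mul l).exp.div_const l).congr_deriv ?_
    field_simp
  · apply Continuous.intervalIntegrable; fun_prop

lemma abs_radInt_le {l C : ℝ} (hl : 0 < l) (hC : 0 ≤ C)
    (h : ∀ s, 0 ≤ s → |g s| ≤ C * exp (l * s)) {r : ℝ} (hr : 0 ≤ r) :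
    |radInt n g r| ≤ C / l ^ 2 * exp (l * r) := by
  have h1 : ∀ t, 0 ≤ t → |t * avg n g t| ≤ C / l * exp (l * t) := by
    intro t ht
    have e1 : |avg n g t| ≤ ∫ τ in (0 : ℝ)..1, C * exp (l * t * τ) := by
      rw [← Real.norm_eq_abs, avg]
      refine intervalIntegral.norm_integral_le_of_norm_le (μ := MeasureTheory.volume) zero_le_one
        (Eventually.of_forall fun τ hτ => ?_)
        ((by fun_prop : Continuous fun τ : ℝ => C * exp (l * t * τ)).intervalIntegrable 0 1)
      rw [norm_mul, norm_pow, Real.norm_eq_abs, Real.norm_eq_abs, abs_of_pos hτ.1]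
      have e2 := h (t * τ) (mul_nonneg ht hτ.1.le)
      have e3 : τ ^ (n - 1) ≤ 1 := pow_le_one₀ hτ.1.le hτ.2
      calc τ ^ (n - 1) * |g (t * τ)| ≤ 1 * |g (t * τ)| :=
            mul_le_mul_of_nonneg_right e3 (abs_nonneg _)
        _ ≤ _ := by rw [one_mul, mul_assoc]; exact e2
    rcases ht.eq_or_lt with rfl | ht'
    · simp; positivity
    · rw [intervalIntegral.integral_const_mul, integral_exp_le (mul_pos hl ht'), mul_one] at e1
      rw [abs_mul, abs_of_pos ht']
      calc t * |avg n g t| ≤ t * (C * ((exp (l * t) - 1) / (l * t))) :=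
            mul_le_mul_of_nonneg_left e1 ht
        _ = C / l * (exp (l * t) - 1) := by field_simp
        _ ≤ _ := mul_le_mul_of_nonneg_left (by linarith) (by positivity)
  have h2 : |radInt n g r| ≤ ∫ t in (0 : ℝ)..r, C / l * exp (l * t) := by
    rw [← Real.norm_eq_abs, radInt]
    exact intervalIntegral.norm_integral_le_of_norm_le (μ := MeasureTheory.volume) hr
      (Eventually.of_forall fun t ht => h1 t ht.1.le)
      ((by fun_prop : Continuous fun t : ℝ => C / l * exp (l * t)).intervalIntegrable 0 r)
  rw [intervalIntegral.integral_const_mul, integral_exp_le hl] at h2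
  calc |radInt n g r| ≤ C / l * ((exp (l * r) - 1) / l) := h2
    _ = C / l ^ 2 * (exp (l * r) - 1) := by field_simp
    _ ≤ _ := mul_le_mul_of_nonneg_left (by linarith) (by positivity)

lemma hasDerivAt_radInt (hg : Continuous g) (r : ℝ) :
    HasDerivAt (radInt n g) (r * avg n g r) r := by
  have c1 := continuous_avg (n := n) hg
  exact (Continuous.integral_hasStrictDerivAt (f := fun t => t * avg n g t)
    (by fun_prop) 0 r).hasDerivAt

lemma avg_zero (hn : 1 ≤ n) : avg n g 0 = g 0 / n := by
  unfold avg
  simp only [zero_mul, intervalIntegral.integral_mul_const, integral_pow]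
  obtain ⟨m, rfl⟩ : ∃ m, n = m + 1 := ⟨n - 1, by omega⟩
  simp; field_simp

lemma hasDerivAt_mul_avg_zero (hg : Continuous g) :
    HasDerivAt (fun t => t * avg n g t) (avg n g 0) 0 := by
  have c1 := continuous_avg (n := n) hg
  rw [hasDerivAt_iff_tendsto_slope]
  refine ((c1.tendsto 0).mono_left nhdsWithin_le_nhds).congr' ?_
  refine eventually_nhdsWithin_of_forall fun x hx => ?_
  have hx : x ≠ 0 := hx
  simp [slope_def_field, hx]

lemma pow_mul_avg {r : ℝ} (hr : 0 < r) :
    r ^ (n - 1) * (r * avg n g r) = ∫ s in (0 : ℝ)..r, s ^ (n - 1) * g s := by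
  have h1 := intervalIntegral.integral_comp_mul_left (a := 0) (b := 1) (c := r)
    (fun s => s ^ (n - 1) * g s) hr.ne'
  simp only [mul_zero, mul_one, smul_eq_mul, mul_pow, mul_assoc,
    intervalIntegral.integral_const_mul] at h1
  unfold avg
  have := congrArg (fun x => r * x) h1
  simp only [mul_inv_cancel_left₀ hr.ne'] at this
  rw [← this]; ring

lemma hasDerivAt_mul_avg (hn : 1 ≤ n) (hg : Continuous g) {r : ℝ} (hr : 0 < r) :
    HasDerivAt (fun t => t * avg n g t) (g r - ((n : ℝ) - 1) * avg n g r) r := by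
  have hJ : HasDerivAt (fun t => ∫ s in (0 : ℝ)..t, s ^ (n - 1) * g s) (r ^ (n - 1) * g r) r :=
    (Continuous.integral_hasStrictDerivAt (f := fun s => s ^ (n - 1) * g s)
      (by fun_prop) 0 r).hasDerivAt
  have h1 := hJ.div (hasDerivAt_pow_pred hn hr) (pow_pos hr (n - 1)).ne'
  refine (h1.congr_of_eventuallyEq ?_).congr_deriv ?_
  · filter_upwards [lt_mem_nhds hr] with t ht
    rw [Pi.div_apply, ← pow_mul_avg ht]
    field_simp
  · rw [← pow_mul_avg hr]
    field_simp

/-- Global existence for the radial initial value problem with a Lipschitz nonlinearity. -/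
theorem exists_radial_of_lipschitz (hn : 1 ≤ n) (α : ℝ) {h : ℝ → ℝ → ℝ}
    (hc : Continuous (Function.uncurry h)) {L : ℝ} (hL : 0 ≤ L)
    (hlip : ∀ r s t, |h r s - h r t| ≤ L * |s - t|) (h0 : ∀ r, h r 0 = 0) :
    ∃ y y1 y2 : ℝ → ℝ, y 0 = α ∧ y1 0 = 0 ∧ Continuous y2 ∧ (∀ r, HasDerivAt y (y1 r) r) ∧
      (∀ r, 0 ≤ r → HasDerivAt y1 (y2 r) r) ∧
      (∀ r, 0 < r → y2 r + ((n : ℝ) - 1) / r * y1 r + h r (y r) = 0) := by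
  set l := 2 * L + 1 with hl
  have hl0 : 0 < l := by linarith
  have hLl : L / l ^ 2 ≤ 1 / 2 := by
    rw [div_le_div_iff₀ (by positivity) (by norm_num)]
    nlinarith
  let G : BoundedContinuousFunction ℝ ℝ → ℝ → ℝ := fun Y s => h s (exp (l * s) * Y s)
  have hGc : ∀ Y, Continuous (G Y) := fun Y => by
    have : Continuous (fun s : ℝ => ((s, exp (l * s) * Y s) : ℝ × ℝ)) := by
      have := Y.continuous
      fun_prop
    exact hc.comp this
  have hGsub : ∀ Y Z s, |G Y s - G Z s| ≤ L * dist Y Z * exp (l * s) := fun Y Z s => by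
    have e1 := hlip s (exp (l * s) * Y s) (exp (l * s) * Z s)
    have e2 : |Y s - Z s| ≤ dist Y Z := by
      have := BoundedContinuousFunction.dist_coe_le_dist (f := Y) (g := Z) s
      rwa [Real.dist_eq] at this
    rw [← mul_sub, abs_mul, abs_of_pos (exp_pos _)] at e1
    have e3 := mul_le_mul_of_nonneg_left e2 (mul_nonneg hL (exp_pos (l * s)).le)
    calc _ ≤ _ := e1
      _ = L * exp (l * s) * |Y s - Z s| := by ring
      _ ≤ _ := e3
      _ = _ := by ring
  have hGz : ∀ s, G 0 s = 0 := fun s => by simp [G, h0]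
  have hGb : ∀ Y s, |G Y s| ≤ L * dist Y 0 * exp (l * s) := fun Y s => by
    have := hGsub Y 0 s
    rwa [hGz, sub_zero] at this
  let T0 : BoundedContinuousFunction ℝ ℝ → ℝ → ℝ := fun Y r =>
    exp (-(l * |r|)) * (α - radInt n (G Y) |r|)
  have hT0c : ∀ Y, Continuous (T0 Y) := fun Y => by
    have c1 : Continuous (radInt n (G Y)) :=
      continuous_iff_continuousAt.2 fun r => (hasDerivAt_radInt (hGc Y) r).continuousAt
    have c2 : Continuous (fun r : ℝ => radInt n (G Y) |r|) := c1.comp continuous_abs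
    simp only [T0]
    fun_prop
  have hexp : ∀ r : ℝ, exp (-(l * |r|)) * exp (l * |r|) = 1 := fun r => by
    rw [← exp_add]; simp
  have hT0b : ∀ Y r, ‖T0 Y r‖ ≤ |α| + L * dist Y 0 / l ^ 2 := fun Y r => by
    have e1 := abs_radInt_le (n := n) (g := G Y) hl0 (mul_nonneg hL dist_nonneg)
      (fun s _ => hGb Y s) (abs_nonneg r)
    simp only [T0]
    rw [norm_mul, Real.norm_eq_abs, Real.norm_eq_abs, abs_of_pos (exp_pos _)]
    have e2 : |α - radInt n (G Y) (|r|)| ≤ |α| + |radInt n (G Y) (|r|)| :=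
      norm_sub_le α (radInt n (G Y) (|r|))
    have e3 : exp (-(l * |r|)) ≤ 1 := exp_le_one_iff.2 (by
      have := mul_nonneg hl0.le (abs_nonneg r)
      linarith)
    have e4 := (exp_pos (-(l * |r|))).le
    calc _ ≤ exp (-(l * |r|)) * (|α| + L * dist Y 0 / l ^ 2 * exp (l * |r|)) :=
          mul_le_mul_of_nonneg_left (by linarith) e4
      _ = exp (-(l * |r|)) * |α| + L * dist Y 0 / l ^ 2 * (exp (-(l * |r|)) * exp (l * |r|)) := by
          ring
      _ ≤ _ := by
          rw [hexp, mul_one]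
          have := mul_le_mul_of_nonneg_right e3 (abs_nonneg α)
          linarith
  let T : BoundedContinuousFunction ℝ ℝ → BoundedContinuousFunction ℝ ℝ := fun Y =>
    BoundedContinuousFunction.ofNormedAddCommGroup (T0 Y) (hT0c Y) _ (hT0b Y)
  have hTc : ContractingWith (1 / 2) T := by
    refine ⟨by
      rw [← NNReal.coe_lt_coe]; norm_num, LipschitzWith.of_dist_le_mul fun Y Z => ?_⟩
    have hhalf : (((1 / 2 : NNReal)) : ℝ) = 1 / 2 := by norm_num
    rw [hhalf]
    refine (BoundedContinuousFunction.dist_le (by positivity)).2 fun r => ?_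
    change dist (T0 Y r) (T0 Z r) ≤ _
    have e1 := abs_radInt_le (n := n) (g := G Y - G Z) hl0 (mul_nonneg hL dist_nonneg)
      (fun s _ => hGsub Y Z s) (abs_nonneg r)
    have e0 : radInt n (G Y - G Z) |r| = radInt n (G Y) |r| - radInt n (G Z) |r| :=
      radInt_sub (hGc Y) (hGc Z) _
    rw [e0] at e1
    have e2 : T0 Y r - T0 Z r = -(exp (-(l * |r|)) * (radInt n (G Y) |r| - radInt n (G Z) |r|)) := by
      simp only [T0]; ring
    rw [Real.dist_eq, e2, abs_neg, abs_mul, abs_of_pos (exp_pos _)]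
    calc _ ≤ exp (-(l * |r|)) * (L * dist Y Z / l ^ 2 * exp (l * |r|)) :=
          mul_le_mul_of_nonneg_left e1 (exp_pos _).le
      _ = L / l ^ 2 * dist Y Z * (exp (-(l * |r|)) * exp (l * |r|)) := by ring
      _ ≤ _ := by
          rw [hexp, mul_one]
          exact mul_le_mul_of_nonneg_right hLl dist_nonneg
  obtain ⟨Y, hY⟩ : ∃ Y, T Y = Y := ⟨_, hTc.fixedPoint_isFixedPt⟩
  have hYr : ∀ r, 0 ≤ r → exp (l * r) * Y r = α - radInt n (G Y) r := fun r hr => by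
    have e1 : T0 Y r = Y r := congrArg (fun Z : BoundedContinuousFunction ℝ ℝ => Z r) hY
    simp only [T0] at e1
    rw [abs_of_nonneg hr] at e1
    rw [← e1, ← mul_assoc, ← exp_add]; simp
  refine ⟨fun r => α - radInt n (G Y) r, fun r => -(r * avg n (G Y) r),
    fun r => -(G Y r) + ((n : ℝ) - 1) * avg n (G Y) r, by simp [radInt], by simp, ?_, ?_, ?_, ?_⟩
  · have c1 := continuous_avg (n := n) (hGc Y)
    have c2 := hGc Y
    fun_prop
  · exact fun r => (hasDerivAt_radInt (hGc Y) r).const_sub α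
  · intro r hr
    rcases hr.eq_or_lt with rfl | hr
    · refine (hasDerivAt_mul_avg_zero (hGc Y)).neg.congr_deriv ?_
      simp only [avg_zero hn]
      have : (n : ℝ) ≠ 0 := by
        have : n ≠ 0 := by omega
        exact_mod_cast this
      field_simp; ring
    · refine (hasDerivAt_mul_avg hn (hGc Y) hr).neg.congr_deriv ?_
      ring
  · intro r hr
    have e1 : h r (α - radInt n (G Y) r) = G Y r := by
      simp only [G]; rw [hYr r hr.le]
    rw [e1]
    field_simp
    ring

end existence

section boundedIVP

/-- The nonlinearity `-ε s + |s|^(p-1) s`. -/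
noncomputable def fe (p ε s : ℝ) : ℝ := f p s + (1 - ε) * s

lemma fe_one (p s : ℝ) : fe p 1 s = f p s := by simp [fe]

lemma fe_zero_right (p ε : ℝ) : fe p ε 0 = 0 := by simp [fe, f_zero]

lemma fe_neg (p ε s : ℝ) : fe p ε (-s) = -fe p ε s := by simp [fe, f_neg]; ring

lemma fe_eq (p ε s : ℝ) : fe p ε s = (|s| ^ (p - 1) - ε) * s := by rw [fe, f]; ring

variable {p ε : ℝ}

lemma hasDerivAt_fe (hp : 1 < p) (s : ℝ) : HasDerivAt (fe p ε) (fder p s + (1 - ε)) s :=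
  ((hasDerivAt_f hp s).add ((hasDerivAt_id' s).const_mul (1 - ε))).congr_deriv (by simp)

lemma continuous_fe (hp : 1 < p) : Continuous (fe p ε) :=
  (continuous_f hp).add (by fun_prop)

lemma abs_fder_add_le (hp : 1 < p) (hε0 : 0 ≤ ε) (hε1 : ε ≤ 1) {A s : ℝ} (hs : |s| ≤ A) :
    |fder p s + (1 - ε)| ≤ 1 + p * A ^ (p - 1) := by
  have h1 : |s| ^ (p - 1) ≤ A ^ (p - 1) := rpow_le_rpow (abs_nonneg s) hs (by linarith)
  have h2 : 0 ≤ |s| ^ (p - 1) := rpow_nonneg (abs_nonneg s) _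
  have h3 : p * |s| ^ (p - 1) ≤ p * A ^ (p - 1) := mul_le_mul_of_nonneg_left h1 (by linarith)
  have h4 : 0 ≤ p * |s| ^ (p - 1) := mul_nonneg (by linarith) h2
  rw [fder, abs_le]
  constructor <;> linarith

lemma abs_fe_sub_le (hp : 1 < p) (hε0 : 0 ≤ ε) (hε1 : ε ≤ 1) {A s t : ℝ} (hs : |s| ≤ A)
    (ht : |t| ≤ A) : |fe p ε s - fe p ε t| ≤ (1 + p * A ^ (p - 1)) * |s - t| :=
  Convex.norm_image_sub_le_of_norm_hasDerivWithin_le (s := Icc (-A) A)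
    (fun x _ => (hasDerivAt_fe hp x).hasDerivWithinAt)
    (fun _ hx => abs_fder_add_le hp hε0 hε1 (abs_le.2 ⟨hx.1, hx.2⟩)) (convex_Icc _ _)
    (abs_le.1 ht) (abs_le.1 hs)

/-- The radial initial value problem with nonlinearity `g(r)`. -/
structure IVP (n : ℕ) (g : ℝ → ℝ) (α : ℝ) (u u1 u2 : ℝ → ℝ) : Prop where
  u0 : u 0 = α
  u10 : u1 0 = 0
  c2 : Continuous u2
  d0 : ∀ r, HasDerivAt u (u1 r) r
  d1 : ∀ r, 0 ≤ r → HasDerivAt u1 (u2 r) r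
  ode : ∀ r, 0 < r → u2 r + ((n : ℝ) - 1) / r * u1 r + g r = 0

variable {n : ℕ} {g : ℝ → ℝ} {α : ℝ} {u u1 u2 : ℝ → ℝ}

lemma IVP.radial (h : IVP n g α u u1 u2) : Radial n g u u1 where
  d0 := fun r _ => h.d0 r
  d1 := fun r hr => (h.d1 r hr.le).congr_deriv (by have := h.ode r hr; linarith)
  c0 := fun r _ => (h.d0 r).continuousAt.continuousWithinAt
  c1 := fun r hr => (h.d1 r hr).continuousAt.continuousWithinAt

lemma IVP.continuous (h : IVP n g α u u1 u2) : Continuous u :=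
  continuous_iff_continuousAt.2 fun r => (h.d0 r).continuousAt

/-- The energy of a solution of the `ε`-problem. -/
noncomputable def energyE (p ε : ℝ) (u u1 : ℝ → ℝ) (r : ℝ) : ℝ :=
  u1 r ^ 2 / 2 + (F p (u r) + (1 - ε) * u r ^ 2 / 2)

lemma energyE_le (hn : 1 ≤ n) (hp : 1 < p) (hU : Radial n g u u1) {b : ℝ} (hb : 0 ≤ b)
    (hg : ∀ r, 0 < r → r < b → g r = fe p ε (u r)) :
    energyE p ε u u1 b ≤ energyE p ε u u1 0 := by
  have hn' : (1 : ℝ) ≤ n := by exact_mod_cast hn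
  have hsub : Icc 0 b ⊆ Ici (0 : ℝ) := fun x hx => hx.1
  refine le_of_hasDerivAt_nonpos (g := energyE p ε u u1)
    (g' := fun r => -(((n : ℝ) - 1) / r * u1 r ^ 2)) hb ?_ ?_ ?_
  · have k0 := hU.c0.mono hsub
    have k1 := hU.c1.mono hsub
    have k2 := (continuous_F hp).comp_continuousOn k0
    unfold energyE
    exact ((k1.pow 2).div_const 2).add (k2.add ((continuousOn_const.mul (k0.pow 2)).div_const 2))
  · intro r hr
    have k0 := hU.d0 r hr.1
    have k1 := hU.d1 r hr.1
    have k2 := (hasDerivAt_F hp (u r)).comp r k0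
    refine (((k1.pow 2).div_const 2).add
      (k2.add (((k0.pow 2).const_mul (1 - ε)).div_const 2))).congr_deriv ?_
    rw [hg r hr.1 hr.2, fe]
    push_cast
    ring
  · intro r hr
    have := mul_nonneg (div_nonneg (sub_nonneg.2 hn') hr.1.le) (sq_nonneg (u1 r))
    linarith

lemma strictMono_potential (hp : 1 < p) (hε1 : ε ≤ 1) {s t : ℝ} (hs : 1 ≤ s) (hst : s < t) :
    F p s + (1 - ε) * s ^ 2 / 2 < F p t + (1 - ε) * t ^ 2 / 2 := by
  refine lt_of_hasDerivAt_pos (g := fun x => F p x + (1 - ε) * x ^ 2 / 2)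
    (g' := fun x => fe p ε x) hst ?_ ?_ ?_
  · have := continuous_F hp
    fun_prop
  · intro x _
    refine ((hasDerivAt_F hp x).add
      ((((hasDerivAt_id' x).pow 2).const_mul (1 - ε)).div_const 2)).congr_deriv ?_
    rw [fe]; push_cast; ring
  · intro x hx
    have hx1 : 1 < x := lt_of_le_of_lt hs hx.1
    rw [fe_eq, abs_of_pos (by linarith)]
    have := one_lt_rpow hx1 (by linarith : 0 < p - 1)
    exact mul_pos (by linarith) (by linarith)

lemma abs_clamp_sub_le (A s t : ℝ) : |max (-A) (min s A) - max (-A) (min t A)| ≤ |s - t| := by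
  have h1 := abs_max_sub_max_le_max (-A) (min s A) (-A) (min t A)
  have h2 := abs_min_sub_min_le_max s A t A
  simp at h1 h2
  linarith

lemma clamp_eq {A s : ℝ} (h : |s| ≤ A) : max (-A) (min s A) = s := by
  rw [abs_le] at h
  rw [min_eq_left h.2, max_eq_right h.1]

lemma abs_clamp_le {A : ℝ} (hA : 0 ≤ A) (s : ℝ) : |max (-A) (min s A)| ≤ A := by
  rw [abs_le]
  exact ⟨le_max_left _ _, max_le (by linarith) (min_le_right _ _)⟩

theorem exists_IVP (hn : 1 ≤ n) (hp : 1 < p) (hε0 : 0 ≤ ε) (hε1 : ε ≤ 1) (hα : 1 ≤ α) :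
    ∃ u u1 u2 : ℝ → ℝ, IVP n (fun r => fe p ε (u r)) α u u1 u2 ∧ ∀ r, 0 ≤ r → |u r| ≤ α := by
  have hA : (0 : ℝ) ≤ 2 * α := by linarith
  have hcf := continuous_fe (ε := ε) hp
  obtain ⟨u, u1, u2, h0, h10, hc2, hd0, hd1, hode⟩ := exists_radial_of_lipschitz (n := n) hn α
    (h := fun _ s => fe p ε (max (-(2 * α)) (min s (2 * α))))
    (by simp only [Function.uncurry_def]; fun_prop)
    (L := 1 + p * (2 * α) ^ (p - 1))
    (by have := rpow_nonneg hA (p - 1); positivity)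
    (fun _ s t => (abs_fe_sub_le hp hε0 hε1 (abs_clamp_le hA s) (abs_clamp_le hA t)).trans
      (mul_le_mul_of_nonneg_left (abs_clamp_sub_le _ _ _)
        (by have := rpow_nonneg hA (p - 1); positivity)))
    (fun _ => by rw [clamp_eq (by simpa using hA)]; exact fe_zero_right _ _)
  have hI : IVP n (fun r => fe p ε (max (-(2 * α)) (min (u r) (2 * α)))) α u u1 u2 :=
    ⟨h0, h10, hc2, hd0, hd1, hode⟩
  have hb : ∀ r, 0 ≤ r → |u r| ≤ α := by
    by_contra! hcon
    obtain ⟨r1, hr1, hlt⟩ := hcon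
    have hδ : 0 < min (|u r1| - α) α := lt_min (by linarith) (by linarith)
    set δ := min (|u r1| - α) α with hδd
    have hδ1 : δ ≤ |u r1| - α := min_le_left _ _
    have hδ2 : δ ≤ α := min_le_right _ _
    have hcu := hI.continuous
    obtain ⟨r, hr0, -, hr, hlt⟩ := exists_first_zero (g := fun x => α + δ - |u x|) hr1
      (by fun_prop) (by simp only [h0]; rw [abs_of_pos (by linarith)]; linarith)
      (by linarith)
    have e1 := energyE_le (ε := ε) hn hp hI.radial hr0.le (fun x hx0 hx => by
      have := hlt x hx0.le hx
      rw [clamp_eq (by linarith)])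
    have e2 := strictMono_potential hp hε1 hα (by linarith : α < α + δ)
    have e3 : |u r| = α + δ := by linarith
    have e4 : F p (u r) = F p (α + δ) := by
      rw [← e3]
      rcases abs_choice (u r) with h | h <;> rw [h]
      rw [F_neg]
    have e5 : u r ^ 2 = (α + δ) ^ 2 := by rw [← e3, sq_abs]
    rw [energyE, energyE, h10, h0, e4, e5] at e1
    nlinarith [sq_nonneg (u1 r)]
  refine ⟨u, u1, u2, ⟨h0, h10, hc2, hd0, hd1, fun r hr => ?_⟩, hb⟩
  have := hode r hr
  rwa [clamp_eq ((hb r hr.le).trans (by linarith))] at this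

theorem exists_linear (hn : 1 ≤ n) {q : ℝ → ℝ} (hq : Continuous q) {L : ℝ}
    (hL : ∀ r, 0 ≤ r → |q r| ≤ L) :
    ∃ v v1 v2 : ℝ → ℝ, IVP n (fun r => q r * v r) 1 v v1 v2 := by
  obtain ⟨v, v1, v2, h0, h10, hc2, hd0, hd1, hode⟩ := exists_radial_of_lipschitz (n := n) hn 1
    (h := fun r s => q (|r|) * s)
    (by simp only [Function.uncurry_def]; fun_prop)
    (L := L) ((abs_nonneg _).trans (hL 0 le_rfl))
    (fun r s t => by
      rw [← mul_sub, abs_mul]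
      exact mul_le_mul_of_nonneg_right (hL _ (abs_nonneg r)) (abs_nonneg _))
    (fun _ => by simp)
  refine ⟨v, v1, v2, h0, h10, hc2, hd0, hd1, fun r hr => ?_⟩
  have := hode r hr
  rwa [abs_of_pos hr] at this

end boundedIVP

section gronwall

variable {n : ℕ} {p : ℝ}

lemma Radial.sub {g h U U1 V V1 : ℝ → ℝ} (hU : Radial n g U U1) (hV : Radial n h V V1) :
    Radial n (fun r => g r - h r) (fun r => U r - V r) (fun r => U1 r - V1 r) where
  d0 := fun r hr => (hU.d0 r hr).sub (hV.d0 r hr)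
  d1 := fun r hr => ((hU.d1 r hr).sub (hV.d1 r hr)).congr_deriv (by ring)
  c0 := hU.c0.sub hV.c0
  c1 := hU.c1.sub hV.c1

lemma Radial.const_mul {g U U1 : ℝ → ℝ} (c : ℝ) (hU : Radial n g U U1) :
    Radial n (fun r => c * g r) (fun r => c * U r) (fun r => c * U1 r) where
  d0 := fun r hr => (hU.d0 r hr).const_mul c
  d1 := fun r hr => ((hU.d1 r hr).const_mul c).congr_deriv (by ring)
  c0 := continuousOn_const.mul hU.c0
  c1 := continuousOn_const.mul hU.c1

lemma Radial.gronwall (hn : 1 ≤ n) {g y y1 : ℝ → ℝ} (hU : Radial n g y y1) {L δ R : ℝ}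
    (hL : 0 ≤ L) (hg : ∀ r, 0 < r → r < R → |g r| ≤ L * |y r| + δ) {r : ℝ} (hr : 0 ≤ r)
    (hrR : r ≤ R) :
    y r ^ 2 + y1 r ^ 2 ≤ exp ((L + 2) * r) * (y 0 ^ 2 + y1 0 ^ 2 + δ ^ 2) := by
  have hn' : (1 : ℝ) ≤ n := by exact_mod_cast hn
  have hsub : Icc 0 r ⊆ Ici (0 : ℝ) := fun x hx => hx.1
  have key : exp (-((L + 2) * r)) * (y r ^ 2 + y1 r ^ 2 + δ ^ 2) ≤
      exp (-((L + 2) * 0)) * (y 0 ^ 2 + y1 0 ^ 2 + δ ^ 2) := by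
    refine le_of_hasDerivAt_nonpos
      (g := fun x => exp (-((L + 2) * x)) * (y x ^ 2 + y1 x ^ 2 + δ ^ 2))
      (g' := fun x => exp (-((L + 2) * x)) * (2 * y x * y1 x +
        2 * y1 x * (-(((n : ℝ) - 1) / x * y1 x) - g x) -
        (L + 2) * (y x ^ 2 + y1 x ^ 2 + δ ^ 2))) hr ?_ ?_ ?_
    · have k0 := hU.c0.mono hsub
      have k1 := hU.c1.mono hsub
      exact (Continuous.continuousOn (by fun_prop)).mul
        (((k0.pow 2).add (k1.pow 2)).add continuousOn_const)
    · intro x hx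
      have k0 := hU.d0 x hx.1
      have k1 := hU.d1 x hx.1
      refine ((((hasDerivAt_id' x).const_mul (L + 2)).neg.exp).mul
        (((k0.pow 2).add (k1.pow 2)).add_const (δ ^ 2))).congr_deriv ?_
      push_cast
      simp only [Pi.add_apply, Pi.pow_apply, Pi.neg_apply]
      ring
    · intro x hx
      refine mul_nonpos_of_nonneg_of_nonpos (exp_pos _).le ?_
      have e1 := hg x hx.1 (hx.2.trans_le hrR)
      have e2 := mul_nonneg (div_nonneg (sub_nonneg.2 hn') hx.1.le) (sq_nonneg (y1 x))
      have e3 : -(y1 x * g x) ≤ |y1 x| * (L * |y x| + δ) := by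
        calc _ ≤ |y1 x * g x| := neg_le_abs _
          _ = |y1 x| * |g x| := abs_mul _ _
          _ ≤ _ := mul_le_mul_of_nonneg_left e1 (abs_nonneg _)
      have e4 : L * (2 * |y1 x| * |y x|) ≤ L * (y x ^ 2 + y1 x ^ 2) := by
        apply mul_le_mul_of_nonneg_left _ hL
        have := sq_nonneg (|y1 x| - |y x|)
        nlinarith [sq_abs (y1 x), sq_abs (y x)]
      have e5 : 2 * |y1 x| * δ ≤ y1 x ^ 2 + δ ^ 2 := by
        nlinarith [sq_abs (y1 x), sq_nonneg (|y1 x| - δ)]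
      nlinarith [sq_nonneg (y x - y1 x), sq_nonneg δ, sq_nonneg (y x), mul_nonneg hL (sq_nonneg δ)]
  simp only [mul_zero, neg_zero, exp_zero, one_mul] at key
  have h2 : exp ((L + 2) * r) * exp (-((L + 2) * r)) = 1 := by rw [← exp_add]; simp
  have h3 := mul_le_mul_of_nonneg_left key (exp_pos ((L + 2) * r)).le
  rw [← mul_assoc, h2, one_mul] at h3
  linarith [sq_nonneg δ]

lemma Radial.rho_pos (hn : 1 ≤ n) {g y y1 : ℝ → ℝ} (hU : Radial n g y y1) {L : ℝ} (hL : 0 ≤ L)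
    (hg : ∀ r, 0 < r → |g r| ≤ L * |y r|) (h0 : y 0 ≠ 0) {R : ℝ} (hR : 0 ≤ R) :
    0 < y R ^ 2 + y1 R ^ 2 := by
  have hn' : (1 : ℝ) ≤ n := by exact_mod_cast hn
  by_contra hcon
  have hR0 : y R ^ 2 + y1 R ^ 2 = 0 := by linarith [sq_nonneg (y R), sq_nonneg (y1 R)]
  have key : ∀ a, 0 < a → a ≤ R → y a = 0 := by
    intro a ha haR
    set C := 2 * ((n : ℝ) - 1) / a + L + 1 with hC
    have hsub : Icc a R ⊆ Ici (0 : ℝ) := fun x hx => ha.le.trans hx.1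
    have h1 : exp (C * a) * (y a ^ 2 + y1 a ^ 2) ≤ exp (C * R) * (y R ^ 2 + y1 R ^ 2) := by
      refine le_of_hasDerivAt_nonneg
        (g := fun x => exp (C * x) * (y x ^ 2 + y1 x ^ 2))
        (g' := fun x => exp (C * x) * (2 * y x * y1 x +
          2 * y1 x * (-(((n : ℝ) - 1) / x * y1 x) - g x) +
          C * (y x ^ 2 + y1 x ^ 2))) haR ?_ ?_ ?_
      · have k0 := hU.c0.mono hsub
        have k1 := hU.c1.mono hsub
        exact (Continuous.continuousOn (by fun_prop)).mul ((k0.pow 2).add (k1.pow 2))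
      · intro x hx
        have k0 := hU.d0 x (ha.trans hx.1)
        have k1 := hU.d1 x (ha.trans hx.1)
        refine ((((hasDerivAt_id' x).const_mul C).exp).mul
          ((k0.pow 2).add (k1.pow 2))).congr_deriv ?_
        push_cast
        simp only [Pi.add_apply, Pi.pow_apply]
        ring
      · intro x hx
        have hx0 := ha.trans hx.1
        refine mul_nonneg (exp_pos _).le ?_
        have e1 := hg x hx0
        have e2 : ((n : ℝ) - 1) / x * y1 x ^ 2 ≤ ((n : ℝ) - 1) / a * y1 x ^ 2 :=
          mul_le_mul_of_nonneg_right
            (div_le_div_of_nonneg_left (by linarith) ha hx.1.le) (sq_nonneg _)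
        have e3 : y1 x * g x ≤ |y1 x| * (L * |y x|) := by
          calc _ ≤ |y1 x * g x| := le_abs_self _
            _ = |y1 x| * |g x| := abs_mul _ _
            _ ≤ _ := mul_le_mul_of_nonneg_left e1 (abs_nonneg _)
        have e4 : L * (2 * |y1 x| * |y x|) ≤ L * (y x ^ 2 + y1 x ^ 2) := by
          apply mul_le_mul_of_nonneg_left _ hL
          have := sq_nonneg (|y1 x| - |y x|)
          nlinarith [sq_abs (y1 x), sq_abs (y x)]
        have e6 : 0 ≤ ((n : ℝ) - 1) / a * y x ^ 2 :=
          mul_nonneg (div_nonneg (by linarith) ha.le) (sq_nonneg _)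
        have e7 : 2 * ((n : ℝ) - 1) / a = 2 * (((n : ℝ) - 1) / a) := by ring
        rw [hC, e7]
        nlinarith [sq_nonneg (y x + y1 x)]
    rw [hR0, mul_zero] at h1
    have h2 : y a ^ 2 + y1 a ^ 2 ≤ 0 := by
      by_contra h
      have := mul_pos (exp_pos (C * a)) (not_le.1 h)
      linarith
    have : y a ^ 2 = 0 := le_antisymm (by linarith [sq_nonneg (y1 a)]) (sq_nonneg _)
    exact pow_eq_zero_iff (two_ne_zero) |>.1 this
  apply h0
  rcases hR.eq_or_lt with rfl | hR'
  · have : y 0 ^ 2 = 0 := le_antisymm (by linarith [sq_nonneg (y1 0)]) (sq_nonneg _)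
    exact pow_eq_zero_iff (two_ne_zero) |>.1 this
  have h1 : Tendsto y (nhdsWithin 0 (Ioi 0)) (nhds (y 0)) :=
    (hU.c0 0 self_mem_Ici).mono_left (nhdsWithin_mono _ Ioi_subset_Ici_self)
  refine tendsto_nhds_unique h1 (tendsto_const_nhds.congr' ?_)
  filter_upwards [Ioo_mem_nhdsGT hR'] with a ha
  exact (key a ha.1 ha.2.le).symm

lemma radial_dist_le (hn : 1 ≤ n) (hp : 1 < p) {ε ε' : ℝ} (hε0 : 0 ≤ ε) (hε1 : ε ≤ 1)
    {U U1 V V1 : ℝ → ℝ} (hU : Radial n (fun r => fe p ε (U r)) U U1)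
    (hV : Radial n (fun r => fe p ε' (V r)) V V1) {A R : ℝ}
    (hUA : ∀ r, 0 ≤ r → r ≤ R → |U r| ≤ A) (hVA : ∀ r, 0 ≤ r → r ≤ R → |V r| ≤ A) {r : ℝ}
    (hr : 0 ≤ r) (hrR : r ≤ R) :
    (U r - V r) ^ 2 + (U1 r - V1 r) ^ 2 ≤ exp ((1 + p * A ^ (p - 1) + 2) * r) *
      ((U 0 - V 0) ^ 2 + (U1 0 - V1 0) ^ 2 + (|ε' - ε| * A) ^ 2) := by
  have hA : 0 ≤ A := (abs_nonneg _).trans (hUA r hr hrR)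
  refine (hU.sub hV).gronwall hn (R := R) (by have := rpow_nonneg hA (p - 1); positivity) ?_ hr hrR
  intro x hx0 hxR
  have e1 := abs_fe_sub_le hp hε0 hε1 (hUA x hx0.le hxR.le) (hVA x hx0.le hxR.le)
  have e2 : fe p ε (U x) - fe p ε' (V x) = (fe p ε (U x) - fe p ε (V x)) + (ε' - ε) * V x := by
    simp only [fe]; ring
  rw [e2]
  refine (abs_add_le _ _).trans (add_le_add e1 ?_)
  rw [abs_mul]
  exact mul_le_mul_of_nonneg_left (hVA x hx0.le hxR.le) (abs_nonneg _)

lemma radial_unique (hn : 1 ≤ n) (hp : 1 < p) {U U1 V V1 : ℝ → ℝ}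
    (hU : Radial n (fun r => fe p 1 (U r)) U U1) (hV : Radial n (fun r => fe p 1 (V r)) V V1)
    (h0 : U 0 = V 0) (h1 : U1 0 = V1 0) {r : ℝ} (hr : 0 ≤ r) : U r = V r ∧ U1 r = V1 r := by
  have hsub : Icc 0 r ⊆ Ici (0 : ℝ) := fun x hx => hx.1
  obtain ⟨A, hA⟩ := isCompact_Icc.exists_bound_of_continuousOn (hU.c0.mono hsub)
  obtain ⟨B, hB⟩ := isCompact_Icc.exists_bound_of_continuousOn (hV.c0.mono hsub)
  have := radial_dist_le hn hp zero_le_one le_rfl hU hV (A := max A B) (R := r)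
    (fun x h h' => (hA x ⟨h, h'⟩).trans (le_max_left _ _))
    (fun x h h' => (hB x ⟨h, h'⟩).trans (le_max_right _ _)) hr le_rfl
  rw [h0, h1] at this
  simp at this
  have k1 := sq_nonneg (U r - V r)
  have k2 := sq_nonneg (U1 r - V1 r)
  constructor
  · exact sub_eq_zero.1 (pow_eq_zero_iff two_ne_zero |>.1 (le_antisymm (by linarith) k1))
  · exact sub_eq_zero.1 (pow_eq_zero_iff two_ne_zero |>.1 (le_antisymm (by linarith) k2))

lemma taylor_f (hp : 1 < p) (A : ℝ) {η : ℝ} (hη : 0 < η) :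
    ∃ ρ > 0, ∀ s t, |s| ≤ A → |t| ≤ A → |t - s| < ρ →
      |f p t - f p s - fder p s * (t - s)| ≤ η * |t - s| := by
  have huc := isCompact_Icc.uniformContinuousOn_of_continuous
    ((continuous_fder hp).continuousOn (s := Icc (-A) A))
  obtain ⟨ρ, hρ, h⟩ := Metric.uniformContinuousOn_iff.1 huc η hη
  refine ⟨ρ, hρ, fun s t hs ht hst => ?_⟩
  have hsA : s ∈ Icc (-A) A := abs_le.1 hs
  have htA : t ∈ Icc (-A) A := abs_le.1 ht
  have := Convex.norm_image_sub_le_of_norm_hasDerivWithin_le (s := uIcc s t)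
    (f := fun x => f p x - fder p s * x) (f' := fun x => fder p x - fder p s) (C := η)
    (fun x _ => ((hasDerivAt_f hp x).sub
      (((hasDerivAt_id' x).const_mul (fder p s)).congr_deriv (mul_one _))).hasDerivWithinAt)
    (fun x hx => by
      have hxA : x ∈ Icc (-A) A := (convex_Icc (-A) A).ordConnected.uIcc_subset hsA htA hx
      have h1 : |x - s| < ρ := lt_of_le_of_lt (abs_sub_left_of_mem_uIcc hx) (by rwa [abs_sub_comm] at hst ⊢)
      exact (h x hxA s hsA h1).le) (convex_uIcc s t) left_mem_uIcc right_mem_uIcc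
  simp only [Real.norm_eq_abs] at this
  convert this using 2
  ring

theorem variation_approx (hn : 1 ≤ n) (hp : 1 < p) {α R : ℝ} (hα : 1 ≤ α) (hR : 0 ≤ R)
    {U U1 V V1 : ℝ → ℝ} (hU : Radial n (fun r => f p (U r)) U U1)
    (hUA : ∀ r, 0 ≤ r → |U r| ≤ α) (hU0 : U 0 = α) (hU10 : U1 0 = 0)
    (hV : Radial n (fun r => fder p (U r) * V r) V V1) (hV0 : V 0 = 1) (hV10 : V1 0 = 0)
    {c : ℝ} (hc : 0 < c) :
    ∃ ρ > 0, ∀ β W W1, |β - α| < ρ → Radial n (fun r => f p (W r)) W W1 →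
      (∀ r, 0 ≤ r → |W r| ≤ β) → W 0 = β → W1 0 = 0 →
      |W R - U R - (β - α) * V R| ≤ c * |β - α| := by
  set A := α + 1 with hA
  set L := 1 + p * A ^ (p - 1) with hLd
  have hL : 0 ≤ L := by have := rpow_nonneg (by linarith : 0 ≤ A) (p - 1); positivity
  set K := exp ((L + 2) * R) with hK
  have hK1 : 1 ≤ K := one_le_exp (by positivity)
  have hη : 0 < c / K ^ 2 := by positivity
  obtain ⟨ρ, hρ, hT⟩ := taylor_f hp A hη
  refine ⟨min 1 (ρ / K), by positivity, fun β W W1 hβ hW hWA hW0 hW10 => ?_⟩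
  have hβ1 : |β - α| < 1 := hβ.trans_le (min_le_left _ _)
  have hβ2 : |β - α| < ρ / K := hβ.trans_le (min_le_right _ _)
  have hβA : β ≤ A := by have := (abs_lt.1 hβ1).2; linarith
  have hWA' : ∀ r, 0 ≤ r → |W r| ≤ A := fun r hr => (hWA r hr).trans hβA
  have hUA' : ∀ r, 0 ≤ r → |U r| ≤ A := fun r hr => (hUA r hr).trans (by linarith)
  have hd : ∀ r, 0 ≤ r → r ≤ R → |W r - U r| ≤ K * |β - α| := by
    intro r hr hrR
    have h1 := radial_dist_le (ε := 1) (ε' := 1) (R := R) hn hp zero_le_one le_rfl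
      (by simpa only [fe_one] using hW) (by simpa only [fe_one] using hU)
      (fun r hr _ => hWA' r hr) (fun r hr _ => hUA' r hr) hr hrR
    rw [hW0, hU0, hW10, hU10] at h1
    simp only [sub_self, abs_zero, zero_mul] at h1
    rw [← hLd] at h1
    have h2 : exp ((L + 2) * r) ≤ K := exp_le_exp.2 (mul_le_mul_of_nonneg_left hrR (by positivity))
    refine abs_le_of_sq_le_sq ?_ (by positivity)
    rw [mul_pow, sq_abs]
    have h3 := mul_le_mul_of_nonneg_right h2 (sq_nonneg (β - α))
    nlinarith [sq_nonneg (W1 r - U1 r), mul_nonneg (by nlinarith : 0 ≤ K ^ 2 - K) (sq_nonneg (β - α))]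
  have hy := ((hW.sub hU).sub (hV.const_mul (β - α))).gronwall hn (L := L)
    (δ := c / K * |β - α|) (R := R) hL (fun r hr0 hrR => ?_) hR le_rfl
  · simp only [hW0, hU0, hV0, hW10, hU10, hV10, ← hK] at hy
    refine abs_le_of_sq_le_sq ?_ (by positivity)
    have e1 : K * (c / K * |β - α|) ^ 2 ≤ (c * |β - α|) ^ 2 := by
      have : K * (c / K * |β - α|) ^ 2 = (c * |β - α|) ^ 2 / K := by field_simp
      rw [this]
      exact div_le_self (sq_nonneg _) hK1
    ring_nf at hy e1 ⊢
    nlinarith [sq_nonneg (W1 R - U1 R - (β - α) * V1 R)]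
  · have e0 := hd r hr0.le hrR.le
    have e1 := hT (U r) (W r) (hUA' r hr0.le) (hWA' r hr0.le)
      (lt_of_le_of_lt e0 (by rwa [lt_div_iff₀' (by positivity)] at hβ2))
    have e2 := abs_fder_add_le (ε := 1) hp zero_le_one le_rfl (hUA' r hr0.le)
    simp only [sub_self, add_zero] at e2
    have e3 : f p (W r) - f p (U r) - (β - α) * (fder p (U r) * V r) =
        fder p (U r) * (W r - U r - (β - α) * V r) +
        (f p (W r) - f p (U r) - fder p (U r) * (W r - U r)) := by ring
    rw [e3]
    refine (abs_add_le _ _).trans (add_le_add ?_ (e1.trans ?_))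
    · rw [abs_mul]
      exact mul_le_mul_of_nonneg_right e2 (abs_nonneg _)
    · calc c / K ^ 2 * |W r - U r| ≤ c / K ^ 2 * (K * |β - α|) :=
            mul_le_mul_of_nonneg_left e0 hη.le
        _ = _ := by field_simp

end gronwall

section polar

/-- A continuous polar representation of the phase curve `(u, u')`. -/
structure Polar (u u1 A θ : ℝ → ℝ) : Prop where
  hu : ∀ r, 0 ≤ r → u r = A r * cos (θ r)
  hu1 : ∀ r, 0 ≤ r → u1 r = A r * sin (θ r)
  hA : ∀ r, 0 ≤ r → 0 < A r
  hc : ContinuousOn θ (Ici 0)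
  h0 : θ 0 = 0
  hd : ∀ r, 0 < r → u r = 0 → HasDerivAt θ (-1) r

theorem IVP.exists_polar {n : ℕ} {g : ℝ → ℝ} {α : ℝ} {u u1 u2 : ℝ → ℝ}
    (h : IVP n g α u u1 u2) (hα : 0 < α) (hρ : ∀ r, 0 ≤ r → 0 < u r ^ 2 + u1 r ^ 2) :
    ∃ A θ, Polar u u1 A θ := by
  set T : ℝ → ℝ := fun r => (u r * u2 r - u1 r ^ 2) / (u r ^ 2 + u1 r ^ 2) with hT
  have cu := h.continuous
  have cu1 : Continuous fun r : ℝ => u1 (|r|) :=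
    h.radial.c1.comp_continuous continuous_abs (fun r => abs_nonneg r)
  have cT : Continuous fun r : ℝ => T (|r|) := by
    have cu2 := h.c2
    exact ((((cu.comp continuous_abs).mul (cu2.comp continuous_abs)).sub (cu1.pow 2))).div
      (((cu.comp continuous_abs).pow 2).add (cu1.pow 2)) (fun r => (hρ _ (abs_nonneg r)).ne')
  set θ : ℝ → ℝ := fun r => ∫ s in (0 : ℝ)..r, T (|s|) with hθ
  have dθ : ∀ r, 0 ≤ r → HasDerivAt θ (T r) r := fun r hr => by
    have := (cT.integral_hasStrictDerivAt 0 r).hasDerivAt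
    simp only [abs_of_nonneg hr] at this
    exact this
  have θ0 : θ 0 = 0 := by simp [hθ]
  have cθ : ContinuousOn θ (Ici 0) := fun r hr => (dθ r hr).continuousAt.continuousWithinAt
  have hB : ∀ r, 0 ≤ r → -u r * sin (θ r) + u1 r * cos (θ r) = 0 := by
    intro R hR
    have hsub : Icc 0 R ⊆ Ici (0 : ℝ) := fun x hx => hx.1
    have key : (-u R * sin (θ R) + u1 R * cos (θ R)) ^ 2 / (u R ^ 2 + u1 R ^ 2) ≤
        (-u 0 * sin (θ 0) + u1 0 * cos (θ 0)) ^ 2 / (u 0 ^ 2 + u1 0 ^ 2) := by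
      refine le_of_hasDerivAt_nonpos (g := fun r =>
        (-u r * sin (θ r) + u1 r * cos (θ r)) ^ 2 / (u r ^ 2 + u1 r ^ 2)) (g' := fun _ => 0)
        hR ?_ ?_ (fun _ _ => le_rfl)
      · have k0 := h.radial.c0.mono hsub
        have k1 := h.radial.c1.mono hsub
        have kθ := cθ.mono hsub
        exact (((k0.neg.mul (continuous_sin.comp_continuousOn kθ)).add
          (k1.mul (continuous_cos.comp_continuousOn kθ))).pow 2).div
          ((k0.pow 2).add (k1.pow 2)) (fun r hr => (hρ r hr.1).ne')
      · intro r hr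
        have k0 := h.d0 r
        have k1 := h.d1 r hr.1.le
        have kθ := dθ r hr.1.le
        have hρr := (hρ r hr.1.le).ne'
        refine ((((k0.neg.mul kθ.sin).add (k1.mul kθ.cos)).pow 2).div
          ((k0.pow 2).add (k1.pow 2)) hρr).congr_deriv ?_
        simp only [Pi.add_apply, Pi.pow_apply, Pi.neg_apply, Pi.mul_apply]
        rw [div_eq_zero_iff]
        left
        push_cast
        have hTr : T r * (u r ^ 2 + u1 r ^ 2) = u r * u2 r - u1 r ^ 2 := by
          rw [hT]; exact div_mul_cancel₀ _ hρr
        linear_combination (-2 * (-u r * sin (θ r) + u1 r * cos (θ r)) *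
          (u r * cos (θ r) + u1 r * sin (θ r))) * hTr
    rw [θ0, h.u10] at key
    simp only [sin_zero, mul_zero, zero_mul, add_zero, ne_eq, OfNat.ofNat_ne_zero,
      not_false_eq_true, zero_pow, zero_div] at key
    have k2 : (-u R * sin (θ R) + u1 R * cos (θ R)) ^ 2 ≤ 0 := by
      by_contra hcon
      have := div_pos (not_le.1 hcon) (hρ R hR)
      linarith
    exact pow_eq_zero_iff two_ne_zero |>.1 (le_antisymm k2 (sq_nonneg _))
  set A : ℝ → ℝ := fun r => u r * cos (θ r) + u1 r * sin (θ r) with hAd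
  have hu : ∀ r, 0 ≤ r → u r = A r * cos (θ r) := fun r hr => by
    simp only [hAd]
    linear_combination (-u r) * sin_sq_add_cos_sq (θ r) - sin (θ r) * hB r hr
  have hu1 : ∀ r, 0 ≤ r → u1 r = A r * sin (θ r) := fun r hr => by
    simp only [hAd]
    linear_combination (-u1 r) * sin_sq_add_cos_sq (θ r) + cos (θ r) * hB r hr
  have hA0 : ∀ r, 0 ≤ r → A r ≠ 0 := fun r hr hz => by
    have := hρ r hr
    rw [hu r hr, hu1 r hr, hz] at this
    simp at this
  have hA : ∀ r, 0 ≤ r → 0 < A r := by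
    intro r hr
    by_contra hcon
    have hsub : Icc 0 r ⊆ Ici (0 : ℝ) := fun x hx => hx.1
    have kθ := cθ.mono hsub
    obtain ⟨x, hx0, -, hx, -⟩ := exists_first_zero (g := A) hr
      (((h.radial.c0.mono hsub).mul (continuous_cos.comp_continuousOn kθ)).add
        ((h.radial.c1.mono hsub).mul (continuous_sin.comp_continuousOn kθ)))
      (by simp only [hAd, θ0, h.u0, h.u10]; simpa using hα) (not_lt.1 hcon)
    exact hA0 x hx0.le hx
  refine ⟨A, θ, hu, hu1, hA, cθ, θ0, fun r hr hz => (dθ r hr.le).congr_deriv ?_⟩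
  have := hρ r hr.le
  simp only [hT, hz] at this ⊢
  rw [zero_mul, zero_sub, zero_pow two_ne_zero, zero_add] at *
  rw [neg_div, div_self this.ne']

namespace Polar

/-- The angles at which the phase curve meets the axis `u = 0`. -/
noncomputable def level (m : ℕ) : ℝ := -(π / 2) - m * π

lemma cos_level (m : ℕ) : cos (level m) = 0 := by
  rw [level, cos_sub_nat_mul_pi, cos_neg, cos_pi_div_two, mul_zero]

lemma level_lt_iff {i j : ℕ} : level i < level j ↔ j < i := by
  rw [level, level, sub_lt_sub_iff_left, mul_lt_mul_iff_left₀ pi_pos, Nat.cast_lt]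

lemma level_neg (m : ℕ) : level m < 0 := by
  have h1 := pi_pos
  have h2 : 0 ≤ (m : ℝ) * π := by positivity
  rw [level]; linarith

variable {u u1 A θ : ℝ → ℝ}

lemma lt_of_lt (P : Polar u u1 A θ) {c : ℝ} (hc : cos c = 0) {a r : ℝ} (ha : 0 ≤ a)
    (h : θ a < c) (har : a ≤ r) : θ r < c := by
  by_contra hcon
  obtain ⟨x, hax, -, hx, hlt⟩ := exists_first_zero (g := fun x => c - θ x) har
    (continuousOn_const.sub (P.hc.mono fun x hx => ha.trans hx.1)) (by linarith) (by linarith)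
  have hx0 : 0 < x := ha.trans_lt hax
  have hux : u x = 0 := by
    rw [P.hu x hx0.le, ← sub_eq_zero.1 hx, hc, mul_zero]
  obtain ⟨δ, hδ, hl⟩ := hasDerivAt_eventually_left_pos
    ((P.hd x hx0 hux).sub_const c) (by norm_num) (by linarith)
  have hm : max a (x - δ) < x := max_lt hax (by linarith)
  obtain ⟨y, hy1, hy2⟩ := exists_between hm
  have h1 := hlt y ((le_max_left _ _).trans hy1.le) hy2
  have h2 := hl y ((le_max_right _ _).trans_lt hy1) hy2
  linarith

lemma ne_level_zero (P : Polar u u1 A θ) {c : ℝ} (hc : cos c = 0) : θ 0 ≠ c := by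
  rintro rfl
  rw [P.h0, cos_zero] at hc
  exact one_ne_zero hc

lemma after (P : Polar u u1 A θ) {c : ℝ} (hc : cos c = 0) {a r : ℝ} (ha : 0 ≤ a)
    (h : θ a = c) (har : a < r) : θ r < c := by
  rcases ha.eq_or_lt with rfl | ha0
  · exact absurd h (P.ne_level_zero hc)
  have hua : u a = 0 := by rw [P.hu a ha, h, hc, mul_zero]
  obtain ⟨δ, hδ, hl⟩ := hasDerivAt_eventually_right_neg
    ((P.hd a ha0 hua).sub_const c) (by norm_num) (by linarith)
  have hm : a < min r (a + δ) := lt_min har (by linarith)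
  obtain ⟨y, hy1, hy2⟩ := exists_between hm
  have h2 := hl y hy1 (hy2.trans_le (min_le_right _ _))
  exact P.lt_of_lt hc (ha.trans hy1.le) (by linarith) (hy2.le.trans (min_le_left _ _))

lemma before (P : Polar u u1 A θ) {c : ℝ} (hc : cos c = 0) {a r : ℝ} (hr : 0 ≤ r)
    (h : θ a = c) (hra : r < a) : c < θ r := by
  rcases lt_trichotomy (θ r) c with hl | hl | hl
  · exact absurd h (P.lt_of_lt hc hr hl hra.le).ne
  · exact absurd h (P.after hc hr hl hra).ne
  · exact hl

lemma lt_pi_div_two (P : Polar u u1 A θ) {r : ℝ} (hr : 0 ≤ r) : θ r < π / 2 :=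
  P.lt_of_lt cos_pi_div_two le_rfl (by rw [P.h0]; positivity) hr

lemma zero_iff (P : Polar u u1 A θ) {r : ℝ} (hr : 0 ≤ r) : u r = 0 ↔ ∃ m : ℕ, θ r = level m := by
  constructor
  · intro h
    rw [P.hu r hr, mul_eq_zero, or_iff_right (P.hA r hr).ne', cos_eq_zero_iff] at h
    obtain ⟨k, hk⟩ := h
    have h1 := P.lt_pi_div_two hr
    rw [hk] at h1
    have h2 : (k : ℝ) < 0 := by
      by_contra hcon
      have := mul_nonneg (not_lt.1 hcon) pi_pos.le
      linarith
    have h3 : k < 0 := by exact_mod_cast h2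
    obtain ⟨m, hm⟩ := Int.eq_ofNat_of_zero_le (by omega : 0 ≤ -1 - k)
    refine ⟨m, ?_⟩
    have h4 : (k : ℝ) = -1 - m := by
      have : k = -1 - (m : ℤ) := by omega
      rw [this]; push_cast; ring
    rw [hk, h4, level]; ring
  · rintro ⟨m, hm⟩
    rw [P.hu r hr, hm, cos_level, mul_zero]

lemma exists_eq (P : Polar u u1 A θ) {R c : ℝ} (hR : 0 ≤ R) (hc0 : c < 0) (hcR : θ R < c) :
    ∃ r, 0 < r ∧ r < R ∧ θ r = c := by
  obtain ⟨r, hr0, hrR, hr, -⟩ := exists_first_zero (g := fun x => θ x - c) hR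
    ((P.hc.mono fun x hx => hx.1).sub continuousOn_const)
    (by rw [P.h0]; linarith) (by linarith)
  refine ⟨r, hr0, lt_of_le_of_ne hrR ?_, by linarith⟩
  rintro rfl
  linarith

theorem exact_zeros (P : Polar u u1 A θ) {R : ℝ} (hR : 0 ≤ R) {k : ℕ} (hk : θ R = level k) :
    ∃ z : Fin k → ℝ, StrictMono z ∧ (∀ i, 0 < z i ∧ z i < R ∧ u (z i) = 0) ∧
      ∀ r, 0 < r → r < R → u r = 0 → ∃ i, r = z i := by
  have hex : ∀ i : Fin k, ∃ r, 0 < r ∧ r < R ∧ θ r = level i := fun i =>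
    P.exists_eq hR (level_neg i) (by rw [hk]; exact level_lt_iff.2 i.2)
  choose z hz0 hzR hz using hex
  refine ⟨z, fun i j hij => ?_, fun i => ⟨hz0 i, hzR i, (P.zero_iff (hz0 i).le).2 ⟨i, hz i⟩⟩, ?_⟩
  · have h1 : level j < level i := level_lt_iff.2 hij
    rcases lt_trichotomy (z i) (z j) with hl | hl | hl
    · exact hl
    · have := hz i
      rw [hl, hz j] at this
      linarith
    · have := P.after (cos_level j) (hz0 j).le (hz j) hl
      rw [hz i] at this
      linarith
  · intro r hr0 hrR hur
    obtain ⟨m, hm⟩ := (P.zero_iff hr0.le).1 hur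
    have h1 := P.before (cos_level k) hr0.le hk hrR
    rw [hm, level_lt_iff] at h1
    refine ⟨⟨m, h1⟩, ?_⟩
    rcases lt_trichotomy r (z ⟨m, h1⟩) with hl | hl | hl
    · have := P.after (cos_level m) hr0.le hm hl
      exact absurd (hz ⟨m, h1⟩) this.ne
    · exact hl
    · have := P.after (cos_level m) (hz0 _).le (hz ⟨m, h1⟩) hl
      exact absurd hm this.ne

theorem level_of_exact_zeros (P : Polar u u1 A θ) {R : ℝ} (hR : 0 ≤ R) (hu : u R = 0) {k : ℕ}
    {z : Fin k → ℝ} (hz : StrictMono z) (hz1 : ∀ i, 0 < z i ∧ z i < R ∧ u (z i) = 0)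
    (hz2 : ∀ r, 0 < r → r < R → u r = 0 → ∃ i, r = z i) : θ R = level k := by
  obtain ⟨m, hm⟩ := (P.zero_iff hR).1 hu
  obtain ⟨w, hw, hw1, hw2⟩ := P.exact_zeros hR hm
  have h : range z = range w := by
    ext r
    constructor
    · rintro ⟨i, rfl⟩
      obtain ⟨j, hj⟩ := hw2 _ (hz1 i).1 (hz1 i).2.1 (hz1 i).2.2
      exact ⟨j, hj.symm⟩
    · rintro ⟨i, rfl⟩
      obtain ⟨j, hj⟩ := hz2 _ (hw1 i).1 (hw1 i).2.1 (hw1 i).2.2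
      exact ⟨j, hj.symm⟩
  have h2 := congrArg Nat.card (congrArg (fun s : Set ℝ => ↥s) h)
  rw [Nat.card_range_of_injective hz.injective, Nat.card_range_of_injective hw.injective,
    Nat.card_fin, Nat.card_fin] at h2
  rw [h2, hm]

lemma dot {v v1 B φ : ℝ → ℝ} (P : Polar u u1 A θ) (Q : Polar v v1 B φ) {r : ℝ} (hr : 0 ≤ r) :
    u r * v r + u1 r * v1 r = A r * B r * cos (θ r - φ r) := by
  rw [P.hu r hr, P.hu1 r hr, Q.hu r hr, Q.hu1 r hr, cos_sub]; ring

lemma cross {v v1 B φ : ℝ → ℝ} (P : Polar u u1 A θ) (Q : Polar v v1 B φ) {r : ℝ} (hr : 0 ≤ r) :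
    v r * u1 r - u r * v1 r = A r * B r * sin (θ r - φ r) := by
  rw [P.hu r hr, P.hu1 r hr, Q.hu r hr, Q.hu1 r hr, sin_sub]; ring

lemma stable {v v1 B φ : ℝ → ℝ} (P : Polar u u1 A θ) (Q : Polar v v1 B φ) {R : ℝ} (hR : 0 ≤ R)
    (h : ∀ r, 0 ≤ r → r ≤ R → 0 < u r * v r + u1 r * v1 r) : |θ R - φ R| < π / 2 := by
  by_contra hcon
  have hsub : Icc 0 R ⊆ Ici (0 : ℝ) := fun x hx => hx.1
  obtain ⟨r, hr0, hrR, hr, -⟩ := exists_first_zero (g := fun x => π / 2 - |θ x - φ x|) hR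
    (continuousOn_const.sub ((P.hc.mono hsub).sub (Q.hc.mono hsub)).abs)
    (by simp only [P.h0, Q.h0]; simp [pi_pos]) (by linarith)
  have h1 := h r hr0.le hrR
  rw [P.dot Q hr0.le, ← cos_abs, ← sub_eq_zero.1 hr, cos_pi_div_two, mul_zero] at h1
  exact lt_irrefl _ h1

end Polar

end polar

section angle

/-- A bounded solution of the `ε`-problem together with its polar representation. -/
structure Sol (n : ℕ) (p ε α : ℝ) (u u1 A θ : ℝ → ℝ) : Prop where
  rad : Radial n (fun r => fe p ε (u r)) u u1
  cont : Continuous u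
  u0 : u 0 = α
  u10 : u1 0 = 0
  bd : ∀ r, 0 ≤ r → |u r| ≤ α
  pol : Polar u u1 A θ

variable {n : ℕ} {p : ℝ}

theorem exists_sol_aux (hn : 1 ≤ n) (hp : 1 < p) {ε α : ℝ} (hε0 : 0 ≤ ε) (hε1 : ε ≤ 1)
    (hα : 1 ≤ α) : ∃ u u1 u2 A θ, IVP n (fun r => fe p ε (u r)) α u u1 u2 ∧
      Sol n p ε α u u1 A θ := by
  obtain ⟨u, u1, u2, h, hb⟩ := exists_IVP (p := p) hn hp hε0 hε1 hα
  have hα0 : 0 ≤ α := by linarith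
  obtain ⟨A, θ, hP⟩ := h.exists_polar (by linarith) (fun r hr =>
    h.radial.rho_pos hn (L := 1 + p * α ^ (p - 1))
      (by have := rpow_nonneg hα0 (p - 1); positivity)
      (fun x hx => by
        have := abs_fe_sub_le (t := 0) hp hε0 hε1 (hb x hx.le) (by simpa using hα0)
        simpa [fe_zero_right] using this)
      (by rw [h.u0]; linarith) hr)
  exact ⟨u, u1, u2, A, θ, h, h.radial, h.continuous, h.u0, h.u10, hb, hP⟩

theorem exists_sol (hn : 1 ≤ n) (hp : 1 < p) {ε α : ℝ} (hε0 : 0 ≤ ε) (hε1 : ε ≤ 1)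
    (hα : 1 ≤ α) : ∃ u u1 A θ, Sol n p ε α u u1 A θ := by
  obtain ⟨u, u1, u2, A, θ, -, h⟩ := exists_sol_aux hn hp hε0 hε1 hα
  exact ⟨u, u1, A, θ, h⟩

lemma Polar.rho {u u1 A θ : ℝ → ℝ} (P : Polar u u1 A θ) {r : ℝ} (hr : 0 ≤ r) :
    u r ^ 2 + u1 r ^ 2 = A r ^ 2 := by
  rw [P.hu r hr, P.hu1 r hr]
  linear_combination (A r ^ 2) * sin_sq_add_cos_sq (θ r)

set_option maxHeartbeats 1000000 in
/-- The polar angle depends continuously on the initial value and on `ε`. -/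
theorem Sol.angle_close (hn : 1 ≤ n) (hp : 1 < p) {ε α : ℝ} (hε0 : 0 ≤ ε) (hε1 : ε ≤ 1)
    {u u1 A θ : ℝ → ℝ} (S : Sol n p ε α u u1 A θ) {R : ℝ} (hR : 0 ≤ R) {η : ℝ} (hη : 0 < η) :
    ∃ ρ > 0, ∀ ε' β v v1 B φ, Sol n p ε' β v v1 B φ → |β - α| < ρ → |ε' - ε| < ρ →
      |θ R - φ R| < min η (π / 2) := by
  have hsub : Icc 0 R ⊆ Ici (0 : ℝ) := fun x hx => hx.1
  have hα : 0 ≤ α := (abs_nonneg _).trans (S.bd 0 le_rfl)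
  have P := S.pol
  obtain ⟨x0, hx0, hmin⟩ := isCompact_Icc.exists_isMinOn (nonempty_Icc.2 hR)
    (((S.rad.c0.mono hsub).pow 2).add ((S.rad.c1.mono hsub).pow 2))
  set m := u x0 ^ 2 + u1 x0 ^ 2 with hm
  have hmin' : ∀ r, 0 ≤ r → r ≤ R → m ≤ u r ^ 2 + u1 r ^ 2 := fun r h h' => hmin ⟨h, h'⟩
  have hm0 : 0 < m := by
    rw [hm, P.rho hx0.1]
    exact pow_pos (P.hA x0 hx0.1) 2
  set η' := min η 1 with hη'
  have hη0 : 0 < η' := lt_min hη one_pos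
  have hη1 : η' ≤ 1 := min_le_right _ _
  have hπ : (1 : ℝ) < π / 2 := by linarith [pi_gt_three]
  have hs : 0 < sin η' := sin_pos_of_pos_of_lt_pi hη0 (by linarith)
  set q := m * sin η' ^ 2 with hq
  have hq0 : 0 < q := by positivity
  have hqm : q ≤ m := mul_le_of_le_one_right hm0.le (sin_sq_le_one _)
  set a := α + 1 with ha
  set K := exp ((1 + p * a ^ (p - 1) + 2) * R) with hK
  have ha0 : 0 ≤ a ^ (p - 1) := rpow_nonneg (by linarith) _
  have hpa : 0 ≤ p * a ^ (p - 1) := mul_nonneg (by linarith) ha0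
  have hK0 : 0 < K := exp_pos _
  refine ⟨min 1 (q / (2 * (K * (1 + a ^ 2)))), by positivity, ?_⟩
  intro ε' β v v1 B φ T hβ hε
  have Q := T.pol
  have hβ1 : |β - α| < 1 := hβ.trans_le (min_le_left _ _)
  have hD : ∀ r, 0 ≤ r → r ≤ R → (u r - v r) ^ 2 + (u1 r - v1 r) ^ 2 < q := by
    intro r hr hrR
    have h1 := radial_dist_le hn hp hε0 hε1 S.rad T.rad (A := a) (R := R)
      (fun r h _ => (S.bd r h).trans (by linarith))
      (fun r h _ => (T.bd r h).trans (by have := (abs_lt.1 hβ1).2; linarith)) hr hrR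
    rw [S.u0, T.u0, S.u10, T.u10] at h1
    set ρ := min 1 (q / (2 * (K * (1 + a ^ 2)))) with hρ
    have hρ0 : 0 < ρ := by positivity
    have hρ1 : ρ ≤ 1 := min_le_left _ _
    have hρ2 : ρ ≤ q / (2 * (K * (1 + a ^ 2))) := min_le_right _ _
    have e1 : (α - β) ^ 2 ≤ ρ := by
      have : (α - β) ^ 2 = |β - α| * |β - α| := by rw [← sq, sq_abs]; ring
      rw [this]
      nlinarith [abs_nonneg (β - α)]
    have e2 : (|ε' - ε| * a) ^ 2 ≤ ρ * a ^ 2 := by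
      rw [mul_pow]
      apply mul_le_mul_of_nonneg_right _ (sq_nonneg a)
      nlinarith [abs_nonneg (ε' - ε)]
    have e3 : exp ((1 + p * a ^ (p - 1) + 2) * r) ≤ K :=
      exp_le_exp.2 (mul_le_mul_of_nonneg_left hrR (by linarith))
    rw [le_div_iff₀ (by positivity)] at hρ2
    calc _ ≤ _ := h1
      _ ≤ K * (ρ + 0 ^ 2 + ρ * a ^ 2) := by
        apply mul_le_mul e3 _ (by positivity) hK0.le
        simp only [sub_self]
        linarith
      _ ≤ q / 2 := by nlinarith
      _ < q := by linarith
  have hst := P.stable Q hR (fun r hr hrR => by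
    have h1 := hD r hr hrR
    have h2 := hmin' r hr hrR
    nlinarith [sq_nonneg (v r), sq_nonneg (v1 r)])
  refine lt_min ?_ hst
  by_contra hcon
  have hψ : η' ≤ |θ R - φ R| := (min_le_left _ _).trans (not_lt.1 hcon)
  have h1 : sin η' ≤ sin |θ R - φ R| := sin_le_sin_of_le_of_le_pi_div_two (by linarith) hst.le hψ
  have h2 : sin η' ^ 2 ≤ sin (θ R - φ R) ^ 2 := by
    have : sin |θ R - φ R| ^ 2 = sin (θ R - φ R) ^ 2 := by
      rcases abs_choice (θ R - φ R) with h | h <;> rw [h]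
      rw [sin_neg, neg_sq]
    rw [← this]
    exact pow_le_pow_left₀ hs.le h1 2
  have h3 := hD R hR le_rfl
  have h4 := P.dot Q hR
  have h5 := P.rho hR
  have h6 := Q.rho hR
  have h7 := hmin' R hR le_rfl
  have h8 : (u R - v R) ^ 2 + (u1 R - v1 R) ^ 2 =
      (B R - A R * cos (θ R - φ R)) ^ 2 + A R ^ 2 * sin (θ R - φ R) ^ 2 := by
    linear_combination h5 + h6 - 2 * h4 - (A R) ^ 2 * sin_sq_add_cos_sq (θ R - φ R)
  have h9 : q ≤ A R ^ 2 * sin (θ R - φ R) ^ 2 := by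
    rw [← h5]
    exact mul_le_mul h7 h2 (sq_nonneg _) (by positivity)
  nlinarith [sq_nonneg (B R - A R * cos (θ R - φ R))]

theorem Sol.angle_eq (hn : 1 ≤ n) (hp : 1 < p) {ε α : ℝ} (hε0 : 0 ≤ ε) (hε1 : ε ≤ 1)
    {u u1 A θ v v1 B φ : ℝ → ℝ} (S : Sol n p ε α u u1 A θ) (T : Sol n p ε α v v1 B φ)
    {R : ℝ} (hR : 0 ≤ R) : θ R = φ R := by
  by_contra hne
  have hpos : 0 < |θ R - φ R| := abs_pos.2 (sub_ne_zero.2 hne)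
  obtain ⟨ρ, hρ, h⟩ := S.angle_close hn hp hε0 hε1 hR hpos
  exact absurd ((h ε α v v1 B φ T (by simpa using hρ) (by simpa using hρ)).trans_le
    (min_le_left _ _)) (lt_irrefl _)

/-- The angle `θ_α(R)` crosses each level `-(π/2) - kπ` strictly downward as `α` increases. -/
theorem Sol.transversal (hn : 3 ≤ n) (hp : 1 < p)
    (hsub : 0 < (n : ℝ) / (p + 1) - ((n : ℝ) - 2) / 2) {α : ℝ} (hα : 1 ≤ α)
    {u u1 A θ : ℝ → ℝ} (S : Sol n p 1 α u u1 A θ) {R : ℝ} (hR : 0 < R) {k : ℕ}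
    (hk : θ R = Polar.level k) :
    ∃ ρ > 0, ∀ β v v1 B φ, Sol n p 1 β v v1 B φ → |β - α| < ρ →
      (α < β → φ R < Polar.level k) ∧ (β < α → Polar.level k < φ R) := by
  have hn1 : 1 ≤ n := by omega
  have hradf : ∀ {β v v1 B φ}, Sol n p 1 β v v1 B φ → Radial n (fun r => f p (v r)) v v1 :=
    fun T => by simpa only [fe_one] using T.rad
  obtain ⟨V, V1, V2, hV⟩ := exists_linear (n := n) hn1 (q := fun r => fder p (u r))
    ((continuous_fder hp).comp S.cont) (L := 1 + p * α ^ (p - 1)) (fun r hr => by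
      simpa using abs_fder_add_le (ε := 1) hp zero_le_one le_rfl (S.bd r hr))
  have hShot : Shot n p u u1 V V1 :=
    ⟨hn, hp, hradf S, hV.radial, by rw [S.u0, hV.u0]; linarith, S.u10, hV.u10, hsub⟩
  have huR : u R = 0 := (S.pol.zero_iff hR.le).2 ⟨k, hk⟩
  have hgood : 0 < V R * u1 R := (hShot.goodZero hR huR).1
  have hVR : V R ≠ 0 := fun h => by simp [h] at hgood
  obtain ⟨ρ1, hρ1, h1⟩ := variation_approx hn1 hp hα hR.le (hradf S) S.bd S.u0 S.u10 hV.radial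
    hV.u0 hV.u10 (c := |V R| / 2) (by positivity)
  obtain ⟨ρ2, hρ2, h2⟩ := S.angle_close hn1 hp zero_le_one le_rfl hR.le one_pos
  refine ⟨min ρ1 ρ2, lt_min hρ1 hρ2, fun β v v1 B φ T hβ => ?_⟩
  have k1 := h1 β v v1 (hβ.trans_le (min_le_left _ _)) (hradf T) T.bd T.u0 T.u10
  have k2 := (h2 1 β v v1 B φ T (hβ.trans_le (min_le_right _ _)) (by simpa using hρ2)).trans_le
    (min_le_right _ _)
  have k3 := S.pol.cross T.pol hR.le
  rw [huR, zero_mul, sub_zero] at k3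
  rw [huR, sub_zero] at k1
  have hAB : 0 < A R * B R := mul_pos (S.pol.hA R hR.le) (T.pol.hA R hR.le)
  rw [← hk]
  have main : β ≠ α → 0 < (β - α) * sin (θ R - φ R) := by
    intro hne
    have hd : 0 < |β - α| := abs_pos.2 (sub_ne_zero.2 hne)
    have hx : 0 < ((β - α) * V R) * v R := by
      set x := (β - α) * V R with hx
      have hxa : |V R| / 2 * |β - α| < |x| := by
        rw [hx, abs_mul]
        nlinarith [mul_pos (abs_pos.2 hVR) hd]
      have hlt := lt_of_le_of_lt k1 hxa
      rcases lt_or_ge 0 x with hx0 | hx0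
      · rw [abs_of_pos hx0, abs_lt] at hlt
        exact mul_pos hx0 (by linarith)
      · rw [abs_of_nonpos hx0, abs_lt] at hlt
        exact mul_pos_of_neg_of_neg (by linarith) (by linarith)
    have e : ((β - α) * V R * v R) * (V R * u1 R) =
        V R ^ 2 * (A R * B R) * ((β - α) * sin (θ R - φ R)) := by
      linear_combination ((β - α) * V R ^ 2) * k3
    have h3 := mul_pos hx hgood
    rw [e] at h3
    exact pos_of_mul_pos_right h3 (by positivity)
  rw [abs_lt] at k2
  have hsl : ∀ x, 0 < sin x → -(π / 2) < x → 0 < x := fun x h h' => by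
    by_contra hcon
    have := sin_nonpos_of_nonpos_of_neg_pi_le (not_lt.1 hcon) (by linarith [pi_pos])
    linarith
  constructor
  · intro h
    have := pos_of_mul_pos_right (main h.ne') (by linarith)
    have := hsl _ this k2.1
    linarith
  · intro h
    have h4 := main h.ne
    have h5 : 0 < (α - β) * sin (φ R - θ R) := by
      have : sin (φ R - θ R) = -sin (θ R - φ R) := by rw [← sin_neg]; ring_nf
      rw [this]; linarith
    have := pos_of_mul_pos_right h5 (by linarith)
    have := hsl _ this (by linarith)
    linarith

lemma one_lt_of_zero (hn : 1 ≤ n) (hp : 1 < p) {α : ℝ} (hα : 0 < α) {u u1 : ℝ → ℝ}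
    (hU : Radial n (fun r => fe p 1 (u r)) u u1) (h0 : u 0 = α) (h10 : u1 0 = 0) {R : ℝ}
    (hR : 0 ≤ R) (huR : u R = 0) : 1 < α := by
  by_contra hcon
  have h1 := energyE_le hn hp hU hR (fun _ _ _ => rfl)
  rw [energyE, energyE, h0, h10, huR, F_zero hp, F_eq hp] at h1
  have h2 : |α| ^ (p - 1) ≤ 1 := by
    rw [abs_of_pos hα]
    exact rpow_le_one hα.le (not_lt.1 hcon) (by linarith)
  have h3 : |α| ^ (p - 1) / (p + 1) < 1 / 2 := by
    rw [div_lt_div_iff₀ (by linarith) (by norm_num)]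
    linarith
  have h4 : α ^ 2 * |α| ^ (p - 1) / (p + 1) = α ^ 2 * (|α| ^ (p - 1) / (p + 1)) := by ring
  rw [h4] at h1
  nlinarith [mul_lt_mul_of_pos_left h3 (pow_pos hα 2), sq_nonneg (u1 R)]

/-- The angle at `R` is a well-defined continuous function of the initial value. -/
theorem exists_angle (hn : 1 ≤ n) (hp : 1 < p) {R : ℝ} (hR : 0 ≤ R) :
    ∃ Θ : ℝ → ℝ, ContinuousOn Θ (Ici 1) ∧
      ∀ α u u1 A θ, 1 ≤ α → Sol n p 1 α u u1 A θ → θ R = Θ α := by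
  have hex : ∀ α : ℝ, ∃ t : ℝ, 1 ≤ α → ∃ u u1 A θ, Sol n p 1 α u u1 A θ ∧ θ R = t := by
    intro α
    by_cases hα : 1 ≤ α
    · obtain ⟨u, u1, A, θ, h⟩ := exists_sol hn hp zero_le_one le_rfl hα
      exact ⟨θ R, fun _ => ⟨u, u1, A, θ, h, rfl⟩⟩
    · exact ⟨0, fun h => absurd h hα⟩
  choose Θ hΘ using hex
  refine ⟨Θ, ?_, fun α u u1 A θ hα S => ?_⟩
  · rw [Metric.continuousOn_iff]
    intro α hα η hη
    obtain ⟨u, u1, A, θ, S, hS⟩ := hΘ α hα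
    obtain ⟨ρ, hρ, h⟩ := S.angle_close hn hp zero_le_one le_rfl hR hη
    refine ⟨ρ, hρ, fun β hβ hd => ?_⟩
    obtain ⟨v, v1, B, φ, T, hT⟩ := hΘ β hβ
    have := h 1 β v v1 B φ T hd (by simpa using hρ)
    rw [dist_comm, Real.dist_eq, ← hS, ← hT]
    exact this.trans_le (min_le_left _ _)
  · obtain ⟨v, v1, B, φ, T, hT⟩ := hΘ α hα
    rw [← hT]
    exact S.angle_eq hn hp zero_le_one le_rfl T hR

theorem angle_unique (hn : 3 ≤ n) (hp : 1 < p)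
    (hsub : 0 < (n : ℝ) / (p + 1) - ((n : ℝ) - 2) / 2) {R : ℝ} (hR : 0 < R) {k : ℕ} {Θ : ℝ → ℝ}
    (hc : ContinuousOn Θ (Ici 1))
    (hΘ : ∀ α u u1 A θ, 1 ≤ α → Sol n p 1 α u u1 A θ → θ R = Θ α) {α β : ℝ} (hα : 1 ≤ α)
    (hαβ : α < β) (h1 : Θ α = Polar.level k) (h2 : Θ β = Polar.level k) : False := by
  have hn1 : 1 ≤ n := by omega
  have tr : ∀ γ, 1 ≤ γ → Θ γ = Polar.level k → ∃ ρ > 0, ∀ δ, 1 ≤ δ → |δ - γ| < ρ →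
      (γ < δ → Θ δ < Polar.level k) ∧ (δ < γ → Polar.level k < Θ δ) := by
    intro γ hγ h
    obtain ⟨u, u1, A, θ, S⟩ := exists_sol (p := p) hn1 hp zero_le_one le_rfl hγ
    obtain ⟨ρ, hρ, ht⟩ := S.transversal hn hp hsub hγ hR ((hΘ γ _ _ _ _ hγ S).trans h)
    refine ⟨ρ, hρ, fun δ hδ hd => ?_⟩
    obtain ⟨v, v1, B, φ, T⟩ := exists_sol (p := p) hn1 hp zero_le_one le_rfl hδ
    rw [← hΘ δ _ _ _ _ hδ T]
    exact ht δ v v1 B φ T hd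
  obtain ⟨ρ, hρ, ht⟩ := tr α hα h1
  obtain ⟨a, ha1, ha2⟩ := exists_between (lt_min hαβ (by linarith : α < α + ρ))
  have haβ : a < β := ha2.trans_le (min_le_left _ _)
  have ha3 : a < α + ρ := ha2.trans_le (min_le_right _ _)
  have hΘa := (ht a (by linarith) (by rw [abs_lt]; constructor <;> linarith)).1 ha1
  obtain ⟨b, hab, hbβ, hb, hlt⟩ := exists_first_zero (g := fun x => Polar.level k - Θ x) haβ.le
    (continuousOn_const.sub (hc.mono fun x hx => by
      have := hx.1
      simp only [mem_Ici]; linarith)) (by linarith) (by linarith)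
  obtain ⟨ρ', hρ', ht'⟩ := tr b (by linarith) (by linarith)
  obtain ⟨c, hc1, hc2⟩ := exists_between (max_lt hab (by linarith : b - ρ' < b))
  have hca : a < c := (le_max_left _ _).trans_lt hc1
  have hcb : b - ρ' < c := (le_max_right _ _).trans_lt hc1
  have := (ht' c (by linarith) (by rw [abs_lt]; constructor <;> linarith)).2 hc2
  have := hlt c hca.le hc2
  linarith

lemma level_lt_angle_one (hn : 1 ≤ n) (hp : 1 < p) {u u1 A θ : ℝ → ℝ}
    (S : Sol n p 1 1 u u1 A θ) {R : ℝ} (hR : 0 ≤ R) (k : ℕ) : Polar.level k < θ R := by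
  by_contra hcon
  have hz : ∃ r, 0 ≤ r ∧ θ r = Polar.level k := by
    rcases (not_lt.1 hcon).eq_or_lt with h | h
    · exact ⟨R, hR, h⟩
    · obtain ⟨r, hr0, -, hr⟩ := S.pol.exists_eq hR (Polar.level_neg k) h
      exact ⟨r, hr0.le, hr⟩
  obtain ⟨r, hr0, hr⟩ := hz
  exact lt_irrefl _ (one_lt_of_zero hn hp one_pos S.rad S.u0 S.u10 hr0
    ((S.pol.zero_iff hr0).2 ⟨k, hr⟩))

end angle

section oscillation

variable {n : ℕ} {p : ℝ}

/-- The Pohozaev functional of the equation `Δw + |w|^(p-1) w = 0`. -/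
noncomputable def pohozaevZero (n : ℕ) (p : ℝ) (W W1 : ℝ → ℝ) (r : ℝ) : ℝ :=
  r ^ n * (W1 r ^ 2 / 2 + |W r| ^ (p + 1) / (p + 1)) +
    ((n : ℝ) - 2) / 2 * (r ^ (n - 1) * (W r * W1 r))

lemma hasDerivAt_pohozaevZero (hn : 1 ≤ n) (hp : 1 < p) {W W1 : ℝ → ℝ}
    (hW : Radial n (fun r => fe p 0 (W r)) W W1) {r : ℝ} (hr : 0 < r) :
    HasDerivAt (pohozaevZero n p W W1)
      (((n : ℝ) / (p + 1) - ((n : ℝ) - 2) / 2) * (r ^ (n - 1) * |W r| ^ (p + 1))) r := by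
  have k0 := hW.d0 r hr
  have k1 := hW.d1 r hr
  have k2 := (hasDerivAt_abs_rpow_add_one hp (W r)).comp r k0
  have k3 := hasDerivAt_pow_pred hn hr
  have hp1 : p + 1 ≠ 0 := by linarith
  obtain ⟨m, rfl⟩ : ∃ m, n = m + 1 := ⟨n - 1, by omega⟩
  refine (((hasDerivAt_pow (m + 1) r).mul (((k1.pow 2).div_const 2).add k2)).add
    ((k3.mul (k0.mul k1)).const_mul ((((m + 1 : ℕ) : ℝ) - 2) / 2))).congr_deriv ?_
  simp only [Pi.add_apply, Pi.pow_apply, Pi.mul_apply, Function.comp, fe_eq, abs_rpow_add_one hp]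
  push_cast
  field_simp
  ring

lemma continuousOn_pohozaevZero (hp : 1 < p) {W W1 : ℝ → ℝ}
    (hW : Radial n (fun r => fe p 0 (W r)) W W1) :
    ContinuousOn (pohozaevZero n p W W1) (Ici 0) := by
  have k0 := hW.c0
  have k1 := hW.c1
  have k2 : ContinuousOn (fun r => |W r| ^ (p + 1)) (Ici 0) :=
    k0.abs.rpow_const fun _ _ => Or.inr (by linarith)
  unfold pohozaevZero
  fun_prop

/-- In the subcritical range, radial solutions of `Δw + |w|^(p-1) w = 0` are not eventually
positive. -/
theorem not_eventually_pos (hn : 3 ≤ n) (hp : 1 < p)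
    (hsub : 0 < (n : ℝ) / (p + 1) - ((n : ℝ) - 2) / 2) {W W1 : ℝ → ℝ}
    (hW : Radial n (fun r => fe p 0 (W r)) W W1) {M : ℝ} (hM : 0 < M)
    (hpos : ∀ r, M ≤ r → 0 < W r) : False := by
  have hn1 : 1 ≤ n := by omega
  have hn' : (3 : ℝ) ≤ n := by exact_mod_cast hn
  have hfe : ∀ r, M ≤ r → fe p 0 (W r) = W r ^ (p - 1) * W r := fun r hr => by
    rw [fe_eq, sub_zero, abs_of_pos (hpos r hr)]
  have hfpos : ∀ r, M ≤ r → 0 < fe p 0 (W r) := fun r hr => by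
    rw [hfe r hr]; exact mul_pos (rpow_pos_of_pos (hpos r hr) _) (hpos r hr)
  have dJ : ∀ r, 0 < r → HasDerivAt (fun x => x ^ (n - 1) * W1 x)
      (-(r ^ (n - 1) * fe p 0 (W r))) r := fun r hr => by
    refine ((hasDerivAt_pow_pred hn1 hr).mul (hW.d1 r hr)).congr_deriv ?_
    ring
  have cJ : ContinuousOn (fun x => x ^ (n - 1) * W1 x) (Ici 0) :=
    (Continuous.continuousOn (by fun_prop)).mul hW.c1
  have mfe : ∀ s t : ℝ, 0 ≤ s → s ≤ t → fe p 0 s ≤ fe p 0 t := fun s t hs hst => by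
    rw [fe_eq, fe_eq, abs_of_nonneg hs, abs_of_nonneg (hs.trans hst), sub_zero, sub_zero]
    exact mul_le_mul (rpow_le_rpow hs hst (by linarith)) hst hs (rpow_nonneg (hs.trans hst) _)
  -- the derivative becomes negative
  obtain ⟨M1, hM1, hneg1⟩ : ∃ M1, M ≤ M1 ∧ W1 M1 < 0 := by
    by_contra! hcon
    have hc := hfpos M le_rfl
    have hlow : ∀ r, M ≤ r → fe p 0 (W M) ≤ fe p 0 (W r) := fun r hr =>
      mfe _ _ (hpos M le_rfl).le (le_of_hasDerivAt_nonneg (g := W) hr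
        (hW.c0.mono fun x hx => hM.le.trans hx.1)
        (fun x hx => hW.d0 x (hM.trans hx.1)) (fun x hx => hcon x hx.1.le))
    set C := M ^ (n - 1) * fe p 0 (W M) with hC
    have hC0 : 0 < C := by positivity
    have hdec : ∀ r, M ≤ r → r ^ (n - 1) * W1 r + C * r ≤ M ^ (n - 1) * W1 M + C * M := fun r hr =>
      le_of_hasDerivAt_nonpos (g := fun x => x ^ (n - 1) * W1 x + C * x) hr
        ((cJ.mono fun x hx => hM.le.trans hx.1).add (Continuous.continuousOn (by fun_prop)))
        (fun x hx => (dJ x (hM.trans hx.1)).add ((hasDerivAt_id' x).const_mul C))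
        (fun x hx => by
          have e1 : M ^ (n - 1) ≤ x ^ (n - 1) := pow_le_pow_left₀ hM.le hx.1.le _
          have e2 : C ≤ x ^ (n - 1) * fe p 0 (W x) :=
            mul_le_mul e1 (hlow x hx.1.le) hc.le (by have := hM.trans hx.1; positivity)
          linarith)
    have hJM : 0 ≤ M ^ (n - 1) * W1 M := mul_nonneg (by positivity) (hcon M le_rfl)
    have hr : M ≤ M + M ^ (n - 1) * W1 M / C + 1 := by
      have := div_nonneg hJM hC0.le
      linarith
    have h1 := hdec _ hr
    have h2 := mul_nonneg (pow_nonneg (hM.le.trans hr) (n - 1)) (hcon _ hr)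
    have h3 : C * (M + M ^ (n - 1) * W1 M / C + 1) = C * M + M ^ (n - 1) * W1 M + C := by
      field_simp
    linarith
  have hM10 : 0 < M1 := hM.trans_le hM1
  have hneg : ∀ r, M1 ≤ r → W1 r < 0 := fun r hr => by
    have h1 := le_of_hasDerivAt_nonpos (g := fun x => x ^ (n - 1) * W1 x) hr
      (cJ.mono fun x hx => hM10.le.trans hx.1) (fun x hx => dJ x (hM10.trans hx.1))
      (fun x hx => by
        have := mul_pos (pow_pos (hM10.trans hx.1) (n - 1)) (hfpos x (hM1.trans hx.1.le))
        linarith)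
    have h2 : M1 ^ (n - 1) * W1 M1 < 0 := mul_neg_of_pos_of_neg (by positivity) hneg1
    exact neg_of_mul_neg_right (lt_of_le_of_lt h1 h2) (pow_nonneg (hM10.le.trans hr) _)
  have hslope : ∀ r, 2 * M1 ≤ r → W1 r ≤ -(W r ^ (p - 1) * W r * r / (2 * n)) := fun r hr => by
    have hr1 : M1 ≤ r := by linarith
    have hr0 : 0 < r := by linarith
    have h1 := le_of_hasDerivAt_nonpos
      (g := fun x => x ^ (n - 1) * W1 x + fe p 0 (W x) * ((x ^ n - M1 ^ n) / n))
      (g' := fun x => (fder p (W x) + (1 - 0)) * W1 x * ((x ^ n - M1 ^ n) / n)) hr1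
      ((cJ.mono fun x hx => hM10.le.trans hx.1).add
        (((continuous_fe hp).comp_continuousOn (hW.c0.mono fun x hx => hM10.le.trans hx.1)).mul
          (Continuous.continuousOn (by fun_prop))))
      (fun x hx => by
        have hx0 := hM10.trans hx.1
        refine ((dJ x hx0).add (((hasDerivAt_fe hp (W x)).comp x (hW.d0 x hx0)).mul
          (((hasDerivAt_pow n x).sub_const (M1 ^ n)).div_const (n : ℝ)))).congr_deriv ?_
        have : (n : ℝ) ≠ 0 := by linarith
        simp only [Function.comp]
        field_simp
        ring)
      (fun x hx => by
        have e1 : fder p (W x) + (1 - 0) = p * |W x| ^ (p - 1) := by rw [fder]; ring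
        have e2 : 0 ≤ (x ^ n - M1 ^ n) / n :=
          div_nonneg (sub_nonneg.2 (pow_le_pow_left₀ hM10.le hx.1.le _)) (by linarith)
        have e3 := hneg x hx.1.le
        have e4 := rpow_nonneg (abs_nonneg (W x)) (p - 1)
        rw [e1]
        exact mul_nonpos_of_nonpos_of_nonneg
          (mul_nonpos_of_nonneg_of_nonpos (mul_nonneg (by linarith) e4) e3.le) e2)
    simp only [sub_self, zero_div, mul_zero, add_zero] at h1
    have h2 : M1 ^ (n - 1) * W1 M1 < 0 := mul_neg_of_pos_of_neg (by positivity) hneg1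
    have h3 : M1 ^ n ≤ r ^ n / 2 := by
      have e1 : (2 * M1) ^ n ≤ r ^ n := pow_le_pow_left₀ (by linarith) hr _
      have e2 : (2 : ℝ) ≤ 2 ^ n := le_self_pow₀ (by norm_num) (by omega)
      rw [mul_pow] at e1
      nlinarith [pow_pos hM10 n]
    have h4 : r ^ n = r ^ (n - 1) * r := by
      rw [← pow_succ]; congr 1; omega
    have h5 : r ^ n / 2 / n ≤ (r ^ n - M1 ^ n) / n :=
      div_le_div_of_nonneg_right (by linarith) (by linarith)
    have h6 := mul_le_mul_of_nonneg_left h5 (hfpos r (hM1.trans hr1)).le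
    rw [hfe r (hM1.trans hr1)] at h1 h6
    have hrn := pow_pos hr0 (n - 1)
    have h7 : r ^ (n - 1) * (W1 r + W r ^ (p - 1) * W r * r / (2 * n)) ≤ 0 := by
      have : W r ^ (p - 1) * W r * (r ^ n / 2 / n) =
          r ^ (n - 1) * (W r ^ (p - 1) * W r * r / (2 * n)) := by
        rw [h4]; field_simp
      linarith
    have h8 : W1 r + W r ^ (p - 1) * W r * r / (2 * n) ≤ 0 := by
      by_contra hcon
      have := mul_pos hrn (not_le.1 hcon)
      linarith
    linarith
  set c := (p - 1) / (8 * n) with hcd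
  have hc : 0 < c := div_pos (by linarith) (by linarith)
  have hbound : ∀ r, 4 * M1 ≤ r → r ^ 2 * W r ^ (p - 1) ≤ 1 / c := fun r hr => by
    have hr1 : 2 * M1 ≤ r := by linarith
    have hr0 : 0 < r := by linarith
    have h1 := le_of_hasDerivAt_nonneg
      (g := fun x => W x ^ (1 - p) - 2 * c * x ^ 2)
      (g' := fun x => W1 x * (1 - p) * W x ^ (1 - p - 1) - 4 * c * x) hr1
      (((hW.c0.mono fun x (hx : x ∈ Icc (2 * M1) r) =>
        (by linarith [hx.1] : (0 : ℝ) ≤ x)).rpow_const fun x hx =>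
          Or.inl (hpos x (by linarith [hx.1])).ne').sub (Continuous.continuousOn (by fun_prop)))
      (fun x hx => by
        have hx0 : 0 < x := by linarith [hx.1]
        refine (((hW.d0 x hx0).rpow_const (Or.inl (hpos x (by linarith [hx.1])).ne')).sub
          (((hasDerivAt_id' x).pow 2).const_mul (2 * c))).congr_deriv ?_
        push_cast
        ring)
      (fun x hx => by
        have hWx := hpos x (by linarith [hx.1])
        have e1 := hslope x hx.1.le
        have e2 : W x ^ (p - 1) * W x * W x ^ (1 - p - 1) = 1 := by
          rw [← rpow_add_one hWx.ne', ← rpow_add hWx]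
          ring_nf
          exact rpow_zero _
        have e3 := rpow_pos_of_pos hWx (1 - p - 1)
        have e4 : W x ^ (p - 1) * W x * x / (2 * n) * ((p - 1) * W x ^ (1 - p - 1)) =
            4 * c * x := by
          rw [hcd]
          have : (n : ℝ) ≠ 0 := by linarith
          have e5 : W x ^ (p - 1) * W x * x / (2 * n) * ((p - 1) * W x ^ (1 - p - 1)) =
              (p - 1) * x / (2 * n) * (W x ^ (p - 1) * W x * W x ^ (1 - p - 1)) := by ring
          rw [e5, e2]
          field_simp
          ring
        have e5 := mul_le_mul_of_nonneg_right e1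
          (mul_pos (by linarith : 0 < p - 1) e3).le
        nlinarith)
    have hWr := hpos r (by linarith)
    have h2 := rpow_pos_of_pos (hpos (2 * M1) (by linarith)) (1 - p)
    have h3 : c * r ^ 2 ≤ W r ^ (1 - p) := by
      have e1 : (2 * M1) ^ 2 ≤ r ^ 2 / 4 := by nlinarith
      have e2 := mul_le_mul_of_nonneg_left e1 hc.le
      have e3 : 0 ≤ c * r ^ 2 := by positivity
      linarith
    have h4 : W r ^ (1 - p) * W r ^ (p - 1) = 1 := by
      rw [← rpow_add hWr]; ring_nf; exact rpow_zero _
    rw [le_div_iff₀ hc]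
    have h5 := mul_le_mul_of_nonneg_right h3 (rpow_pos_of_pos hWr (p - 1)).le
    linarith
  set D := 1 / c with hDd
  have hD : 0 < D := one_div_pos.2 hc
  -- decay of `r^(n-2) W^2`
  have hexp : 0 < 4 / (p - 1) - ((n : ℝ) - 2) := by
    have e1 : 0 < p - 1 := by linarith
    rw [sub_pos, lt_div_iff₀ e1]
    rw [sub_pos, div_lt_div_iff₀ (by norm_num) (by linarith)] at hsub
    linarith
  have hZle : ∀ r, 4 * M1 ≤ r → r ^ (n - 2) * W r ^ 2 ≤
      D ^ (2 / (p - 1)) * r ^ (-(4 / (p - 1) - ((n : ℝ) - 2))) := fun r hr => by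
    have hr0 : 0 < r := by linarith
    have hWr := hpos r (by linarith)
    have e1 : W r ^ (p - 1) ≤ D * r ^ (-2 : ℝ) := by
      rw [rpow_neg hr0.le, ← div_eq_mul_inv, rpow_two, le_div_iff₀ (by positivity), mul_comm]
      exact hbound r hr
    have e2 := rpow_le_rpow (rpow_nonneg hWr.le _) e1 (z := 2 / (p - 1))
      (div_nonneg (by norm_num) (by linarith))
    have e3 : p - 1 ≠ 0 := by linarith
    rw [← rpow_mul hWr.le, mul_div_cancel₀ _ e3, rpow_two,
      mul_rpow hD.le (rpow_nonneg hr0.le _), ← rpow_mul hr0.le] at e2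
    have e4 : r ^ (n - 2) = r ^ ((n : ℝ) - 2) := by
      rw [← rpow_natCast, Nat.cast_sub (by omega)]
      norm_num
    have e5 := mul_le_mul_of_nonneg_left e2 (pow_nonneg hr0.le (n - 2))
    refine e5.trans_eq ?_
    rw [e4, mul_left_comm, ← rpow_add hr0]
    congr 2
    ring
  have hZlim : Tendsto (fun r : ℝ => D ^ (2 / (p - 1)) * r ^ (-(4 / (p - 1) - ((n : ℝ) - 2))))
      atTop (nhds 0) := by
    simpa using (tendsto_rpow_neg_atTop hexp).const_mul (D ^ (2 / (p - 1)))
  -- monotonicity of the Pohozaev functional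
  have hmono : ∀ a b, 0 ≤ a → a ≤ b → pohozaevZero n p W W1 a ≤ pohozaevZero n p W W1 b :=
    fun a b ha hab => le_of_hasDerivAt_nonneg hab
      ((continuousOn_pohozaevZero hp hW).mono fun x hx => ha.trans hx.1)
      (fun x hx => hasDerivAt_pohozaevZero hn1 hp hW (ha.trans_lt hx.1))
      (fun x hx => by
        have := ha.trans_lt hx.1
        exact mul_nonneg hsub.le (mul_nonneg (by positivity) (rpow_nonneg (abs_nonneg _) _)))
  have hN0 : 0 < pohozaevZero n p W W1 (M + 1) := by
    have e1 := lt_of_hasDerivAt_pos (by linarith : M < M + 1)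
      ((continuousOn_pohozaevZero hp hW).mono fun x hx => hM.le.trans hx.1)
      (fun x hx => hasDerivAt_pohozaevZero hn1 hp hW (hM.trans hx.1))
      (fun x hx => by
        have h0 := hM.trans hx.1
        have h1 := hpos x hx.1.le
        have h2 := abs_pos.2 h1.ne'
        positivity)
    have e2 := hmono 0 M le_rfl hM.le
    have e3 : pohozaevZero n p W W1 0 = 0 := by
      simp [pohozaevZero, zero_pow (by omega : n ≠ 0), zero_pow (by omega : n - 1 ≠ 0)]
    linarith
  set N0 := pohozaevZero n p W W1 (M + 1)
  have hδ : 0 < N0 / (2 ^ n + D) := by positivity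
  obtain ⟨r0, hr0⟩ := eventually_atTop.1 (hZlim.eventually (gt_mem_nhds hδ))
  set r := max r0 (max (4 * M1) (M + 1)) with hrd
  have hrr0 : r0 ≤ r := le_max_left _ _
  have hr4 : 4 * M1 ≤ r := (le_max_left _ _).trans (le_max_right _ _)
  have hrM : M + 1 ≤ r := (le_max_right _ _).trans (le_max_right _ _)
  have hrpos : 0 < r := by linarith
  obtain ⟨s, hs, hslo⟩ := exists_hasDerivAt_eq_slope W W1 (by linarith : r < 2 * r)
    (hW.c0.mono fun x hx => hrpos.le.trans hx.1) (fun x hx => hW.d0 x (hrpos.trans hx.1))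
  have hZ : ∀ x, r ≤ x → x ^ (n - 2) * W x ^ 2 < N0 / (2 ^ n + D) := fun x hx =>
    (hZle x (hr4.trans hx)).trans_lt (hr0 x (hrr0.trans hx))
  have hs0 : 0 < s := hrpos.trans hs.1
  have hWs := hpos s (by linarith [hs.1])
  have hWr := hpos r (by linarith)
  have hW1s := hneg s (by linarith [hs.1])
  have f1 : r * W1 s = W (2 * r) - W r := by
    rw [hslo]
    field_simp
    ring
  have f2 := hpos (2 * r) (by linarith)
  have f3 : (r * W1 s) ^ 2 ≤ W r ^ 2 := by
    have : r * W1 s < 0 := mul_neg_of_pos_of_neg hrpos hW1s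
    nlinarith
  have hpn : ∀ x : ℝ, x ^ n = x ^ (n - 2) * x ^ 2 := fun x => by
    rw [← pow_add]; congr 1; omega
  have f4 : s ^ n * W1 s ^ 2 ≤ 2 ^ n * (r ^ (n - 2) * W r ^ 2) := by
    calc s ^ n * W1 s ^ 2 ≤ (2 * r) ^ n * W1 s ^ 2 :=
          mul_le_mul_of_nonneg_right (pow_le_pow_left₀ hs0.le hs.2.le _) (sq_nonneg _)
      _ = 2 ^ n * (r ^ (n - 2) * (r * W1 s) ^ 2) := by rw [mul_pow, hpn r]; ring
      _ ≤ _ := by gcongr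
  have f5 : s ^ n * |W s| ^ (p + 1) ≤ D * (s ^ (n - 2) * W s ^ 2) := by
    rw [abs_rpow_add_one hp, abs_of_pos hWs, hpn s]
    have := mul_le_mul_of_nonneg_left (hbound s (hr4.trans hs.1.le))
      (by positivity : 0 ≤ s ^ (n - 2) * W s ^ 2)
    linarith
  have f6 : s ^ n * |W s| ^ (p + 1) / (p + 1) ≤ s ^ n * |W s| ^ (p + 1) :=
    div_le_self (mul_nonneg (by positivity) (rpow_nonneg (abs_nonneg _) _)) (by linarith)
  have f7 : ((n : ℝ) - 2) / 2 * (s ^ (n - 1) * (W s * W1 s)) ≤ 0 :=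
    mul_nonpos_of_nonneg_of_nonpos (by linarith) (mul_nonpos_of_nonneg_of_nonpos (by positivity)
      (mul_neg_of_pos_of_neg hWs hW1s).le)
  have f8 := hmono (M + 1) s (by linarith) (by linarith [hs.1])
  have f9 : pohozaevZero n p W W1 s = s ^ n * W1 s ^ 2 / 2 + s ^ n * |W s| ^ (p + 1) / (p + 1) +
      ((n : ℝ) - 2) / 2 * (s ^ (n - 1) * (W s * W1 s)) := by
    rw [pohozaevZero]; ring
  have g0 : (0 : ℝ) < 2 ^ n := by positivity
  have g1 := mul_lt_mul_of_pos_left (hZ r le_rfl) g0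
  have g2 := mul_lt_mul_of_pos_left (hZ s hs.1.le) hD
  have g3 : 2 ^ n * (N0 / (2 ^ n + D)) + D * (N0 / (2 ^ n + D)) = N0 := by
    field_simp
  have g4 : 0 ≤ s ^ n * W1 s ^ 2 := by positivity
  linarith

end oscillation

section existence

variable {n : ℕ} {p : ℝ}

/-- The polar angle of a solution of `Δw + |w|^(p-1) w = 0` is unbounded below. -/
theorem Sol.angle_unbounded (hn : 3 ≤ n) (hp : 1 < p)
    (hsub : 0 < (n : ℝ) / (p + 1) - ((n : ℝ) - 2) / 2) {w w1 B φ : ℝ → ℝ}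
    (S : Sol n p 0 1 w w1 B φ) (k : ℕ) : ∃ T > 0, φ T < Polar.level k := by
  by_contra! hcon
  have P := S.pol
  have hex : ∃ j : ℕ, ∃ M > 0, ∀ r, M ≤ r → Polar.level j < φ r :=
    ⟨k + 1, 1, one_pos, fun r hr => (Polar.level_lt_iff.2 k.lt_succ_self).trans_le
      (hcon r (by linarith))⟩
  obtain ⟨j, ⟨M, hM, hj⟩, hmin⟩ : ∃ j : ℕ, (∃ M > 0, ∀ r, M ≤ r → Polar.level j < φ r) ∧
      ∀ i < j, ¬ ∃ M > 0, ∀ r, M ≤ r → Polar.level i < φ r := by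
    classical
    exact ⟨Nat.find hex, Nat.find_spec hex, fun i hi => Nat.find_min hex hi⟩
  obtain ⟨N, hN, hne⟩ : ∃ N > 0, ∀ r, N ≤ r → w r ≠ 0 := by
    rcases j with _ | j
    · refine ⟨M, hM, fun r hr h => ?_⟩
      obtain ⟨m, hm⟩ := (P.zero_iff (hM.le.trans hr)).1 h
      have := hj r hr
      rw [hm, Polar.level_lt_iff] at this
      omega
    · have h1 := hmin j j.lt_succ_self
      push Not at h1
      obtain ⟨r, hr, hrj⟩ := h1 M hM
      have hr0 : 0 < r := hM.trans_le hr
      refine ⟨r + 1, by linarith, fun x hx h => ?_⟩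
      have h2 : φ x < Polar.level j := by
        rcases hrj.lt_or_eq with hl | hl
        · exact P.lt_of_lt (Polar.cos_level j) hr0.le hl (by linarith)
        · exact P.after (Polar.cos_level j) hr0.le hl (by linarith)
      have h3 := hj x (by linarith)
      obtain ⟨m, hm⟩ := (P.zero_iff (by linarith)).1 h
      rw [hm, Polar.level_lt_iff] at h2 h3
      omega
  have hsign : ∀ g : ℝ → ℝ, Continuous g → 0 < g N → (∀ r, N ≤ r → g r ≠ 0) →
      ∀ r, N ≤ r → 0 < g r := fun g hg h0 h r hr => by
    by_contra hle
    obtain ⟨x, hx, -, hx0, -⟩ := exists_first_zero hr hg.continuousOn h0 (not_lt.1 hle)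
    exact h x hx.le hx0
  rcases (hne N le_rfl).lt_or_gt with h | h
  · refine not_eventually_pos (W := fun r => -w r) (W1 := fun r => -w1 r) hn hp hsub ?_ hN
      (hsign _ S.cont.neg (by linarith) fun r hr => neg_ne_zero.2 (hne r hr))
    simpa only [fe_neg] using S.rad.neg
  · exact not_eventually_pos hn hp hsub S.rad hN (hsign _ S.cont h hne)

lemma Sol.rescale {α : ℝ} (hα : 0 < α) {v v1 B φ : ℝ → ℝ}
    (S : Sol n p (α ^ (1 - p)) 1 v v1 B φ) :
    Radial n (fun r => fe p 1 (α * v (α ^ ((p - 1) / 2) * r)))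
      (fun r => α * v (α ^ ((p - 1) / 2) * r))
      (fun r => α * (α ^ ((p - 1) / 2) * v1 (α ^ ((p - 1) / 2) * r))) := by
  set l := α ^ ((p - 1) / 2) with hl
  have hl0 : 0 < l := rpow_pos_of_pos hα _
  have hmaps : MapsTo (fun r : ℝ => l * r) (Ici 0) (Ici 0) := fun r hr => mul_nonneg hl0.le hr
  have hlin : ∀ r, HasDerivAt (fun r : ℝ => l * r) l r := fun r => by
    simpa using (hasDerivAt_id' r).const_mul l
  have hl2 : l ^ 2 = α ^ (p - 1) := by
    rw [hl, ← rpow_natCast, ← rpow_mul hα.le]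
    congr 1
    push_cast
    ring
  have hε : l ^ 2 * α ^ (1 - p) = 1 := by
    rw [hl2, ← rpow_add hα]
    ring_nf
    exact rpow_zero _
  refine ⟨fun r hr => ?_, fun r hr => ?_, ?_, ?_⟩
  · refine (((S.rad.d0 (l * r) (mul_pos hl0 hr)).comp r (hlin r)).const_mul α).congr_deriv ?_
    ring
  · refine ((((S.rad.d1 (l * r) (mul_pos hl0 hr)).comp r (hlin r)).const_mul l).const_mul
      α).congr_deriv ?_
    rw [fe_eq, fe_eq, abs_mul, abs_of_pos hα, mul_rpow hα.le (abs_nonneg _), ← hl2]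
    field_simp
    linear_combination (r * v (l * r)) * hε
  · exact (S.rad.c0.comp (Continuous.continuousOn (by fun_prop)) hmaps).const_smul α
  · exact ((S.rad.c1.comp (Continuous.continuousOn (by fun_prop)) hmaps).const_smul l).const_smul α

/-- For large initial values the solution oscillates arbitrarily often on `(0, R)`. -/
theorem exists_angle_lt (hn : 3 ≤ n) (hp : 1 < p)
    (hsub : 0 < (n : ℝ) / (p + 1) - ((n : ℝ) - 2) / 2) {R : ℝ} (hR : 0 < R) (k : ℕ) :
    ∃ α, 1 ≤ α ∧ ∃ u u1 A θ, Sol n p 1 α u u1 A θ ∧ θ R < Polar.level k := by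
  have hn1 : 1 ≤ n := by omega
  obtain ⟨w, w1, C, ψ, S0⟩ := exists_sol (p := p) hn1 hp le_rfl zero_le_one le_rfl
  obtain ⟨T, hT, hψ⟩ := S0.angle_unbounded hn hp hsub (k + 2)
  obtain ⟨ρ, hρ, hclose⟩ := S0.angle_close hn1 hp le_rfl zero_le_one hT.le one_pos
  have hlim : Tendsto (fun α : ℝ => α ^ (1 - p)) atTop (nhds 0) := by
    simpa using tendsto_rpow_neg_atTop (by linarith : 0 < p - 1)
  obtain ⟨α, hα, hαρ, hαT⟩ := ((eventually_ge_atTop (1 : ℝ)).and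
    ((hlim.eventually (gt_mem_nhds hρ)).and
      ((tendsto_rpow_atTop (by linarith : 0 < (p - 1) / 2)).eventually_ge_atTop (T / R)))).exists
  have hα0 : 0 < α := by linarith
  rw [div_le_iff₀ hR] at hαT
  have hε0 : 0 < α ^ (1 - p) := rpow_pos_of_pos hα0 _
  obtain ⟨v, v1, B, φ, S⟩ := exists_sol (p := p) hn1 hp hε0.le
    (rpow_le_one_of_one_le_of_nonpos hα (by linarith)) le_rfl
  obtain ⟨u, u1, A, θ, Su⟩ := exists_sol (p := p) hn1 hp zero_le_one le_rfl hα
  refine ⟨α, hα, u, u1, A, θ, Su, ?_⟩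
  have hφT : φ T < Polar.level (k + 1) := by
    have h1 := (hclose _ 1 v v1 B φ S (by simpa using hρ)
      (by rw [sub_zero, abs_of_pos hε0]; exact hαρ)).trans_le (min_le_right _ _)
    have h2 := (abs_lt.1 h1).1
    have h3 := pi_pos
    simp only [Polar.level] at hψ ⊢
    push_cast at hψ ⊢
    linarith
  have hφR := S.pol.lt_of_lt (Polar.cos_level _) hT.le hφT hαT
  have hrad := S.rescale hα0
  set l := α ^ ((p - 1) / 2)
  have hl0 : 0 < l := rpow_pos_of_pos hα0 _
  have hu : ∀ r, 0 ≤ r → u r = α * v (l * r) ∧ u1 r = α * (l * v1 (l * r)) := fun r hr =>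
    radial_unique hn1 hp Su.rad hrad (by simp [Su.u0, S.u0]) (by simp [Su.u10, S.u10]) hr
  have hang : |θ R - φ (l * R)| < π / 2 := by
    by_contra hcon
    have hmaps : MapsTo (fun r : ℝ => l * r) (Icc 0 R) (Ici 0) := fun r hr =>
      mul_nonneg hl0.le hr.1
    obtain ⟨r, hr0, -, hr, -⟩ := exists_first_zero (g := fun x => π / 2 - |θ x - φ (l * x)|) hR.le
      (continuousOn_const.sub ((Su.pol.hc.mono fun x hx => hx.1).sub
        (S.pol.hc.comp (Continuous.continuousOn (by fun_prop)) hmaps)).abs)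
      (by simp only [mul_zero, Su.pol.h0, S.pol.h0]; simp [pi_pos]) (by linarith)
    have hlr : 0 ≤ l * r := by positivity
    have h1 : u r * v (l * r) + u1 r * v1 (l * r) =
        A r * B (l * r) * cos (θ r - φ (l * r)) := by
      rw [Su.pol.hu r hr0.le, Su.pol.hu1 r hr0.le, S.pol.hu _ hlr, S.pol.hu1 _ hlr, cos_sub]
      ring
    rw [← cos_abs, ← sub_eq_zero.1 hr, cos_pi_div_two, mul_zero, (hu r hr0.le).1,
      (hu r hr0.le).2] at h1
    have h2 : v (l * r) ^ 2 + l * v1 (l * r) ^ 2 = 0 := by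
      have : α * (v (l * r) ^ 2 + l * v1 (l * r) ^ 2) = 0 := by linear_combination h1
      exact (mul_eq_zero.1 this).resolve_left hα0.ne'
    have h3 := mul_nonneg hl0.le (sq_nonneg (v1 (l * r)))
    have h4 := sq_nonneg (v (l * r))
    have h5 : v1 (l * r) ^ 2 = 0 := by
      have : l * v1 (l * r) ^ 2 = 0 := by linarith
      exact (mul_eq_zero.1 this).resolve_left hl0.ne'
    have h6 := S.pol.rho hlr
    have h7 := pow_pos (S.pol.hA _ hlr) 2
    linarith
  have h2 := (abs_lt.1 hang).2
  have h3 := pi_pos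
  simp only [Polar.level] at hφR ⊢
  push_cast at hφR
  linarith

end existence

lemma IsSolution.radial {n : ℕ} {p α : ℝ} {u u' u'' : ℝ → ℝ} (h : IsSolution n p α u u' u'') :
    Radial n (fun r => fe p 1 (u r)) u u' where
  d0 r hr := (h.hasDeriv1 r hr.le).hasDerivAt (Ici_mem_nhds hr)
  d1 r hr := ((h.hasDeriv2 r hr.le).hasDerivAt (Ici_mem_nhds hr)).congr_deriv (by
    have := h.ode r hr
    simp only [fe_one]
    linarith)
  c0 r hr := (h.hasDeriv1 r hr).continuousWithinAt
  c1 r hr := (h.hasDeriv2 r hr).continuousWithinAt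

lemma IVP.isSolution {n : ℕ} {p α : ℝ} {u u1 u2 : ℝ → ℝ}
    (h : IVP n (fun r => fe p 1 (u r)) α u u1 u2) : IsSolution n p α u u1 u2 where
  init := h.u0
  initDeriv := h.u10
  hasDeriv1 r _ := (h.d0 r).hasDerivWithinAt
  hasDeriv2 r hr := (h.d1 r hr).hasDerivWithinAt
  cont2 := h.c2.continuousOn
  ode r hr := by simpa only [fe_one] using h.ode r hr

/-- for every radius `R > 0` and every `k`, there is exactly one initial value
`α > 0` whose solution vanishes at `R` and changes sign exactly `k` times in `(0, R)`. -/
theorem statement3 (n : ℕ) (hn : 3 ≤ n) (p : ℝ) (hp1 : 1 < p)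
    (hp2 : p < ((n : ℝ) + 2) / ((n : ℝ) - 2))
    (R : ℝ) (hR : 0 < R) (k : ℕ) :
    ∃! α : ℝ, 0 < α ∧ ∃ (u u' u'' : ℝ → ℝ) (z : Fin k → ℝ),
      IsSolution n p α u u' u'' ∧ u R = 0 ∧
      StrictMono z ∧ (∀ i, 0 < z i ∧ z i < R ∧ u (z i) = 0) ∧
      (∀ r : ℝ, 0 < r → r < R → u r = 0 → ∃ i, r = z i) := by
  have hn1 : 1 ≤ n := by omega
  have hn' : (3 : ℝ) ≤ n := by exact_mod_cast hn
  have hsub : 0 < (n : ℝ) / (p + 1) - ((n : ℝ) - 2) / 2 := by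
    rw [lt_div_iff₀ (by linarith)] at hp2
    rw [sub_pos, div_lt_div_iff₀ (by norm_num) (by linarith)]
    linarith
  obtain ⟨Θ, hc, hΘ⟩ := exists_angle hn1 hp1 hR.le
  obtain ⟨β, hβ, u, u1, A, θ, S, hθ⟩ := exists_angle_lt hn hp1 hsub hR k
  rw [hΘ β _ _ _ _ hβ S] at hθ
  obtain ⟨v, v1, B, φ, T⟩ := exists_sol (p := p) hn1 hp1 zero_le_one le_rfl le_rfl
  have hφ := level_lt_angle_one hn1 hp1 T hR.le k
  rw [hΘ 1 _ _ _ _ le_rfl T] at hφ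
  obtain ⟨α, hα, hαk⟩ := intermediate_value_Icc' hβ (hc.mono fun x hx => hx.1) ⟨hθ.le, hφ.le⟩
  have key : ∀ γ : ℝ, (0 < γ ∧ ∃ (u u' u'' : ℝ → ℝ) (z : Fin k → ℝ),
      IsSolution n p γ u u' u'' ∧ u R = 0 ∧
      StrictMono z ∧ (∀ i, 0 < z i ∧ z i < R ∧ u (z i) = 0) ∧
      (∀ r : ℝ, 0 < r → r < R → u r = 0 → ∃ i, r = z i)) → 1 ≤ γ ∧ Θ γ = Polar.level k := by
    rintro γ ⟨hγ, U, U', U'', z, hU, hUR, hz, hz1, hz2⟩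
    have hγ1 := (one_lt_of_zero hn1 hp1 hγ hU.radial hU.init hU.initDeriv hR.le hUR).le
    obtain ⟨w, w1, C, ψ, W⟩ := exists_sol (p := p) hn1 hp1 zero_le_one le_rfl hγ1
    have heq : ∀ r, 0 ≤ r → w r = U r := fun r hr =>
      (radial_unique hn1 hp1 W.rad hU.radial (by rw [W.u0, hU.init])
        (by rw [W.u10, hU.initDeriv]) hr).1
    refine ⟨hγ1, ?_⟩
    rw [← hΘ γ _ _ _ _ hγ1 W]
    exact W.pol.level_of_exact_zeros hR.le (by rw [heq R hR.le, hUR]) hz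
      (fun i => ⟨(hz1 i).1, (hz1 i).2.1, by rw [heq _ (hz1 i).1.le, (hz1 i).2.2]⟩)
      (fun r h0 h1 h2 => hz2 r h0 h1 (by rw [← heq r h0.le, h2]))
  refine ⟨α, ?_, fun γ hγ => ?_⟩
  · obtain ⟨w, w1, w2, C, ψ, hw, W⟩ := exists_sol_aux (p := p) hn1 hp1 zero_le_one le_rfl hα.1
    have hψ := (hΘ α _ _ _ _ hα.1 W).trans hαk
    obtain ⟨z, hz, hz1, hz2⟩ := W.pol.exact_zeros hR.le hψ
    exact ⟨by linarith [hα.1], w, w1, w2, z, hw.isSolution, (W.pol.zero_iff hR.le).2 ⟨k, hψ⟩,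
      hz, hz1, hz2⟩
  · obtain ⟨hγ1, hγk⟩ := key γ hγ
    rcases lt_trichotomy γ α with h | h | h
    · exact (angle_unique hn hp1 hsub hR hc hΘ hγ1 h hγk hαk).elim
    · exact h
    · exact (angle_unique hn hp1 hsub hR hc hΘ hα.1 h hαk hγk).elim
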